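/- arXiv:2411.13656 — 2 statements merged into one kernel-verified Lean document; each statement's English description precedes it below -/
import Mathlib

section
/- For every integer k ≥ 1 there exists an integer M(k) such that the following holds: for every k-tangle τ in a graph G there exist a sequence of graphs G_0, …, G_m and k-tangles τ_i in G_i for each i ∈ {0,…,m} such that (i) G_0 = G and τ_0 = τ; (ii) for every i ∈ [m], the graph G_i is obtained from G_{i−1} by deleting an edge, suppressing a vertex of degree 2, or taking a proper component; (iii) for every i ∈ [m], the k-tangle τ_{i−1} in G_{i−1} survives as the k-tangle τ_i in G_i; and (iv) G_m is connected and has fewer than M(k) edges. -/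
open Finset

variable {V : Type} [Fintype V] [DecidableEq V]

/-- `{A, B}` is a separation of the graph `G`: the two sides together cover the vertex set and
no edge of `G` joins `A \ B` to `B \ A`. -/
def IsSep (G : SimpleGraph V) (A B : Finset V) : Prop :=
  A ∪ B = Finset.univ ∧ ∀ a ∈ A \ B, ∀ b ∈ B \ A, ¬ G.Adj a b

/-- `G[A₁] ∪ G[A₂] ∪ G[A₃] = G` for the induced subgraphs on `A₁`, `A₂`, `A₃`. -/
def CoversG (G : SimpleGraph V) (A₁ A₂ A₃ : Finset V) : Prop :=
  (∀ v : V, v ∈ A₁ ∨ v ∈ A₂ ∨ v ∈ A₃) ∧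
    ∀ u v : V, G.Adj u v →
      (u ∈ A₁ ∧ v ∈ A₁) ∨ (u ∈ A₂ ∧ v ∈ A₂) ∨ (u ∈ A₃ ∧ v ∈ A₃)

/-- `τ` is a `k`-tangle in `G`: a set of oriented separations of order `< k` containing exactly
one orientation of every separation of order `< k`, and no three of its elements have small
sides whose induced subgraphs together cover `G`. -/
def IsTangle (G : SimpleGraph V) (k : ℕ) (τ : Set (Finset V × Finset V)) : Prop :=
  (∀ p ∈ τ, IsSep G p.1 p.2 ∧ (p.1 ∩ p.2).card < k) ∧
    (∀ A B : Finset V, IsSep G A B → (A ∩ B).card < k → ((A, B) ∈ τ ↔ (B, A) ∉ τ)) ∧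
    ∀ p₁ ∈ τ, ∀ p₂ ∈ τ, ∀ p₃ ∈ τ, ¬ CoversG G p₁.1 p₂.1 p₃.1

/-- The graph `G' = G - v + uw` obtained from `G` by suppressing the degree-2 vertex `v` with
neighbours `u` and `w`. -/
def suppressedGraph (G : SimpleGraph V) (v u w : V) (hu : u ≠ v) (hw : w ≠ v) :
    SimpleGraph {x : V // x ≠ v} :=
  SimpleGraph.comap Subtype.val G ⊔
    SimpleGraph.fromEdgeSet {s((⟨u, hu⟩ : {x : V // x ≠ v}), (⟨w, hw⟩ : {x : V // x ≠ v}))}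

/-- The set of oriented separations of the suppressed graph induced by the tangle `τ`:
`(A, B)` with `(A ∪ {v}, B) ∈ τ` or `(A, B ∪ {v}) ∈ τ`. -/
def suppTangle (G : SimpleGraph V) (k : ℕ) (τ : Set (Finset V × Finset V))
    (v u w : V) (hu : u ≠ v) (hw : w ≠ v) :
    Set (Finset {x : V // x ≠ v} × Finset {x : V // x ≠ v}) :=
  {p | IsSep (suppressedGraph G v u w hu hw) p.1 p.2 ∧ (p.1 ∩ p.2).card < k ∧
    ((insert v (p.1.image Subtype.val), p.2.image Subtype.val) ∈ τ ∨
      (p.1.image Subtype.val, insert v (p.2.image Subtype.val)) ∈ τ)}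

/-- A bundled finite graph. -/
structure TGraph : Type 1 where
  V : Type
  fin : Fintype V
  deq : DecidableEq V
  G : SimpleGraph V

/-- The `k`-tangle `τX` in `X` survives as the `k`-tangle `τY` in `Y`, where `Y` is obtained
from `X` (up to isomorphism) by deleting an edge, suppressing a vertex of degree 2, or taking
a proper component. -/
def SurvStep (k : ℕ) (X Y : TGraph)
    (τX : Set (Finset X.V × Finset X.V)) (τY : Set (Finset Y.V × Finset Y.V)) : Prop :=
  letI := X.fin; letI := X.deq; letI := Y.fin; letI := Y.deq
  -- deleting an edge: `τX ⊆ τY` (transported along the isomorphism)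
  (∃ e ∈ X.G.edgeSet, ∃ φ : X.G.deleteEdges {e} ≃g Y.G,
      ∀ p ∈ τX, (p.1.image φ, p.2.image φ) ∈ τY) ∨
  -- suppressing a vertex `v` of degree 2 with neighbours `u`, `w`
  (∃ (v u w : X.V) (hu : u ≠ v) (hw : w ≠ v),
      u ≠ w ∧ X.G.Adj v u ∧ X.G.Adj v w ∧ (∀ x : X.V, X.G.Adj v x → x = u ∨ x = w) ∧
      ∃ φ : suppressedGraph X.G v u w hu hw ≃g Y.G,
        τY = (fun p : Finset {x : X.V // x ≠ v} × Finset {x : X.V // x ≠ v} =>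
            (p.1.image φ, p.2.image φ)) '' suppTangle X.G k τX v u w hu hw) ∨
  -- taking a proper component with vertex set `s`
  (∃ s : Finset X.V, (∃ c : X.G.ConnectedComponent, (s : Set X.V) = c.supp) ∧
      s ≠ Finset.univ ∧
      ∃ φ : SimpleGraph.comap (Subtype.val : {x : X.V // x ∈ s} → X.V) X.G ≃g Y.G,
        ∀ p ∈ τX, ((p.1.subtype (· ∈ s)).image φ, (p.2.subtype (· ∈ s)).image φ) ∈ τY)

set_option linter.unusedSectionVars false

theorem isSep_iff {G : SimpleGraph V} {A B : Finset V} :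
    IsSep G A B ↔ (∀ v, v ∈ A ∨ v ∈ B) ∧
      ∀ u v, G.Adj u v → (u ∈ A ∧ v ∈ A) ∨ (u ∈ B ∧ v ∈ B) := by
  constructor
  · rintro ⟨h1, h2⟩
    have h3 : ∀ v, v ∈ A ∨ v ∈ B := fun v => by
      have := Finset.mem_univ v
      rwa [← h1, Finset.mem_union] at this
    refine ⟨h3, fun u v huv => ?_⟩
    have h4 := h2 u
    have h5 := h2 v
    have h6 := huv.symm
    simp only [Finset.mem_sdiff] at h4 h5
    have := h3 u
    have := h3 v
    grind
  · rintro ⟨h1, h2⟩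
    refine ⟨by ext v; simpa using h1 v, fun a ha b hb hab => ?_⟩
    simp only [Finset.mem_sdiff] at ha hb
    have := h2 a b hab
    tauto

theorem IsSep.symm {G : SimpleGraph V} {A B : Finset V} (h : IsSep G A B) : IsSep G B A := by
  rw [isSep_iff] at h ⊢
  exact ⟨fun v => (h.1 v).symm, fun u v huv => (h.2 u v huv).symm⟩

theorem IsSep.inter_union {G : SimpleGraph V} {A B C D : Finset V}
    (h : IsSep G A B) (h' : IsSep G C D) : IsSep G (A ∩ C) (B ∪ D) := by
  rw [isSep_iff] at h h' ⊢
  simp only [Finset.mem_inter, Finset.mem_union]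
  refine ⟨fun v => ?_, fun u v huv => ?_⟩
  · have := h.1 v
    have := h'.1 v
    tauto
  · have := h.2 u v huv
    have := h'.2 u v huv
    tauto

theorem IsSep.union_inter {G : SimpleGraph V} {A B C D : Finset V}
    (h : IsSep G A B) (h' : IsSep G C D) : IsSep G (A ∪ C) (B ∩ D) :=
  (h.symm.inter_union h'.symm).symm

theorem IsSep.mono {G H : SimpleGraph V} {A B : Finset V} (hGH : H ≤ G) (h : IsSep G A B) :
    IsSep H A B :=
  ⟨h.1, fun a ha b hb hab => h.2 a ha b hb (hGH hab)⟩

/-- The order of separations is submodular. -/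
theorem card_inter_submodular (A B C D : Finset V) :
    ((A ∩ C) ∩ (B ∪ D)).card + ((A ∪ C) ∩ (B ∩ D)).card ≤ (A ∩ B).card + (C ∩ D).card := by
  rw [← Finset.card_union_add_card_inter, ← Finset.card_union_add_card_inter (A ∩ B)]
  refine Nat.add_le_add (Finset.card_le_card ?_) (Finset.card_le_card ?_)
  · intro v
    simp only [Finset.mem_inter, Finset.mem_union]
    tauto
  · intro v
    simp only [Finset.mem_inter, Finset.mem_union]
    tauto

/-- A family of `k` pairwise disjoint paths from `X` to `Y`; the path `l` visits the vertices
`p l 0, …, p l (len l)`. -/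
structure Linkage (G : SimpleGraph V) (k : ℕ) (X Y : Finset V) where
  p : Fin k → ℕ → V
  len : Fin k → ℕ
  start : ∀ l, p l 0 ∈ X
  finish : ∀ l, p l (len l) ∈ Y
  adj : ∀ l n, n < len l → G.Adj (p l n) (p l (n + 1))
  inj : ∀ l n l' n', n ≤ len l → n' ≤ len l' → p l n = p l' n' → l = l' ∧ n = n'

namespace Linkage

variable {G H : SimpleGraph V} {k : ℕ} {X Y : Finset V}

/-- The linkage traversed backwards. -/
def reverse (P : Linkage G k X Y) : Linkage G k Y X where
  p l n := P.p l (P.len l - n)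
  len := P.len
  start l := by simpa using P.finish l
  finish l := by simpa using P.start l
  adj l n hn := by
    have := P.adj l (P.len l - (n + 1)) (by omega)
    rw [show P.len l - (n + 1) + 1 = P.len l - n by omega] at this
    exact this.symm
  inj l n l' n' hn hn' h := by
    obtain ⟨rfl, h⟩ := P.inj l _ l' _ (Nat.sub_le _ _) (Nat.sub_le _ _) h
    exact ⟨rfl, by omega⟩

theorem exists_finish_eq (P : Linkage G k X Y) (hY : Y.card ≤ k) {z : V} (hz : z ∈ Y) :
    ∃ l, P.p l (P.len l) = z := by
  have hinj : Function.Injective fun l => P.p l (P.len l) := fun l l' h =>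
    (P.inj l _ l' _ le_rfl le_rfl h).1
  have h1 : Finset.univ.image (fun l => P.p l (P.len l)) = Y := by
    refine Finset.eq_of_subset_of_card_le ?_ ?_
    · intro v
      simp only [Finset.mem_image, Finset.mem_univ, true_and]
      rintro ⟨l, rfl⟩
      exact P.finish l
    · rw [Finset.card_image_of_injective _ hinj]
      simpa using hY
  rw [← h1] at hz
  simpa using hz

/-- A linkage from one side of a separation onto a set of `k` vertices containing the separator
stays on that side. -/
theorem mem_side (S : Finset V) {x : V} {A B : Finset V} (P : Linkage G k X S)
    (hS : S = insert x (A ∩ B)) (hcard : (A ∩ B).card < k) (hX : X ⊆ A)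
    (hsep : IsSep G A B) (l : Fin k) {n : ℕ} (hn : n ≤ P.len l) :
    P.p l n ∈ A ∧ (n < P.len l → P.p l n ∉ B) := by
  have hSk : S.card ≤ k := by
    rw [hS]
    exact (Finset.card_insert_le _ _).trans hcard
  have hmem : ∀ v, v = x ∨ (v ∈ A ∧ v ∈ B) → v ∈ S := fun v hv => by simpa [hS] using hv
  have key : ∀ m, m < P.len l → P.p l m ∉ S := by
    intro m hm hmS
    obtain ⟨l', hl'⟩ := P.exists_finish_eq hSk hmS
    obtain ⟨rfl, h⟩ := P.inj l' _ l m le_rfl hm.le hl'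
    omega
  have h2 := (isSep_iff.1 hsep).2
  have hB : P.p l n ∈ A → n < P.len l → P.p l n ∉ B := by
    intro hA hlt hB
    exact key n hlt (hmem _ (Or.inr ⟨hA, hB⟩))
  suffices hA : P.p l n ∈ A from ⟨hA, hB hA⟩
  clear hB
  induction n with
  | zero => exact hX (P.start l)
  | succ n ih =>
    have hA := ih (by omega)
    have hS' := key n (by omega)
    have := h2 _ _ (P.adj l n (by omega))
    have := hmem (P.p l n)
    tauto

theorem glue {x y : V} {A B : Finset V} (hle : H ≤ G) (hxy : G.Adj x y) (hsep : IsSep H A B)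
    (hyA : y ∉ A) (hcard : (A ∩ B).card < k)
    (hX : X ⊆ A) (hY : Y ⊆ B)
    (P : Linkage H k X (insert x (A ∩ B))) (Q : Linkage H k (insert y (A ∩ B)) Y) :
    Nonempty (Linkage G k X Y) := by
  have hP := fun l n (hn : n ≤ P.len l) => P.mem_side _ rfl hcard hX hsep l hn
  have hQ : ∀ l n, n ≤ Q.len l → Q.p l n ∈ B ∧ (0 < n → Q.p l n ∉ A) := by
    intro l n hn
    have := Q.reverse.mem_side (x := y) (A := B) (B := A) (insert y (A ∩ B))
      (by rw [Finset.inter_comm]) (by rwa [Finset.inter_comm]) hY hsep.symm l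
      (n := Q.len l - n) (Nat.sub_le _ _)
    simp only [reverse] at this
    rw [show Q.len l - (Q.len l - n) = n by omega] at this
    exact ⟨this.1, fun h => this.2 (by omega)⟩
  have hcy : (insert y (A ∩ B)).card ≤ k := (Finset.card_insert_le _ _).trans hcard
  have hstart : ∀ z ∈ insert y (A ∩ B), ∃ l, Q.p l 0 = z := fun z hz => by
    simpa [reverse] using Q.reverse.exists_finish_eq hcy hz
  have hch : ∀ l, ∃ l' δ, (δ = 0 ∧ Q.p l' 0 = P.p l (P.len l) ∧ P.p l (P.len l) ∈ B) ∨
      (δ = 1 ∧ Q.p l' 0 = y ∧ P.p l (P.len l) = x) := by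
    intro l
    rcases Finset.mem_insert.1 (P.finish l) with h | h
    · obtain ⟨l', hl'⟩ := hstart y (Finset.mem_insert_self _ _)
      exact ⟨l', 1, Or.inr ⟨rfl, hl', h⟩⟩
    · obtain ⟨l', hl'⟩ := hstart _ (Finset.mem_insert_of_mem h)
      exact ⟨l', 0, Or.inl ⟨rfl, hl', (Finset.mem_inter.1 h).2⟩⟩
  choose f δ hf using hch
  have hfinj : Function.Injective f := by
    intro l l' h
    have hl := hf l
    have hl' := hf l'
    rw [h] at hl
    have h1 := (hP l _ le_rfl).1
    have h2 := (hP l' _ le_rfl).1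
    have : P.p l (P.len l) = P.p l' (P.len l') := by
      rcases hl with ⟨_, a, b⟩ | ⟨_, a, b⟩ <;> rcases hl' with ⟨_, c, d⟩ | ⟨_, c, d⟩
      · rw [← a, c]
      · exact absurd (by rwa [← a, c] at h1) hyA
      · exact absurd (by rwa [← c, a] at h2) hyA
      · rw [b, d]
    exact (P.inj _ _ _ _ le_rfl le_rfl this).1
  have mixed : ∀ l n l' n', n ≤ P.len l → P.len l' < n' →
      n' ≤ P.len l' + δ l' + Q.len (f l') →
      P.p l n ≠ Q.p (f l') (n' - P.len l' - δ l') := by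
    intro l n l' n' hn hn' hn'' heq
    have h1 := hP l n hn
    have h2 := hQ (f l') (n' - P.len l' - δ l') (by omega)
    rw [← heq] at h2
    have h3 : n' - P.len l' - δ l' = 0 := by
      by_contra h
      exact h2.2 (by omega) h1.1
    rcases hf l' with ⟨a, b, c⟩ | ⟨a, b, c⟩
    · omega
    · rw [h3, b] at heq
      exact hyA (heq ▸ h1.1)
  refine ⟨{ p := fun l n => if n ≤ P.len l then P.p l n else Q.p (f l) (n - P.len l - δ l)
            len := fun l => P.len l + δ l + Q.len (f l)
            start := fun l => by simpa using P.start l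
            finish := fun l => ?_
            adj := fun l n hn => ?_
            inj := fun l n l' n' hn hn' h => ?_ }⟩
  · split_ifs with h
    · have h0 : Q.len (f l) = 0 := by omega
      rcases hf l with ⟨a, b, c⟩ | ⟨a, b, c⟩
      · rw [a, h0, Nat.add_zero, ← b, ← h0]
        exact Q.finish _
      · omega
    · rw [show P.len l + δ l + Q.len (f l) - P.len l - δ l = Q.len (f l) by omega]
      exact Q.finish _
  · rcases lt_trichotomy n (P.len l) with h | h | h
    · rw [if_pos h.le, if_pos (show n + 1 ≤ P.len l by omega)]
      exact hle (P.adj l n h)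
    · rw [if_pos h.le, if_neg (show ¬ n + 1 ≤ P.len l by omega), h]
      rcases hf l with ⟨a, b, c⟩ | ⟨a, b, c⟩
      · rw [← b, show P.len l + 1 - P.len l - δ l = 0 + 1 by omega]
        exact hle (Q.adj _ _ (by omega))
      · rw [show P.len l + 1 - P.len l - δ l = 0 by omega, b, c]
        exact hxy
    · rw [if_neg (show ¬ n ≤ P.len l by omega), if_neg (show ¬ n + 1 ≤ P.len l by omega)]
      have hδ : δ l ≤ 1 := by
        rcases hf l with ⟨a, -, -⟩ | ⟨a, -, -⟩ <;> omega
      rw [show n + 1 - P.len l - δ l = n - P.len l - δ l + 1 by omega]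
      exact hle (Q.adj _ _ (by omega))
  · have hδ : δ l ≤ 1 := by
      rcases hf l with ⟨a, -, -⟩ | ⟨a, -, -⟩ <;> omega
    split_ifs at h with h1 h2 h2
    · exact P.inj _ _ _ _ h1 h2 h
    · exact absurd h (mixed _ _ _ _ h1 (by omega) hn')
    · exact absurd h.symm (mixed _ _ _ _ h2 (by omega) hn)
    · obtain ⟨h3, h4⟩ := Q.inj _ _ _ _ (by omega) (by omega) h
      obtain rfl := hfinj h3
      exact ⟨rfl, by omega⟩

end Linkage

/-- Menger's theorem for sets of vertices. -/
theorem exists_linkage (k : ℕ) (G : SimpleGraph V) (X Y : Finset V)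
    (h : ∀ A B, IsSep G A B → X ⊆ A → Y ⊆ B → k ≤ (A ∩ B).card) :
    Nonempty (Linkage G k X Y) := by
  classical
  induction hm : G.edgeSet.ncard using Nat.strong_induction_on generalizing G X Y with
  | _ m ih =>
  by_cases hE : ∃ x y, G.Adj x y
  swap
  · have h1 : k ≤ (X ∩ Y).card := by
      refine (h X (Xᶜ ∪ Y) ?_ subset_rfl Finset.subset_union_right).trans
        (Finset.card_le_card ?_)
      · rw [isSep_iff]
        refine ⟨fun v => ?_, fun u v huv => absurd ⟨u, v, huv⟩ hE⟩
        simp only [Finset.mem_union, Finset.mem_compl]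
        tauto
      · intro v
        simp only [Finset.mem_inter, Finset.mem_union, Finset.mem_compl]
        tauto
    obtain ⟨f⟩ : Nonempty (Fin k ↪ (X ∩ Y : Finset V)) :=
      Function.Embedding.nonempty_of_card_le (by rw [Fintype.card_fin, Fintype.card_coe]; exact h1)
    exact ⟨{ p := fun l _ => f l
             len := fun _ => 0
             start := fun l => (Finset.mem_inter.1 (f l).2).1
             finish := fun l => (Finset.mem_inter.1 (f l).2).2
             adj := fun l n hn => absurd hn (Nat.not_lt_zero _)
             inj := fun l n l' n' hn hn' h =>
              ⟨f.injective (Subtype.ext h), by omega⟩ }⟩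
  obtain ⟨a, b, hab⟩ := hE
  set H := G.deleteEdges {s(a, b)} with hH
  have hle : H ≤ G := SimpleGraph.deleteEdges_le _
  have hadj : ∀ u v, G.Adj u v → H.Adj u v ∨ (u = a ∧ v = b) ∨ (u = b ∧ v = a) := by
    intro u v huv
    rw [hH, SimpleGraph.deleteEdges_adj]
    simp only [Set.mem_singleton_iff, Sym2.eq_iff]
    tauto
  have hlt : H.edgeSet.ncard < m := by
    rw [← hm]
    refine Set.ncard_lt_ncard ?_ (Set.toFinite _)
    rw [hH, SimpleGraph.edgeSet_deleteEdges]
    exact Set.sdiff_singleton_ssubset.2 hab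
  by_cases hsm : ∀ A B, IsSep H A B → X ⊆ A → Y ⊆ B → k ≤ (A ∩ B).card
  · obtain ⟨P⟩ := ih _ hlt H X Y hsm rfl
    exact ⟨{ P with adj := fun l n hn => hle (P.adj l n hn) }⟩
  push Not at hsm
  obtain ⟨A, B, hAB, hXA, hYB, hlk⟩ := hsm
  obtain ⟨x, y, hxy, hxA, hxB, hyA, hyB, hadj⟩ : ∃ x y, G.Adj x y ∧ x ∈ A ∧ x ∉ B ∧ y ∉ A ∧
      y ∈ B ∧ ∀ u v, G.Adj u v → H.Adj u v ∨ (u = x ∧ v = y) ∨ (u = y ∧ v = x) := by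
    have hG : ¬ IsSep G A B := fun hG => by
      have := h A B hG hXA hYB
      omega
    have h1 := isSep_iff.1 hAB
    have ha := h1.1 a
    have hb := h1.1 b
    have hn : ¬ ((a ∈ A ∧ b ∈ A) ∨ (a ∈ B ∧ b ∈ B)) := by
      intro hn
      apply hG
      rw [isSep_iff]
      refine ⟨h1.1, fun u v huv => ?_⟩
      rcases hadj u v huv with h2 | ⟨rfl, rfl⟩ | ⟨rfl, rfl⟩
      · exact h1.2 u v h2
      · exact hn
      · tauto
    by_cases haA : a ∈ A
    · exact ⟨a, b, hab, haA, by tauto, by tauto, by tauto, hadj⟩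
    · exact ⟨b, a, hab.symm, by tauto, by tauto, by tauto, by tauto,
        fun u v huv => by have := hadj u v huv; tauto⟩
  obtain ⟨P⟩ := ih _ hlt H X (insert x (A ∩ B)) (by
    intro C D hCD hXC hSD
    have h1 := isSep_iff.1 (hAB.inter_union hCD)
    refine (h (A ∩ C) (B ∪ D) ?_ (Finset.subset_inter hXA hXC)
      (hYB.trans Finset.subset_union_left)).trans (Finset.card_le_card ?_)
    · rw [isSep_iff]
      refine ⟨h1.1, fun u v huv => ?_⟩
      have hxD := hSD (Finset.mem_insert_self _ _)
      rcases hadj u v huv with h2 | ⟨rfl, rfl⟩ | ⟨rfl, rfl⟩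
      · exact h1.2 u v h2
      · simp [hxD, hyB]
      · simp [hxD, hyB]
    · intro v hv
      have := @hSD v
      simp only [Finset.mem_inter, Finset.mem_union, Finset.mem_insert] at hv this ⊢
      tauto) rfl
  obtain ⟨Q⟩ := ih _ hlt H (insert y (A ∩ B)) Y (by
    intro C D hCD hSC hYD
    have h1 := isSep_iff.1 (hAB.union_inter hCD)
    refine (h (A ∪ C) (B ∩ D) ?_ (hXA.trans Finset.subset_union_left)
      (Finset.subset_inter hYB hYD)).trans (Finset.card_le_card ?_)
    · rw [isSep_iff]
      refine ⟨h1.1, fun u v huv => ?_⟩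
      have hyC := hSC (Finset.mem_insert_self _ _)
      rcases hadj u v huv with h2 | ⟨rfl, rfl⟩ | ⟨rfl, rfl⟩
      · exact h1.2 u v h2
      · simp [hyC, hxA]
      · simp [hyC, hxA]
    · intro v hv
      have := @hSC v
      simp only [Finset.mem_inter, Finset.mem_union, Finset.mem_insert] at hv this ⊢
      tauto) rfl
  exact Linkage.glue hle hxy hAB hyA hlk hXA hYB P Q

namespace Linkage

variable {G : SimpleGraph V} {k : ℕ} {X Y : Finset V}

theorem exists_first_mem (P : Linkage G k X Y) {A C : Finset V} (hsep : IsSep G A C)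
    (hX : X ⊆ A) (hY : Y ⊆ C) (l : Fin k) :
    ∃ m ≤ P.len l, P.p l m ∈ A ∩ C ∧ ∀ n < m, P.p l n ∉ C := by
  classical
  have hex : ∃ m, P.p l m ∈ C := ⟨_, hY (P.finish l)⟩
  have hle : Nat.find hex ≤ P.len l := Nat.find_min' hex (hY (P.finish l))
  refine ⟨Nat.find hex, hle, Finset.mem_inter.2 ⟨?_, Nat.find_spec hex⟩,
    fun n hn => Nat.find_min hex hn⟩
  rcases Nat.eq_zero_or_pos (Nat.find hex) with h | h
  · rw [h]
    exact hX (P.start l)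
  · obtain ⟨m, hm⟩ : ∃ m, Nat.find hex = m + 1 := ⟨Nat.find hex - 1, by omega⟩
    have h1 := Nat.find_min hex (m := m) (by omega)
    have h2 := (isSep_iff.1 hsep).2 _ _ (P.adj l m (by omega))
    rw [hm]
    tauto

/-- Every path of a linkage of `k` paths crosses a separation of order `k` exactly once. -/
theorem exists_crossing (P : Linkage G k X Y) {A C : Finset V} (hsep : IsSep G A C)
    (hX : X ⊆ A) (hY : Y ⊆ C) (hcard : (A ∩ C).card = k) :
    ∃ a : Fin k → ℕ, (∀ l, a l ≤ P.len l) ∧ (∀ l, P.p l (a l) ∈ A ∩ C) ∧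
      (∀ l, ∀ n < a l, P.p l n ∉ C) ∧ (∀ l n, a l < n → n ≤ P.len l → P.p l n ∉ A) ∧
      ∀ v ∈ A ∩ C, ∃ l, P.p l (a l) = v := by
  choose a ha1 ha2 ha3 using P.exists_first_mem hsep hX hY
  choose b hb1 hb2 hb3 using P.reverse.exists_first_mem hsep.symm hY hX
  have hinj : Function.Injective fun l => P.p l (a l) := fun l l' h =>
    (P.inj l _ l' _ (ha1 l) (ha1 l') h).1
  have hsurj : ∀ v ∈ A ∩ C, ∃ l, P.p l (a l) = v := by
    have h1 : Finset.univ.image (fun l => P.p l (a l)) = A ∩ C := by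
      refine Finset.eq_of_subset_of_card_le ?_ ?_
      · intro v
        simp only [Finset.mem_image, Finset.mem_univ, true_and]
        rintro ⟨l, rfl⟩
        exact ha2 l
      · rw [Finset.card_image_of_injective _ hinj, hcard]
        simp
    intro v hv
    rw [← h1] at hv
    simpa using hv
  refine ⟨a, ha1, ha2, ha3, fun l n hn hn' => ?_, hsurj⟩
  have h1 : P.p l (P.len l - b l) ∈ A ∩ C := by
    rw [Finset.inter_comm]
    exact hb2 l
  obtain ⟨l', hl'⟩ := hsurj _ h1
  obtain ⟨rfl, h2⟩ := P.inj _ _ _ _ (ha1 l') (Nat.sub_le _ _) hl'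
  have h3 : b l' ≤ P.len l' := hb1 l'
  have h4 := hb3 l' (P.len l' - n) (by omega)
  simp only [reverse] at h4
  rwa [show P.len l' - (P.len l' - n) = n by omega] at h4

end Linkage

/-- `G[A]` has a separation of order at most `m` with the vertices of `Z` and those labelled by `s`
on the first side, and the vertices of `W` and those labelled by `r` on the second. -/
def HasSide (G : SimpleGraph V) {k : ℕ} (A : Finset V) (x : Fin k → V) (Z W : Finset V)
    (s r : Finset (Fin k)) (m : ℕ) : Prop :=
  ∃ P Q : Finset V, P ∪ Q = A ∧
    (∀ u ∈ A, ∀ v ∈ A, G.Adj u v → (u ∈ P ∧ v ∈ P) ∨ (u ∈ Q ∧ v ∈ Q)) ∧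
    Z ∩ A ⊆ P ∧ W ∩ A ⊆ Q ∧ (∀ l ∈ s, x l ∈ P) ∧ (∀ l ∈ r, x l ∈ Q) ∧ (P ∩ Q).card ≤ m

theorem exists_switch {P Q : Finset V} {q : ℕ → V} {a b : ℕ} (hab : a ≤ b)
    (hedge : ∀ n, a ≤ n → n < b →
      (q n ∈ P ∧ q (n + 1) ∈ P) ∨ (q n ∈ Q ∧ q (n + 1) ∈ Q))
    (ha : q a ∉ P) (hb : q b ∈ P) : ∃ n, a < n ∧ n ≤ b ∧ q n ∈ P ∩ Q := by
  classical
  have hex : ∃ n, a ≤ n ∧ q n ∈ P := ⟨b, hab, hb⟩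
  obtain ⟨h1, h2⟩ := Nat.find_spec hex
  have h3 : Nat.find hex ≤ b := Nat.find_min' hex ⟨hab, hb⟩
  have h4 : Nat.find hex ≠ a := fun h => ha (h ▸ h2)
  obtain ⟨m, hm⟩ : ∃ m, Nat.find hex = m + 1 := ⟨Nat.find hex - 1, by omega⟩
  have h5 := Nat.find_min hex (m := m) (by omega)
  have h6 := hedge m (by omega) (by omega)
  refine ⟨m + 1, by omega, by omega, ?_⟩
  rw [Finset.mem_inter]
  have : a ≤ m := by omega
  rw [hm] at h2
  tauto

/-- Disjoint paths leading from `A` to the boundary of a larger set `A'` transport separations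
of the larger graph back to the smaller one without increasing the order. -/
theorem HasSide.pull_back {G H : SimpleGraph V} {k : ℕ} {A A' : Finset V} (hA : A ⊆ A')
    (hGH : ∀ u ∈ A, ∀ v ∈ A, G.Adj u v → H.Adj u v) {q : Fin k → ℕ → V} {a b : Fin k → ℕ}
    (hab : ∀ l, a l ≤ b l)
    (hadj : ∀ l n, a l ≤ n → n < b l → H.Adj (q l n) (q l (n + 1)))
    (hqA' : ∀ l n, a l ≤ n → n ≤ b l → q l n ∈ A')
    (hqA : ∀ l n, a l < n → n ≤ b l → q l n ∉ A) (haA : ∀ l, q l (a l) ∈ A)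
    (hinj : ∀ l n l' n', n ≤ b l → n' ≤ b l' → q l n = q l' n' → l = l')
    {Z W : Finset V} {s r : Finset (Fin k)} {m : ℕ}
    (h : HasSide H A' (fun l => q l (b l)) Z W s r m) :
    HasSide G A (fun l => q l (a l)) Z W s r m := by
  obtain ⟨P, Q, hPQ, hedge, hZ, hW, hs, hr, hm⟩ := h
  have hcov : ∀ v ∈ A', v ∈ P ∨ v ∈ Q := fun v hv => by
    rwa [← hPQ, Finset.mem_union] at hv
  have hqedge : ∀ l n, a l ≤ n → n < b l →
      (q l n ∈ P ∧ q l (n + 1) ∈ P) ∨ (q l n ∈ Q ∧ q l (n + 1) ∈ Q) := fun l n h1 h2 =>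
    hedge _ (hqA' l n h1 h2.le) _ (hqA' l (n + 1) (by omega) (by omega)) (hadj l n h1 h2)
  refine ⟨P ∩ A ∪ s.image fun l => q l (a l), Q ∩ A ∪ r.image fun l => q l (a l),
    ?_, ?_, ?_, ?_, ?_, ?_, le_trans ?_ hm⟩
  · ext v
    have h1 := hcov v
    have h2 := @hA v
    have h3 : v ∈ (s.image fun l => q l (a l)) → v ∈ A := by
      rw [Finset.mem_image]
      rintro ⟨l, -, rfl⟩
      exact haA l
    have h4 : v ∈ (r.image fun l => q l (a l)) → v ∈ A := by
      rw [Finset.mem_image]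
      rintro ⟨l, -, rfl⟩
      exact haA l
    simp only [Finset.mem_union, Finset.mem_inter]
    tauto
  · intro u hu v hv huv
    have := hedge u (hA hu) v (hA hv) (hGH u hu v hv huv)
    simp only [Finset.mem_union, Finset.mem_inter]
    tauto
  · intro v hv
    have := @hZ v
    have := @hA v
    simp only [Finset.mem_union, Finset.mem_inter] at *
    tauto
  · intro v hv
    have := @hW v
    have := @hA v
    simp only [Finset.mem_union, Finset.mem_inter] at *
    tauto
  · exact fun l hl => Finset.mem_union_right _ (Finset.mem_image_of_mem _ hl)
  · exact fun l hl => Finset.mem_union_right _ (Finset.mem_image_of_mem _ hl)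
  · refine Finset.card_le_card_of_forall_subsingleton
      (fun v w => w = v ∨ ∃ l n, v = q l (a l) ∧ a l < n ∧ n ≤ b l ∧ w = q l n) ?_ ?_
    · intro v hv
      by_cases hvPQ : v ∈ P ∩ Q
      · exact ⟨v, hvPQ, Or.inl rfl⟩
      simp only [Finset.mem_union, Finset.mem_inter, Finset.mem_image] at hv hvPQ
      have hcase : (v ∉ P ∧ ∃ l ∈ s, q l (a l) = v) ∨ (v ∉ Q ∧ ∃ l ∈ r, q l (a l) = v) := by
        by_cases hP : v ∈ P
        · exact Or.inr ⟨fun hQ => hvPQ ⟨hP, hQ⟩, hv.2.resolve_left fun h => hvPQ ⟨hP, h.1⟩⟩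
        · exact Or.inl ⟨hP, hv.1.resolve_left fun h => hP h.1⟩
      rcases hcase with ⟨h1, l, hl, rfl⟩ | ⟨h1, l, hl, rfl⟩
      · obtain ⟨n, hn1, hn2, hn3⟩ := exists_switch (hab l) (hqedge l) h1 (hs l hl)
        exact ⟨_, hn3, Or.inr ⟨l, n, rfl, hn1, hn2, rfl⟩⟩
      · obtain ⟨n, hn1, hn2, hn3⟩ := exists_switch (hab l)
          (fun n h1 h2 => (hqedge l n h1 h2).symm) h1 (hr l hl)
        exact ⟨_, Finset.inter_comm Q P ▸ hn3, Or.inr ⟨l, n, rfl, hn1, hn2, rfl⟩⟩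
    · intro w _ v hv v' hv'
      have hAof : ∀ v, v ∈ (P ∩ A ∪ s.image fun l => q l (a l)) ∩
          (Q ∩ A ∪ r.image fun l => q l (a l)) → v ∈ A := by
        intro v hv
        simp only [Finset.mem_union, Finset.mem_inter, Finset.mem_image] at hv
        rcases hv.1 with h | ⟨l, -, rfl⟩
        · exact h.2
        · exact haA l
      have h1 := hAof v hv.1
      have h1' := hAof v' hv'.1
      rcases hv.2 with h | ⟨l, n, rfl, h2, h3, h4⟩ <;>
        rcases hv'.2 with h' | ⟨l', n', rfl, h2', h3', h4'⟩
      · exact h.symm.trans h'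
      · exact absurd (h4' ▸ h ▸ h1) (hqA l' n' h2' h3')
      · exact absurd (h4 ▸ h' ▸ h1') (hqA l n h2 h3)
      · rw [hinj l n l' n' h3 h3' (h4.symm.trans h4')]

/-- If the parts `G[A]` and `G[A']` have the same separations, then a subgraph `H` which differs
from `G` only between `A` and `C'`, and contains linking paths there, has no
more separations than `G` as far as `T` is concerned. -/
theorem exists_isSep_of_hasSide {G H : SimpleGraph V} {k : ℕ} {T A A' C' : Finset V}
    (hsep : IsSep G A' C') (hA : A ⊆ A')
    (hGH : ∀ u ∈ A, ∀ v ∈ A, G.Adj u v → H.Adj u v)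
    (hGH' : ∀ u ∈ C', ∀ v ∈ C', G.Adj u v → H.Adj u v)
    {q : Fin k → ℕ → V} {a b : Fin k → ℕ} (hab : ∀ l, a l ≤ b l)
    (hadj : ∀ l n, a l ≤ n → n < b l → H.Adj (q l n) (q l (n + 1)))
    (hqA' : ∀ l n, a l ≤ n → n ≤ b l → q l n ∈ A')
    (hqA : ∀ l n, a l < n → n ≤ b l → q l n ∉ A) (haA : ∀ l, q l (a l) ∈ A)
    (hinj : ∀ l n l' n', n ≤ b l → n' ≤ b l' → q l n = q l' n' → l = l')
    (hbd : ∀ v ∈ A' ∩ C', ∃ l, q l (b l) = v)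
    (hprof : ∀ Z ⊆ T, ∀ W ⊆ T, ∀ s r, ∀ m < k, HasSide G A (fun l => q l (a l)) Z W s r m →
      HasSide G A' (fun l => q l (b l)) Z W s r m)
    {D E : Finset V} (hDE : IsSep H D E) (hcard : (D ∩ E).card < k) :
    ∃ D' E', IsSep G D' E' ∧ (D' ∩ E').card < k ∧ D ∩ T ⊆ D' ∧ E ∩ T ⊆ E' := by
  classical
  rw [isSep_iff] at hsep hDE
  have h0 : HasSide H A' (fun l => q l (b l)) (D ∩ T) (E ∩ T)
      (Finset.univ.filter fun l => q l (b l) ∈ D) (Finset.univ.filter fun l => q l (b l) ∈ E)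
      (D ∩ E ∩ A').card := by
    refine ⟨D ∩ A', E ∩ A', ?_, ?_, ?_, ?_, ?_, ?_, ?_⟩
    · ext v
      have := hDE.1 v
      simp only [Finset.mem_union, Finset.mem_inter]
      tauto
    · intro u hu v hv huv
      have := hDE.2 u v huv
      simp only [Finset.mem_inter]
      tauto
    · exact Finset.inter_subset_inter_right Finset.inter_subset_left
    · exact Finset.inter_subset_inter_right Finset.inter_subset_left
    · intro l hl
      exact Finset.mem_inter.2 ⟨(Finset.mem_filter.1 hl).2, hqA' l _ (hab l) le_rfl⟩
    · intro l hl
      exact Finset.mem_inter.2 ⟨(Finset.mem_filter.1 hl).2, hqA' l _ (hab l) le_rfl⟩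
    · refine Finset.card_le_card fun v hv => ?_
      simp only [Finset.mem_inter] at hv ⊢
      tauto
  obtain ⟨P, Q, hPQ, hedge, hZ, hW, hs, hr, hm⟩ :=
    hprof _ Finset.inter_subset_right _ Finset.inter_subset_right _ _ _
      ((Finset.card_le_card Finset.inter_subset_left).trans_lt hcard)
      (h0.pull_back hA hGH hab hadj hqA' hqA haA hinj)
  have hcov : ∀ v, v ∈ A' ↔ v ∈ P ∨ v ∈ Q := fun v => by rw [← hPQ, Finset.mem_union]
  have hsP : ∀ v, v ∈ A' → v ∈ C' → v ∈ D → v ∈ P := by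
    intro v h1 h2 h3
    obtain ⟨l, rfl⟩ := hbd v (Finset.mem_inter.2 ⟨h1, h2⟩)
    exact hs l (Finset.mem_filter.2 ⟨Finset.mem_univ _, h3⟩)
  have hrQ : ∀ v, v ∈ A' → v ∈ C' → v ∈ E → v ∈ Q := by
    intro v h1 h2 h3
    obtain ⟨l, rfl⟩ := hbd v (Finset.mem_inter.2 ⟨h1, h2⟩)
    exact hr l (Finset.mem_filter.2 ⟨Finset.mem_univ _, h3⟩)
  refine ⟨P ∪ (D ∩ C'), Q ∪ (E ∩ C'), ?_, ?_, ?_, ?_⟩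
  · rw [isSep_iff]
    simp only [Finset.mem_union, Finset.mem_inter]
    refine ⟨fun v => ?_, fun u v huv => ?_⟩
    · have := hcov v
      have := hsep.1 v
      have := hDE.1 v
      tauto
    · rcases hsep.2 u v huv with ⟨h1, h2⟩ | ⟨h1, h2⟩
      · exact (hedge u h1 v h2 huv).imp (fun h => ⟨Or.inl h.1, Or.inl h.2⟩)
          fun h => ⟨Or.inl h.1, Or.inl h.2⟩
      · exact (hDE.2 u v (hGH' u h1 v h2 huv)).imp
          (fun h => ⟨Or.inr ⟨h.1, h1⟩, Or.inr ⟨h.2, h2⟩⟩)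
          fun h => ⟨Or.inr ⟨h.1, h1⟩, Or.inr ⟨h.2, h2⟩⟩
  · refine lt_of_le_of_lt ?_ hcard
    calc _ ≤ ((P ∩ Q) ∪ ((D ∩ E) \ A')).card := by
          refine Finset.card_le_card fun v hv => ?_
          have := hcov v
          have := hsP v
          have := hrQ v
          simp only [Finset.mem_union, Finset.mem_inter, Finset.mem_sdiff] at hv ⊢
          tauto
      _ ≤ (P ∩ Q).card + ((D ∩ E) \ A').card := Finset.card_union_le _ _
      _ ≤ (D ∩ E ∩ A').card + ((D ∩ E) \ A').card := by omega
      _ = (D ∩ E).card := Finset.card_inter_add_card_sdiff _ _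
  · intro v hv
    have h1 := @hZ v
    have := hsep.1 v
    simp only [Finset.mem_union, Finset.mem_inter] at hv h1 ⊢
    tauto
  · intro v hv
    have h1 := @hW v
    have := hsep.1 v
    simp only [Finset.mem_union, Finset.mem_inter] at hv h1 ⊢
    tauto

/-- A separation of order `k` with `X` on the first side and `Y` on the second. -/
def IsTight (G : SimpleGraph V) (k : ℕ) (X Y A C : Finset V) : Prop :=
  IsSep G A C ∧ X ⊆ A ∧ Y ⊆ C ∧ (A ∩ C).card = k

theorem IsTight.subset_of_minimal {G : SimpleGraph V} {k : ℕ} {X Y A C A' C' : Finset V}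
    (hmin : ∀ A B, IsSep G A B → X ⊆ A → Y ⊆ B → k ≤ (A ∩ B).card)
    (h : IsTight G k X Y A C) (h' : IsTight G k X Y A' C') {u : V} (hu : u ∈ A ∩ C)
    (hu' : u ∈ A')
    (hA : ∀ A'' C'', IsTight G k X Y A'' C'' → u ∈ A'' ∩ C'' → A.card ≤ A''.card) :
    A ⊆ A' := by
  have h1 := hmin _ _ (h.1.inter_union h'.1) (Finset.subset_inter h.2.1 h'.2.1)
    (h.2.2.1.trans Finset.subset_union_left)
  have h2 := hmin _ _ (h.1.union_inter h'.1) (h.2.1.trans Finset.subset_union_left)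
    (Finset.subset_inter h.2.2.1 h'.2.2.1)
  have h3 := card_inter_submodular A C A' C'
  rw [h.2.2.2, h'.2.2.2] at h3
  have h4 := hA (A ∩ A') (C ∪ C') ⟨h.1.inter_union h'.1, Finset.subset_inter h.2.1 h'.2.1,
    h.2.2.1.trans Finset.subset_union_left, by omega⟩ (by
      simp only [Finset.mem_inter, Finset.mem_union] at hu ⊢
      tauto)
  exact Finset.inter_eq_left.1 (Finset.eq_of_subset_of_card_le Finset.inter_subset_left h4)

/-- No vertex has degree two. -/
def NoDegreeTwo (G : SimpleGraph V) : Prop :=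
  ∀ v u w, u ≠ w → G.Adj v u → G.Adj v w → ∃ x, G.Adj v x ∧ x ≠ u ∧ x ≠ w

/-- `D, E` is a separation of order less than `k` of some graph whose trace on `T` is not the trace
of a separation of `G` of order less than `k`. -/
def IsNewSep (G : SimpleGraph V) (k : ℕ) (T D E : Finset V) : Prop :=
  (D ∩ E).card < k ∧ ∀ D' E', IsSep G D' E' → (D' ∩ E').card < k → D ∩ T ⊆ D' → ¬ E ∩ T ⊆ E'

/-- The deletion of any edge outside `G[T]` creates a new small separation of `T`. -/
def IsCritical (G : SimpleGraph V) (k : ℕ) (T : Finset V) : Prop :=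
  ∀ u v, G.Adj u v → ¬ (u ∈ T ∧ v ∈ T) →
    ∃ D E, IsSep (G.deleteEdges {s(u, v)}) D E ∧ IsNewSep G k T D E

/-- Bound on the number of tight vertices on one path of a linkage. -/
def tightBound (k t : ℕ) : ℕ := t + (2 ^ t * (2 ^ t * (2 ^ k * (2 ^ k * k))) + 1) * 2

theorem card_tight_le {G : SimpleGraph V} {k : ℕ} {X Y T : Finset V} (P : Linkage G k X Y)
    (hmin : ∀ A B, IsSep G A B → X ⊆ A → Y ⊆ B → k ≤ (A ∩ B).card)
    (hdeg : NoDegreeTwo G) (hcrit : IsCritical G k T) (l : Fin k) (S : Finset ℕ)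
    (hS : ∀ n ∈ S, n < P.len l ∧ ∃ A C, IsTight G k X Y A C ∧ P.p l n ∈ A ∩ C) :
    S.card ≤ tightBound k T.card := by
  classical
  by_contra! hlt
  have hS1 : (S.filter fun n => P.p l (n + 1) ∈ T).card ≤ T.card := by
    refine Finset.card_le_card_of_injOn (fun n => P.p l (n + 1))
      (fun n hn => (Finset.mem_filter.1 hn).2) fun n hn n' hn' h => ?_
    have h1 := (hS n (Finset.mem_filter.1 hn).1).1
    have h2 := (hS n' (Finset.mem_filter.1 hn').1).1
    have := (P.inj _ _ _ _ (by omega) (by omega) h).2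
    omega
  have hS2 := Finset.card_filter_add_card_filter_not (s := S) fun n => P.p l (n + 1) ∈ T
  set S' := S.filter fun n => ¬ P.p l (n + 1) ∈ T with hS'
  have hS'lt : (2 ^ T.card * (2 ^ T.card * (2 ^ k * (2 ^ k * k))) + 1) * 2 < S'.card := by
    rw [tightBound] at hlt
    omega
  have hex : ∀ n ∈ S', ∃ A C, (IsTight G k X Y A C ∧ P.p l n ∈ A ∩ C) ∧
      ∀ A' C', IsTight G k X Y A' C' → P.p l n ∈ A' ∩ C' → A.card ≤ A'.card := by
    intro n hn
    obtain ⟨A, C, h⟩ := (hS n (Finset.mem_filter.1 hn).1).2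
    obtain ⟨⟨A₀, C₀⟩, h0, h1⟩ := exists_minimalFor_of_wellFoundedLT
      (fun p : Finset V × Finset V => IsTight G k X Y p.1 p.2 ∧ P.p l n ∈ p.1 ∩ p.2)
      (fun p => p.1.card) ⟨(A, C), h⟩
    refine ⟨A₀, C₀, h0, fun A' C' h2 h3 => ?_⟩
    rcases le_total A₀.card A'.card with h | h
    · exact h
    · exact h1 (j := (A', C')) ⟨h2, h3⟩ h
  choose! A C hAC hACmin using hex
  have hcross : ∀ n ∈ S', ∃ a : Fin k → ℕ, (∀ l, a l ≤ P.len l) ∧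
      (∀ l, P.p l (a l) ∈ A n ∩ C n) ∧ (∀ l, ∀ m < a l, P.p l m ∉ C n) ∧
      (∀ l m, a l < m → m ≤ P.len l → P.p l m ∉ A n) ∧
      ∀ v ∈ A n ∩ C n, ∃ l, P.p l (a l) = v := fun n hn =>
    P.exists_crossing (hAC n hn).1.1 (hAC n hn).1.2.1 (hAC n hn).1.2.2.1 (hAC n hn).1.2.2.2
  choose! a halen ha haC haA hasurj using hcross
  have hlen : ∀ n ∈ S', n < P.len l := fun n hn => (hS n (Finset.mem_filter.1 hn).1).1
  have hal : ∀ n ∈ S', a n l = n := by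
    intro n hn
    obtain ⟨l', hl'⟩ := hasurj n hn _ (hAC n hn).2
    obtain ⟨rfl, h⟩ := P.inj _ _ _ _ (halen n hn l') (hlen n hn).le hl'
    exact h
  have hmemA : ∀ n ∈ S', ∀ l m, m ≤ a n l → P.p l m ∈ A n := by
    intro n hn l m hm
    rcases hm.lt_or_eq with h | rfl
    · exact ((isSep_iff.1 (hAC n hn).1.1).1 _).resolve_right (haC n hn l m h)
    · exact (Finset.mem_inter.1 (ha n hn l)).1
  let F : Finset (Finset V × Finset V × Finset (Fin k) × Finset (Fin k) × Fin k) :=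
    T.powerset ×ˢ T.powerset ×ˢ univ ×ˢ univ ×ˢ univ
  have hF : F.card = 2 ^ T.card * (2 ^ T.card * (2 ^ k * (2 ^ k * k))) := by
    simp only [F, Finset.card_product, Finset.card_powerset, Finset.card_univ,
      Fintype.card_finset, Fintype.card_fin]
  let prof : ℕ → Finset (Finset V × Finset V × Finset (Fin k) × Finset (Fin k) × Fin k) :=
    fun n => F.filter fun t => HasSide G (A n) (fun l => P.p l (a n l)) t.1 t.2.1 t.2.2.1
      t.2.2.2.1 t.2.2.2.2
  obtain ⟨c, -, hc⟩ := Finset.exists_lt_card_fiber_of_mul_lt_card_of_maps_to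
    (s := S') (t := Finset.range (F.card + 1)) (f := fun n => (prof n).card) (n := 2)
    (fun n _ => Finset.mem_range.2 (Nat.lt_succ_of_le (Finset.card_filter_le _ _)))
    (by rw [Finset.card_range, hF]; exact hS'lt)
  set R := S'.filter fun n => (prof n).card = c with hR
  have hRne : R.Nonempty := Finset.card_pos.1 (by omega)
  obtain ⟨n, hn, hnmin⟩ : ∃ n ∈ R, ∀ m ∈ R, n ≤ m :=
    ⟨R.min' hRne, R.min'_mem hRne, fun m hm => R.min'_le m hm⟩
  obtain ⟨n', hn', hnmax⟩ : ∃ n ∈ R, ∀ m ∈ R, m ≤ n :=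
    ⟨R.max' hRne, R.max'_mem hRne, fun m hm => R.le_max' m hm⟩
  have hgap : n + 2 ≤ n' := by
    have : R ⊆ Finset.Icc n n' := fun m hm => Finset.mem_Icc.2 ⟨hnmin m hm, hnmax m hm⟩
    have := Finset.card_le_card this
    rw [Nat.card_Icc] at this
    omega
  obtain ⟨hnS, hnc⟩ := Finset.mem_filter.1 hn
  obtain ⟨hnS', hnc'⟩ := Finset.mem_filter.1 hn'
  have hn'len := hlen n' hnS'
  have hsub : A n ⊆ A n' := by
    refine (hAC n hnS).1.subset_of_minimal hmin (hAC n' hnS').1 (hAC n hnS).2 ?_ (hACmin n hnS)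
    exact hmemA n' hnS' l n (by rw [hal n' hnS']; omega)
  have hle : ∀ l, a n l ≤ a n' l := by
    intro l
    by_contra! h
    exact haA n' hnS' l (a n l) h (halen n hnS l) (hsub (hmemA n hnS l _ le_rfl))
  have hqA' : ∀ l m, a n l ≤ m → m ≤ a n' l → P.p l m ∈ A n' := fun l m _ h =>
    hmemA n' hnS' l m h
  have hqA : ∀ l m, a n l < m → m ≤ a n' l → P.p l m ∉ A n := fun l m h1 h2 =>
    haA n hnS l m h1 (h2.trans (halen n' hnS' l))
  have haA : ∀ l, P.p l (a n l) ∈ A n := fun l => hmemA n hnS l _ le_rfl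
  have hinj : ∀ l m l' m', m ≤ a n' l → m' ≤ a n' l' → P.p l m = P.p l' m' → l = l' :=
    fun l m l' m' h1 h2 h =>
      (P.inj _ _ _ _ (h1.trans (halen n' hnS' l)) (h2.trans (halen n' hnS' l')) h).1
  have hprof : prof n' = prof n := by
    refine Finset.eq_of_subset_of_card_le (fun t ht => ?_) (hnc.trans hnc'.symm).le
    rw [Finset.mem_filter] at ht ⊢
    exact ⟨ht.1, ht.2.pull_back (H := G) hsub (fun u _ v _ h => h) hle
      (fun l m _ h2 => P.adj l m (h2.trans_le (halen n' hnS' l))) hqA' hqA haA hinj⟩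
  have hvT : P.p l (n + 1) ∉ T := (Finset.mem_filter.1 hnS).2
  obtain ⟨z, hvz, hz, hz'⟩ := hdeg (P.p l (n + 1)) (P.p l n) (P.p l (n + 2))
    (fun h => by
      have := (P.inj _ _ _ _ (by omega) (by omega) h).2
      omega)
    (P.adj l n (by omega)).symm (P.adj l (n + 1) (by omega))
  obtain ⟨D, E, hDE, hcard, hnew⟩ := hcrit _ z hvz fun h => hvT h.1
  have hkeep : ∀ u w, G.Adj u w → (u = P.p l (n + 1) → w ≠ z) → (w = P.p l (n + 1) → u ≠ z) →
      (G.deleteEdges {s(P.p l (n + 1), z)}).Adj u w := by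
    intro u w huw h1 h2
    rw [SimpleGraph.deleteEdges_adj]
    refine ⟨huw, ?_⟩
    rw [Set.mem_singleton_iff, Sym2.eq_iff]
    tauto
  have hvA : P.p l (n + 1) ∉ A n := hqA l (n + 1) (by rw [hal n hnS]; omega)
    (by rw [hal n' hnS']; omega)
  have hvC : P.p l (n + 1) ∉ C n' := haC n' hnS' l (n + 1) (by rw [hal n' hnS']; omega)
  obtain ⟨D', E', h1, h2, h3, h4⟩ := exists_isSep_of_hasSide (T := T) (hAC n' hnS').1.1 hsub
    (fun u hu w hw huw => hkeep u w huw (fun h => absurd (h ▸ hu) hvA)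
      fun h => absurd (h ▸ hw) hvA)
    (fun u hu w hw huw => hkeep u w huw (fun h => absurd (h ▸ hu) hvC)
      fun h => absurd (h ▸ hw) hvC)
    hle (fun l' m h1 h2 => by
      have h3 := halen n' hnS' l'
      refine hkeep _ _ (P.adj l' m (by omega)) (fun h => ?_) fun h => ?_
      · obtain ⟨rfl, rfl⟩ := P.inj _ _ _ _ (by omega) (by omega) h
        exact hz'.symm
      · obtain ⟨rfl, h⟩ := P.inj _ _ _ _ (by omega) (by omega) h
        rw [show m = n by omega]
        exact hz.symm)
    hqA' hqA haA hinj (hasurj n' hnS')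
    (fun Z hZ W hW s r m hm h => by
      have ht : (Z, W, s, r, (⟨m, hm⟩ : Fin k)) ∈ prof n := by
        simp only [prof, F, Finset.mem_filter, Finset.mem_product, Finset.mem_powerset,
          Finset.mem_univ, and_true]
        exact ⟨⟨hZ, hW⟩, h⟩
      rw [← hprof] at ht
      exact (Finset.mem_filter.1 ht).2)
    hDE hcard
  exact hnew D' E' h1 h2 h3 h4

theorem tightBound_mono (k : ℕ) : Monotone (tightBound k) := by
  intro s t h
  unfold tightBound
  gcongr <;> norm_num

theorem exists_tight_of_isNewSep {G : SimpleGraph V} {k : ℕ} {X Y D E : Finset V} {e : Sym2 V}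
    (P : Linkage G k X Y) (hmin : ∀ A B, IsSep G A B → X ⊆ A → Y ⊆ B → k ≤ (A ∩ B).card)
    (hDE : IsSep (G.deleteEdges {e}) D E) (hX : X ⊆ D) (hY : Y ⊆ E) (hcard : (D ∩ E).card < k) :
    ∃ l n, n < P.len l ∧ s(P.p l n, P.p l (n + 1)) = e ∧
      ∃ A C, IsTight G k X Y A C ∧ P.p l n ∈ A ∩ C := by
  obtain ⟨l, n, hn, he⟩ : ∃ l n, n < P.len l ∧ s(P.p l n, P.p l (n + 1)) = e := by
    by_contra! hno
    let P' : Linkage (G.deleteEdges {e}) k X Y :=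
      { P with
        adj := fun l n hn => by
          rw [SimpleGraph.deleteEdges_adj]
          exact ⟨P.adj l n hn, hno l n hn⟩ }
    choose a ha1 ha2 _ using P'.exists_first_mem hDE hX hY
    have : (Finset.univ : Finset (Fin k)).card ≤ (D ∩ E).card :=
      Finset.card_le_card_of_injOn (fun l => P.p l (a l)) (fun l _ => ha2 l)
        fun l _ l' _ h => (P.inj _ _ _ _ (ha1 l) (ha1 l') h).1
    rw [Finset.card_univ, Fintype.card_fin] at this
    omega
  refine ⟨l, n, hn, he, ?_⟩
  have h1 := isSep_iff.1 hDE
  have hadj : ∀ u v, G.Adj u v → (G.deleteEdges {e}).Adj u v ∨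
      (u = P.p l n ∧ v = P.p l (n + 1)) ∨ (u = P.p l (n + 1) ∧ v = P.p l n) := by
    intro u v huv
    rw [SimpleGraph.deleteEdges_adj, Set.mem_singleton_iff, ← he, Sym2.eq_iff]
    tauto
  generalize P.p l n = u at hadj
  generalize P.p l (n + 1) = v at hadj
  have hu := h1.1 u
  have hv := h1.1 v
  have hD : v ∈ D → IsSep G (insert u D) E := by
    intro hv
    rw [isSep_iff]
    simp only [Finset.mem_insert]
    refine ⟨fun w => (h1.1 w).imp_left Or.inr, fun a b hab => ?_⟩
    rcases hadj a b hab with h | ⟨rfl, rfl⟩ | ⟨rfl, rfl⟩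
    · exact (h1.2 a b h).imp_left fun h => ⟨Or.inr h.1, Or.inr h.2⟩
    · exact Or.inl ⟨Or.inl rfl, Or.inr hv⟩
    · exact Or.inl ⟨Or.inr hv, Or.inl rfl⟩
  have hE : v ∈ E → IsSep G D (insert u E) := by
    intro hv
    rw [isSep_iff]
    simp only [Finset.mem_insert]
    refine ⟨fun w => (h1.1 w).imp_right Or.inr, fun a b hab => ?_⟩
    rcases hadj a b hab with h | ⟨rfl, rfl⟩ | ⟨rfl, rfl⟩
    · exact (h1.2 a b h).imp_right fun h => ⟨Or.inr h.1, Or.inr h.2⟩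
    · exact Or.inr ⟨Or.inl rfl, Or.inr hv⟩
    · exact Or.inr ⟨Or.inr hv, Or.inl rfl⟩
  have hDsub : X ⊆ insert u D := hX.trans (Finset.subset_insert _ _)
  have hEsub : Y ⊆ insert u E := hY.trans (Finset.subset_insert _ _)
  have hcD : (insert u D ∩ E).card ≤ k := by
    refine le_trans (Finset.card_le_card (t := insert u (D ∩ E)) ?_)
      ((Finset.card_insert_le _ _).trans hcard)
    intro w
    simp only [Finset.mem_inter, Finset.mem_insert]
    tauto
  have hcE : (D ∩ insert u E).card ≤ k := by
    refine le_trans (Finset.card_le_card (t := insert u (D ∩ E)) ?_)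
      ((Finset.card_insert_le _ _).trans hcard)
    intro w
    simp only [Finset.mem_inter, Finset.mem_insert]
    tauto
  have hnot : ¬ IsSep G D E := fun h => by
    have := hmin D E h hX hY
    omega
  rcases hv with hv | hv
  · have huD : u ∉ D := fun h => hnot (by simpa [h] using hD hv)
    exact ⟨_, _, ⟨hD hv, hDsub, hY, le_antisymm hcD (hmin _ _ (hD hv) hDsub hY)⟩,
      Finset.mem_inter.2 ⟨Finset.mem_insert_self _ _, hu.resolve_left huD⟩⟩
  · have huE : u ∉ E := fun h => hnot (by simpa [h] using hE hv)
    exact ⟨_, _, ⟨hE hv, hX, hEsub, le_antisymm hcE (hmin _ _ (hE hv) hX hEsub)⟩,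
      Finset.mem_inter.2 ⟨hu.resolve_right huE, Finset.mem_insert_self _ _⟩⟩

/-- Bound on the number of edges of a critical graph without vertices of degree two. -/
def edgeBound (k t : ℕ) : ℕ := t * t + 2 ^ t * 2 ^ t * (k * tightBound k t) + 1

theorem card_newSep_edges_le {G : SimpleGraph V} {k : ℕ} {T X Y : Finset V}
    (hdeg : NoDegreeTwo G) (hcrit : IsCritical G k T) (F : Finset (Sym2 V))
    (hF : ∀ e ∈ F, ∃ D E, IsSep (G.deleteEdges {e}) D E ∧ IsNewSep G k T D E ∧
      D ∩ T = X ∧ E ∩ T = Y) :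
    F.card ≤ k * tightBound k T.card := by
  classical
  rcases F.eq_empty_or_nonempty with rfl | ⟨e₀, he₀⟩
  · simp
  have hmin : ∀ A B, IsSep G A B → X ⊆ A → Y ⊆ B → k ≤ (A ∩ B).card := by
    obtain ⟨D, E, -, ⟨-, h⟩, rfl, rfl⟩ := hF e₀ he₀
    intro A B hAB hX hY
    by_contra! hlt
    exact h A B hAB hlt hX hY
  obtain ⟨P⟩ := exists_linkage k G X Y hmin
  let S : Fin k → Finset ℕ := fun l => (Finset.range (P.len l)).filter fun n =>
    ∃ A C, IsTight G k X Y A C ∧ P.p l n ∈ A ∩ C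
  have hS : ∀ l, (S l).card ≤ tightBound k T.card := fun l =>
    card_tight_le P hmin hdeg hcrit l (S l) fun n hn => by
      simpa only [S, Finset.mem_filter, Finset.mem_range] using hn
  have hsub : F ⊆ Finset.univ.biUnion fun l =>
      (S l).image fun n => s(P.p l n, P.p l (n + 1)) := by
    intro e he
    obtain ⟨D, E, hDE, ⟨hcard, -⟩, rfl, rfl⟩ := hF e he
    obtain ⟨l, n, hn, hne, h⟩ := exists_tight_of_isNewSep P hmin hDE Finset.inter_subset_left
      Finset.inter_subset_left hcard
    simp only [S, Finset.mem_biUnion, Finset.mem_univ, true_and, Finset.mem_image,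
      Finset.mem_filter, Finset.mem_range]
    exact ⟨l, n, ⟨hn, h⟩, hne⟩
  calc F.card ≤ _ := Finset.card_le_card hsub
    _ ≤ _ := Finset.card_biUnion_le_card_mul _ _ (tightBound k T.card)
      fun l _ => Finset.card_image_le.trans (hS l)
    _ = _ := by rw [Finset.card_univ, Fintype.card_fin]

theorem ncard_edgeSet_lt {G : SimpleGraph V} {k t : ℕ} {T : Finset V} (hT : T.card ≤ t)
    (hdeg : NoDegreeTwo G) (hcrit : IsCritical G k T) :
    G.edgeSet.ncard < edgeBound k t := by
  classical
  let F : Finset V → Finset V → Finset (Sym2 V) := fun X Y => Finset.univ.filter fun e =>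
    ∃ D E, IsSep (G.deleteEdges {e}) D E ∧ IsNewSep G k T D E ∧ D ∩ T = X ∧ E ∩ T = Y
  let U : Finset (Sym2 V) := (T ×ˢ T).image (fun p => s(p.1, p.2)) ∪
    (T.powerset ×ˢ T.powerset).biUnion fun p => F p.1 p.2
  have hsub : G.edgeSet ⊆ (U : Set (Sym2 V)) := by
    intro e
    induction e with
    | _ u v =>
    intro he
    rw [Finset.mem_coe, Finset.mem_union]
    by_cases huv : u ∈ T ∧ v ∈ T
    · exact Or.inl (Finset.mem_image.2 ⟨(u, v), Finset.mem_product.2 huv, rfl⟩)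
    · obtain ⟨D, E, hDE, hnew⟩ := hcrit u v he huv
      refine Or.inr (Finset.mem_biUnion.2 ⟨(D ∩ T, E ∩ T), ?_, ?_⟩)
      · simp
      · simp only [F, Finset.mem_filter, Finset.mem_univ, true_and]
        exact ⟨D, E, hDE, hnew, rfl, rfl⟩
  have h1 : G.edgeSet.ncard ≤ U.card := by
    rw [← Set.ncard_coe_finset]
    exact Set.ncard_le_ncard hsub (Finset.finite_toSet _)
  have h2 : U.card ≤ T.card * T.card +
      2 ^ T.card * 2 ^ T.card * (k * tightBound k T.card) := by
    refine (Finset.card_union_le _ _).trans (Nat.add_le_add ?_ ?_)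
    · exact Finset.card_image_le.trans (Finset.card_product _ _).le
    · refine (Finset.card_biUnion_le_card_mul _ _ (k * tightBound k T.card) fun p _ =>
        card_newSep_edges_le hdeg hcrit _ fun e he => (Finset.mem_filter.1 he).2).trans ?_
      rw [Finset.card_product, Finset.card_powerset]
  have h3 : T.card * T.card + 2 ^ T.card * 2 ^ T.card * (k * tightBound k T.card) ≤
      t * t + 2 ^ t * 2 ^ t * (k * tightBound k t) := by
    have := tightBound_mono k hT
    gcongr <;> norm_num
  unfold edgeBound
  omega

/-- The induced subgraphs on `A₁`, `A₂`, `A₃` together cover `G[T]`. -/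
def CoversOn (G : SimpleGraph V) (T A₁ A₂ A₃ : Finset V) : Prop :=
  ∀ u ∈ T, ∀ v ∈ T, u = v ∨ G.Adj u v →
    (u ∈ A₁ ∧ v ∈ A₁) ∨ (u ∈ A₂ ∧ v ∈ A₂) ∨ (u ∈ A₃ ∧ v ∈ A₃)

theorem coversG_iff {G : SimpleGraph V} {A₁ A₂ A₃ : Finset V} :
    CoversG G A₁ A₂ A₃ ↔ ∀ u v, u = v ∨ G.Adj u v →
      (u ∈ A₁ ∧ v ∈ A₁) ∨ (u ∈ A₂ ∧ v ∈ A₂) ∨ (u ∈ A₃ ∧ v ∈ A₃) := by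
  constructor
  · rintro ⟨h1, h2⟩ u v (rfl | h)
    · have := h1 u
      tauto
    · exact h2 u v h
  · intro h
    refine ⟨fun v => ?_, fun u v huv => h u v (Or.inr huv)⟩
    have := h v v (Or.inl rfl)
    tauto

theorem IsSep.cover {G : SimpleGraph V} {A B : Finset V} (h : IsSep G A B) {u v : V}
    (huv : u = v ∨ G.Adj u v) : (u ∈ A ∧ v ∈ A) ∨ (u ∈ B ∧ v ∈ B) := by
  rw [isSep_iff] at h
  rcases huv with rfl | huv
  · have := h.1 u
    tauto
  · exact h.2 u v huv

namespace IsTangle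

variable {G : SimpleGraph V} {k : ℕ} {τ : Set (Finset V × Finset V)}

theorem mem_or (h : IsTangle G k τ) {A B : Finset V} (hAB : IsSep G A B)
    (hk : (A ∩ B).card < k) : (A, B) ∈ τ ∨ (B, A) ∈ τ := by
  have := h.2.1 A B hAB hk
  tauto

theorem false_of_cover (h : IsTangle G k τ) {A₁ B₁ A₂ B₂ A₃ B₃ : Finset V}
    (h₁ : (A₁, B₁) ∈ τ) (h₂ : (A₂, B₂) ∈ τ) (h₃ : (A₃, B₃) ∈ τ)
    (hc : ∀ u v, u = v ∨ G.Adj u v →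
      (u ∈ A₁ ∧ v ∈ A₁) ∨ (u ∈ A₂ ∧ v ∈ A₂) ∨ (u ∈ A₃ ∧ v ∈ A₃)) : False :=
  h.2.2 _ h₁ _ h₂ _ h₃ (coversG_iff.2 hc)

/-- A separation whose small side is covered by two small sides is oriented accordingly. -/
theorem mem_of_subset (h : IsTangle G k τ) {A₁ B₁ A₂ B₂ A B : Finset V}
    (h₁ : (A₁, B₁) ∈ τ) (h₂ : (A₂, B₂) ∈ τ) (hAB : IsSep G A B) (hk : (A ∩ B).card < k)
    (hc : ∀ u v, u = v ∨ G.Adj u v →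
      (u ∈ A₁ ∧ v ∈ A₁) ∨ (u ∈ A₂ ∧ v ∈ A₂) ∨ (u ∈ B ∧ v ∈ B)) : (A, B) ∈ τ :=
  (h.mem_or hAB hk).resolve_right fun h3 => h.false_of_cover h₁ h₂ h3 hc

theorem not_univ_mem (h : IsTangle G k τ) (B : Finset V) : (Finset.univ, B) ∉ τ := fun hB =>
  h.false_of_cover hB hB hB fun _ _ _ => Or.inl ⟨Finset.mem_univ _, Finset.mem_univ _⟩

theorem small_mem (h : IsTangle G k τ) {A : Finset V} (hA : A.card < k) :
    (A, Finset.univ) ∈ τ := by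
  refine (h.mem_or ?_ (by simpa using hA)).resolve_right (h.not_univ_mem A)
  rw [isSep_iff]
  simp

end IsTangle

/-- The least order of a separation in `τ` with `X` on its small side. -/
noncomputable def minOrder (τ : Set (Finset V × Finset V)) (X : Finset V) : ℕ :=
  sInf {n | ∃ p ∈ τ, X ⊆ p.1 ∧ (p.1 ∩ p.2).card = n}

theorem minOrder_le {τ : Set (Finset V × Finset V)} {X : Finset V} {p : Finset V × Finset V}
    (hp : p ∈ τ) (hX : X ⊆ p.1) : minOrder τ X ≤ (p.1 ∩ p.2).card :=
  Nat.sInf_le ⟨p, hp, hX, rfl⟩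

theorem minOrder_mono {τ : Set (Finset V × Finset V)} {X Y : Finset V} (hXY : X ⊆ Y)
    {p : Finset V × Finset V} (hp : p ∈ τ) (hY : Y ⊆ p.1) : minOrder τ X ≤ minOrder τ Y := by
  obtain ⟨q, hq, hYq, h⟩ := Nat.sInf_mem (s := {n | ∃ p ∈ τ, Y ⊆ p.1 ∧ (p.1 ∩ p.2).card = n})
    ⟨_, p, hp, hY, rfl⟩
  rw [show minOrder τ Y = _ from h.symm]
  exact minOrder_le hq (hXY.trans hYq)

/-- Among the separations of least order with `X` on the small side, there is one with largest
small side. -/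
theorem IsTangle.exists_largest {G : SimpleGraph V} {k : ℕ} {τ : Set (Finset V × Finset V)}
    (h : IsTangle G k τ) {X : Finset V} {p : Finset V × Finset V} (hp : p ∈ τ) (hX : X ⊆ p.1) :
    ∃ q ∈ τ, X ⊆ q.1 ∧ ∀ r ∈ τ, X ⊆ r.1 → (r.1 ∩ r.2).card = minOrder τ X → r.1 ⊆ q.1 := by
  obtain ⟨p₀, hp₀, hX₀, hord₀⟩ :=
    Nat.sInf_mem (s := {n | ∃ p ∈ τ, X ⊆ p.1 ∧ (p.1 ∩ p.2).card = n}) ⟨_, p, hp, hX, rfl⟩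
  change _ = minOrder τ X at hord₀
  obtain ⟨q, ⟨hq, hXq, hordq⟩, hmax⟩ := exists_maximalFor_of_wellFoundedGT
    (fun q : Finset V × Finset V => q ∈ τ ∧ X ⊆ q.1 ∧ (q.1 ∩ q.2).card = minOrder τ X)
    (fun q => q.1) ⟨p₀, hp₀, hX₀, hord₀⟩
  refine ⟨q, hq, hXq, fun r hr hXr hordr => ?_⟩
  obtain ⟨A, B⟩ := q
  obtain ⟨C, D⟩ := r
  simp only at *
  have hAB := (h.1 _ hq).1
  have hCD := (h.1 _ hr).1
  have hk := (h.1 _ hq).2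
  simp only at hAB hCD hk
  have hsub := card_inter_submodular A B C D
  have h1 : minOrder τ X ≤ ((A ∩ C) ∩ (B ∪ D)).card := by
    by_contra! hlt
    have hmem : (A ∩ C, B ∪ D) ∈ τ := by
      refine h.mem_of_subset hq hq (hAB.inter_union hCD) (by omega) fun u v huv => ?_
      have := hAB.cover huv
      simp only [Finset.mem_union]
      tauto
    have := minOrder_le hmem (Finset.subset_inter hXq hXr)
    simp only at this
    omega
  have hmem : (A ∪ C, B ∩ D) ∈ τ := by
    refine h.mem_of_subset hq hr (hAB.union_inter hCD) (by omega) fun u v huv => ?_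
    have := hAB.cover huv
    have := hCD.cover huv
    simp only [Finset.mem_inter]
    tauto
  have h2 := minOrder_le hmem (hXq.trans Finset.subset_union_left)
  simp only at h2
  exact (Finset.subset_union_right).trans (hmax (j := (A ∪ C, B ∩ D))
    ⟨hmem, hXq.trans Finset.subset_union_left, by simp only; omega⟩ Finset.subset_union_left)

/-- Size of a set of vertices witnessing a tangle, after `j` steps. -/
def witnessSize : ℕ → ℕ
  | 0 => 0
  | j + 1 => witnessSize j + 2 ^ witnessSize j * (2 ^ witnessSize j * 2 ^ witnessSize j) * 2

theorem IsTangle.exists_witness_aux {G : SimpleGraph V} {k : ℕ}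
    {τ : Set (Finset V × Finset V)} (h : IsTangle G k τ) (j : ℕ) :
    ∃ T : Finset V, T.card ≤ witnessSize j ∧ ∀ p ∈ τ, ∀ q ∈ τ, ∀ r ∈ τ,
      CoversOn G T p.1 q.1 r.1 →
        j ≤ minOrder τ (p.1 ∩ T) + minOrder τ (q.1 ∩ T) + minOrder τ (r.1 ∩ T) := by
  classical
  induction j with
  | zero => exact ⟨∅, by simp [witnessSize], fun _ _ _ _ _ _ _ => Nat.zero_le _⟩
  | succ j ih =>
    obtain ⟨T, hT, hcov⟩ := ih
    have hL : ∀ X, ∃ q : Finset V × Finset V, (∃ p ∈ τ, X ⊆ p.1) → q ∈ τ ∧ X ⊆ q.1 ∧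
        ∀ r ∈ τ, X ⊆ r.1 → (r.1 ∩ r.2).card = minOrder τ X → r.1 ⊆ q.1 := by
      intro X
      by_cases hX : ∃ p ∈ τ, X ⊆ p.1
      · obtain ⟨p, hp, hXp⟩ := hX
        obtain ⟨q, hq⟩ := h.exists_largest hp hXp
        exact ⟨q, fun _ => hq⟩
      · exact ⟨(∅, ∅), fun hX' => absurd hX' hX⟩
    choose L hL using hL
    have hZ : ∀ t : Finset V × Finset V × Finset V, ∃ Z : Finset V, Z.card ≤ 2 ∧
        (L t.1 ∈ τ → L t.2.1 ∈ τ → L t.2.2 ∈ τ → ¬ CoversOn G Z (L t.1).1 (L t.2.1).1 (L t.2.2).1) := by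
      intro t
      by_cases ht : L t.1 ∈ τ ∧ L t.2.1 ∈ τ ∧ L t.2.2 ∈ τ
      · have := h.2.2 _ ht.1 _ ht.2.1 _ ht.2.2
        rw [coversG_iff] at this
        push Not at this
        obtain ⟨u, v, huv, h1⟩ := this
        refine ⟨{u, v}, Finset.card_le_two, fun _ _ _ h2 => ?_⟩
        have := h2 u (by simp) v (by simp) huv
        tauto
      · exact ⟨∅, by simp, fun h1 h2 h3 => absurd ⟨h1, h2, h3⟩ ht⟩
    choose Z hZcard hZ using hZ
    let N := T.powerset ×ˢ T.powerset ×ˢ T.powerset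
    refine ⟨T ∪ N.biUnion Z, ?_, fun p hp q hq r hr hc => ?_⟩
    · refine (Finset.card_union_le _ _).trans (Nat.add_le_add hT ?_)
      refine (Finset.card_biUnion_le_card_mul _ _ 2 fun t _ => hZcard t).trans ?_
      simp only [N, Finset.card_product, Finset.card_powerset]
      gcongr <;> norm_num
    · set T' := T ∪ N.biUnion Z with hT'
      have hTT' : T ⊆ T' := Finset.subset_union_left
      have h1 := hcov p hp q hq r hr fun u hu v hv => hc u (hTT' hu) v (hTT' hv)
      have hmono : ∀ p ∈ τ, minOrder τ (p.1 ∩ T) ≤ minOrder τ (p.1 ∩ T') := fun p hp =>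
        minOrder_mono (Finset.inter_subset_inter_left hTT') hp Finset.inter_subset_left
      by_contra! hlt
      have hp' := hmono p hp
      have hq' := hmono q hq
      have hr' := hmono r hr
      have key : ∀ p ∈ τ, minOrder τ (p.1 ∩ T) = minOrder τ (p.1 ∩ T') →
          L (p.1 ∩ T) ∈ τ ∧ p.1 ∩ T' ⊆ (L (p.1 ∩ T)).1 := by
        intro p hp heq
        obtain ⟨h1, h2, h3⟩ := hL (p.1 ∩ T) ⟨p, hp, Finset.inter_subset_left⟩
        obtain ⟨s, hs, hsub, hord⟩ := Nat.sInf_mem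
          (s := {n | ∃ s ∈ τ, p.1 ∩ T' ⊆ s.1 ∧ (s.1 ∩ s.2).card = n})
          ⟨_, p, hp, Finset.inter_subset_left, rfl⟩
        exact ⟨h1, hsub.trans (h3 s hs ((Finset.inter_subset_inter_left hTT').trans hsub)
          (hord.trans heq.symm))⟩
      obtain ⟨hp1, hp2⟩ := key p hp (by omega)
      obtain ⟨hq1, hq2⟩ := key q hq (by omega)
      obtain ⟨hr1, hr2⟩ := key r hr (by omega)
      refine hZ (p.1 ∩ T, q.1 ∩ T, r.1 ∩ T) hp1 hq1 hr1 fun u hu v hv huv => ?_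
      have hsub : Z (p.1 ∩ T, q.1 ∩ T, r.1 ∩ T) ⊆ T' := by
        refine (Finset.subset_biUnion_of_mem Z ?_).trans Finset.subset_union_right
        simp [N]
      have hu' := hsub hu
      have hv' := hsub hv
      refine (hc u hu' v hv' huv).imp (fun h => ?_) (Or.imp (fun h => ?_) fun h => ?_)
      · exact ⟨hp2 (Finset.mem_inter.2 ⟨h.1, hu'⟩), hp2 (Finset.mem_inter.2 ⟨h.2, hv'⟩)⟩
      · exact ⟨hq2 (Finset.mem_inter.2 ⟨h.1, hu'⟩), hq2 (Finset.mem_inter.2 ⟨h.2, hv'⟩)⟩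
      · exact ⟨hr2 (Finset.mem_inter.2 ⟨h.1, hu'⟩), hr2 (Finset.mem_inter.2 ⟨h.2, hv'⟩)⟩

/-- A tangle is witnessed by a vertex set of bounded size: no three small sides cover the subgraph
it induces. -/
theorem IsTangle.exists_witness {G : SimpleGraph V} {k : ℕ}
    {τ : Set (Finset V × Finset V)} (h : IsTangle G k τ) :
    ∃ T : Finset V, T.card ≤ witnessSize (3 * k) ∧ ∀ p ∈ τ, ∀ q ∈ τ, ∀ r ∈ τ,
      ¬ CoversOn G T p.1 q.1 r.1 := by
  obtain ⟨T, hT, hcov⟩ := h.exists_witness_aux (3 * k)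
  refine ⟨T, hT, fun p hp q hq r hr hc => ?_⟩
  have hlt : ∀ p ∈ τ, minOrder τ (p.1 ∩ T) < k := fun p hp =>
    (minOrder_le hp Finset.inter_subset_left).trans_lt (h.1 p hp).2
  have := hcov p hp q hq r hr hc
  have := hlt p hp
  have := hlt q hq
  have := hlt r hr
  omega

namespace IsTangle

variable {G : SimpleGraph V} {k : ℕ} {τ : Set (Finset V × Finset V)}

/-- That only one orientation of each separation is chosen follows from the covering condition. -/
theorem of_mem_or (h₁ : ∀ p ∈ τ, IsSep G p.1 p.2 ∧ (p.1 ∩ p.2).card < k)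
    (h₂ : ∀ A B, IsSep G A B → (A ∩ B).card < k → (A, B) ∈ τ ∨ (B, A) ∈ τ)
    (h₃ : ∀ p ∈ τ, ∀ q ∈ τ, ∀ r ∈ τ, ¬ CoversG G p.1 q.1 r.1) : IsTangle G k τ := by
  refine ⟨h₁, fun A B hAB hk => ⟨fun hA hB => ?_, (h₂ A B hAB hk).resolve_right⟩, h₃⟩
  refine h₃ _ hA _ hB _ hB (coversG_iff.2 fun u v huv => ?_)
  have := hAB.cover huv
  tauto

/-- A tangle survives the deletion of an edge outside a witness if this creates no new separation
of the witness. -/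
theorem exists_deleteEdges (h : IsTangle G k τ) {T : Finset V}
    (hT : ∀ p ∈ τ, ∀ q ∈ τ, ∀ r ∈ τ, ¬ CoversOn G T p.1 q.1 r.1) {u v : V}
    (huv : ¬ (u ∈ T ∧ v ∈ T))
    (hnew : ∀ D E, IsSep (G.deleteEdges {s(u, v)}) D E → ¬ IsNewSep G k T D E) :
    ∃ τ', IsTangle (G.deleteEdges {s(u, v)}) k τ' ∧ τ ⊆ τ' := by
  have hadj : ∀ a ∈ T, ∀ b ∈ T, G.Adj a b → (G.deleteEdges {s(u, v)}).Adj a b := by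
    intro a ha b hb hab
    rw [SimpleGraph.deleteEdges_adj]
    refine ⟨hab, fun he => huv ?_⟩
    rw [Set.mem_singleton_iff, Sym2.eq_iff] at he
    rcases he with ⟨rfl, rfl⟩ | ⟨rfl, rfl⟩ <;> tauto
  refine ⟨{p | IsSep (G.deleteEdges {s(u, v)}) p.1 p.2 ∧ (p.1 ∩ p.2).card < k ∧
    ∃ q ∈ τ, p.1 ∩ T ⊆ q.1}, of_mem_or (fun p hp => ⟨hp.1, hp.2.1⟩) ?_ ?_, fun p hp =>
    ⟨(h.1 p hp).1.mono (SimpleGraph.deleteEdges_le _), (h.1 p hp).2, p, hp,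
      Finset.inter_subset_left⟩⟩
  · intro A B hAB hk
    have := hnew A B hAB
    rw [IsNewSep] at this
    push Not at this
    obtain ⟨A', B', hA'B', hk', hA, hB⟩ := this hk
    refine (h.mem_or hA'B' hk').imp (fun h1 => ⟨hAB, hk, _, h1, hA⟩) fun h1 =>
      ⟨hAB.symm, by rwa [Finset.inter_comm], _, h1, hB⟩
  · rintro p ⟨_, _, p', hp', hp⟩ q ⟨_, _, q', hq', hq⟩ r ⟨_, _, r', hr', hr⟩ hc
    rw [coversG_iff] at hc
    refine hT p' hp' q' hq' r' hr' fun a ha b hb hab => ?_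
    have key : ∀ {X Y : Finset V}, X ∩ T ⊆ Y → a ∈ X ∧ b ∈ X → a ∈ Y ∧ b ∈ Y := fun hXY hX =>
      ⟨hXY (Finset.mem_inter.2 ⟨hX.1, ha⟩), hXY (Finset.mem_inter.2 ⟨hX.2, hb⟩)⟩
    exact (hc a b (hab.imp id (hadj a ha b hb))).imp (key hp) (Or.imp (key hq) (key hr))

end IsTangle

section Suppression

variable {G : SimpleGraph V} {k : ℕ} {τ : Set (Finset V × Finset V)} {v u w : V}
  {hu : u ≠ v} {hw : w ≠ v}

theorem suppressedGraph_adj_of_adj {x y : V} (hx : x ≠ v) (hy : y ≠ v) (h : G.Adj x y) :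
    (suppressedGraph G v u w hu hw).Adj ⟨x, hx⟩ ⟨y, hy⟩ := by
  simp [suppressedGraph, h]

theorem suppressedGraph_adj (huw : u ≠ w) :
    (suppressedGraph G v u w hu hw).Adj ⟨u, hu⟩ ⟨w, hw⟩ := by
  simp [suppressedGraph, huw]

/-- Covering `G` from a cover of the suppressed graph. -/
theorem cover_of_suppressedGraph (hN : ∀ x, G.Adj v x → x = u ∨ x = w)
    {A₁ A₂ A₃ : Finset {x : V // x ≠ v}} {X : Finset V}
    (hv : v ∈ X) (huX : u ∈ X) (hwX : w ∈ X)
    (hc : ∀ x y, x = y ∨ (suppressedGraph G v u w hu hw).Adj x y →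
      (x ∈ A₁ ∧ y ∈ A₁) ∨ (x ∈ A₂ ∧ y ∈ A₂) ∨ (x ∈ A₃ ∧ y ∈ A₃))
    (hX : A₁.image Subtype.val ⊆ X) {x y : V} (hxy : x = y ∨ G.Adj x y) :
    (x ∈ X ∧ y ∈ X) ∨ (x ∈ A₂.image Subtype.val ∧ y ∈ A₂.image Subtype.val) ∨
      (x ∈ A₃.image Subtype.val ∧ y ∈ A₃.image Subtype.val) := by
  by_cases hx : x = v
  · subst hx
    rcases hxy with rfl | hxy
    · exact Or.inl ⟨hv, hv⟩
    · rcases hN y hxy with rfl | rfl <;> tauto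
  by_cases hy : y = v
  · subst hy
    rcases hxy with rfl | hxy
    · exact Or.inl ⟨hv, hv⟩
    · rcases hN x hxy.symm with rfl | rfl <;> tauto
  have h := hc ⟨x, hx⟩ ⟨y, hy⟩ (hxy.imp (fun h => Subtype.ext h) (suppressedGraph_adj_of_adj hx hy))
  have key : ∀ A : Finset {x : V // x ≠ v}, (⟨x, hx⟩ : {x : V // x ≠ v}) ∈ A ∧ ⟨y, hy⟩ ∈ A →
      x ∈ A.image Subtype.val ∧ y ∈ A.image Subtype.val := fun A hA =>
    ⟨Finset.mem_image_of_mem Subtype.val hA.1, Finset.mem_image_of_mem Subtype.val hA.2⟩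
  refine h.imp (fun h => ?_) (Or.imp (key _) (key _))
  exact ⟨hX (key _ h).1, hX (key _ h).2⟩

theorem card_insert_image_inter (A B : Finset {x : V // x ≠ v}) :
    (insert v (A.image Subtype.val) ∩ B.image Subtype.val).card = (A ∩ B).card := by
  rw [← Finset.card_image_of_injective _ Subtype.val_injective]
  congr 1
  ext x
  simp only [Finset.mem_inter, Finset.mem_insert, Finset.mem_image, Subtype.exists,
    exists_and_right, exists_eq_right]
  constructor
  · rintro ⟨rfl | ⟨h1, h2⟩, h3, h4⟩
    · exact absurd rfl h3
    · exact ⟨h1, h2, h4⟩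
  · rintro ⟨h1, h2, h3⟩
    exact ⟨Or.inr ⟨h1, h2⟩, h1, h3⟩

/-- A separation of the suppressed graph with `u` and `w` on one side lifts to one of `G`. -/
theorem IsSep.of_suppressedGraph (hN : ∀ x, G.Adj v x → x = u ∨ x = w)
    {A B : Finset {x : V // x ≠ v}} (h : IsSep (suppressedGraph G v u w hu hw) A B)
    (huA : ⟨u, hu⟩ ∈ A) (hwA : ⟨w, hw⟩ ∈ A) :
    IsSep G (insert v (A.image Subtype.val)) (B.image Subtype.val) := by
  have key : ∀ {x y : V}, x = y ∨ G.Adj x y → (x ∈ insert v (A.image Subtype.val) ∧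
      y ∈ insert v (A.image Subtype.val)) ∨ (x ∈ B.image Subtype.val ∧
      y ∈ B.image Subtype.val) := fun hxy => by
    have := cover_of_suppressedGraph (A₁ := A) (A₂ := B) (A₃ := B) hN
      (Finset.mem_insert_self v (A.image Subtype.val))
      (Finset.mem_insert_of_mem (Finset.mem_image_of_mem Subtype.val huA))
      (Finset.mem_insert_of_mem (Finset.mem_image_of_mem Subtype.val hwA))
      (fun x y hxy => by have := h.cover hxy; tauto) (Finset.subset_insert _ _) hxy
    tauto
  rw [isSep_iff]
  refine ⟨fun x => ?_, fun x y hxy => key (Or.inr hxy)⟩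
  have := key (Or.inl (Eq.refl x))
  tauto

theorem IsTangle.insert_image_mem (h : IsTangle G k τ) (huw : u ≠ w) (hvu : G.Adj v u)
    (hvw : G.Adj v w) (hN : ∀ x, G.Adj v x → x = u ∨ x = w) {A B : Finset {x : V // x ≠ v}}
    (hAB : (A, B) ∈ suppTangle G k τ v u w hu hw) (huA : ⟨u, hu⟩ ∈ A) (hwA : ⟨w, hw⟩ ∈ A) :
    (insert v (A.image Subtype.val), B.image Subtype.val) ∈ τ := by
  obtain ⟨hsep, hk, h1 | h1⟩ := hAB
  · exact h1
  refine (h.mem_or (hsep.of_suppressedGraph hN huA hwA)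
    (by rwa [card_insert_image_inter])).resolve_right fun h2 => ?_
  simp only at hsep h1 hk
  have hmem : ∀ {x : V}, (hx : x ≠ v) → G.Adj v x → (⟨x, hx⟩ : {x : V // x ≠ v}) ∈ B := by
    intro x hx hvx
    rcases (h.1 _ h1).1.cover (Or.inr hvx) with ⟨h3, _⟩ | ⟨_, h3⟩
    · simp at h3
    · simpa [hx] using h3
  have huB := hmem hu hvu
  have hwB := hmem hw hvw
  have hk2 : 2 < k := by
    refine lt_of_le_of_lt ?_ hk
    refine (Finset.card_pair (a := (⟨u, hu⟩ : {x : V // x ≠ v})) (b := ⟨w, hw⟩)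
      (by simpa using huw)).symm.le.trans (Finset.card_le_card ?_)
    simp [Finset.insert_subset_iff, huA, hwA, huB, hwB]
  have hstar : IsSep G {v, u, w} (univ.erase v) := by
    rw [isSep_iff]
    refine ⟨fun x => ?_, fun x y hxy => ?_⟩
    · by_cases hx : x = v <;> simp [hx]
    · by_cases hx : x = v
      · subst hx
        have := hN y hxy
        simp only [Finset.mem_insert, Finset.mem_singleton]
        tauto
      · by_cases hy : y = v
        · subst hy
          have := hN x hxy.symm
          simp only [Finset.mem_insert, Finset.mem_singleton]
          tauto
        · simp [hx, hy]
  have hcard : (({v, u, w} : Finset V) ∩ univ.erase v).card < k := by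
    refine lt_of_le_of_lt (Finset.card_le_card (t := {u, w}) fun x hx => ?_)
      (Finset.card_le_two.trans_lt hk2)
    simp only [Finset.mem_inter, Finset.mem_insert, Finset.mem_singleton, Finset.mem_erase] at hx ⊢
    tauto
  rcases h.mem_or hstar hcard with h3 | h3
  · refine h.false_of_cover h3 h1 h2 fun x y hxy => ?_
    refine cover_of_suppressedGraph (A₁ := ∅) (hu := hu) (hw := hw) hN (by simp) (by simp)
      (by simp) (fun x y hxy => ?_) (by simp) hxy
    have := hsep.cover hxy
    tauto
  · refine h.false_of_cover h3 (h.small_mem (A := {v, u}) (Finset.card_le_two.trans_lt hk2))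
      (h.small_mem (A := {v, w}) (Finset.card_le_two.trans_lt hk2)) fun x y hxy => ?_
    simp only [Finset.mem_erase, Finset.mem_insert, Finset.mem_singleton, Finset.mem_univ, and_true]
    rcases hxy with rfl | hxy
    · tauto
    · by_cases hx : x = v
      · subst hx
        have := hN y hxy
        tauto
      · by_cases hy : y = v
        · subst hy
          have := hN x hxy.symm
          tauto
        · tauto

/-- A tangle survives the suppression of a vertex of degree 2. -/
theorem IsTangle.suppTangle (h : IsTangle G k τ) (huw : u ≠ w) (hvu : G.Adj v u)
    (hvw : G.Adj v w) (hN : ∀ x, G.Adj v x → x = u ∨ x = w) :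
    IsTangle (suppressedGraph G v u w hu hw) k (suppTangle G k τ v u w hu hw) := by
  refine .of_mem_or (fun p hp => ⟨hp.1, hp.2.1⟩) (fun A B hAB hk => ?_) ?_
  · have hk' := hk
    rw [Finset.inter_comm] at hk'
    rcases hAB.cover (Or.inr (suppressedGraph_adj huw)) with ⟨h1, h2⟩ | ⟨h1, h2⟩
    · exact (h.mem_or (hAB.of_suppressedGraph hN h1 h2)
        (by rwa [card_insert_image_inter])).imp (fun h3 => ⟨hAB, hk, Or.inl h3⟩)
        fun h3 => ⟨hAB.symm, hk', Or.inr h3⟩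
    · exact (h.mem_or (hAB.symm.of_suppressedGraph hN h1 h2)
        (by rwa [card_insert_image_inter])).symm.imp (fun h3 => ⟨hAB, hk, Or.inr h3⟩)
        fun h3 => ⟨hAB.symm, hk', Or.inl h3⟩
  · have lift : ∀ p ∈ _root_.suppTangle G k τ v u w hu hw,
        ∃ q ∈ τ, p.1.image Subtype.val ⊆ q.1 := by
      rintro p ⟨_, _, h1 | h1⟩
      · exact ⟨_, h1, Finset.subset_insert _ _⟩
      · exact ⟨_, h1, subset_rfl⟩
    have key : ∀ p ∈ _root_.suppTangle G k τ v u w hu hw,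
        ∀ q ∈ _root_.suppTangle G k τ v u w hu hw, ∀ r ∈ _root_.suppTangle G k τ v u w hu hw,
        (∀ x y, x = y ∨ (suppressedGraph G v u w hu hw).Adj x y →
          (x ∈ p.1 ∧ y ∈ p.1) ∨ (x ∈ q.1 ∧ y ∈ q.1) ∨ (x ∈ r.1 ∧ y ∈ r.1)) →
        ¬ (⟨u, hu⟩ ∈ p.1 ∧ ⟨w, hw⟩ ∈ p.1) := by
      intro p hp q hq r hr hc hp1
      have hp' := h.insert_image_mem huw hvu hvw hN hp hp1.1 hp1.2
      obtain ⟨q', hq', hqs⟩ := lift q hq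
      obtain ⟨r', hr', hrs⟩ := lift r hr
      refine h.false_of_cover hp' hq' hr' fun x y hxy => ?_
      refine (cover_of_suppressedGraph hN (Finset.mem_insert_self v (p.1.image Subtype.val))
        (Finset.mem_insert_of_mem (Finset.mem_image_of_mem Subtype.val hp1.1))
        (Finset.mem_insert_of_mem (Finset.mem_image_of_mem Subtype.val hp1.2))
        hc (Finset.subset_insert _ _) hxy).imp id
        (Or.imp (And.imp (@hqs _) (@hqs _)) (And.imp (@hrs _) (@hrs _)))
    intro p hp q hq r hr hc
    rw [coversG_iff] at hc
    rcases hc _ _ (Or.inr (suppressedGraph_adj huw)) with h1 | h1 | h1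
    · exact key p hp q hq r hr hc h1
    · exact key q hq p hp r hr (fun x y hxy => by have := hc x y hxy; tauto) h1
    · exact key r hr p hp q hq (fun x y hxy => by have := hc x y hxy; tauto) h1

end Suppression

namespace IsTangle

variable {G : SimpleGraph V} {k : ℕ} {τ : Set (Finset V × Finset V)}

/-- A tangle points to a component of the graph. -/
theorem exists_component (h : IsTangle G k τ) (hk : 1 ≤ k) :
    ∃ s : Finset V, (∃ c : G.ConnectedComponent, (s : Set V) = c.supp) ∧ (sᶜ, s) ∈ τ := by
  classical
  obtain ⟨⟨A, B⟩, ⟨hAB, hdisj⟩, hmax⟩ := exists_maximalFor_of_wellFoundedGT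
    (fun q : Finset V × Finset V => q ∈ τ ∧ q.1 ∩ q.2 = ∅) (fun q => q.1)
    ⟨(∅, univ), h.small_mem (by simpa using Nat.lt_of_succ_le hk), by simp⟩
  simp only at hdisj
  obtain ⟨b, hb⟩ : ∃ b, b ∉ A := by
    by_contra! hA
    obtain rfl : A = univ := Finset.eq_univ_iff_forall.2 hA
    exact h.not_univ_mem B hAB
  let c := G.connectedComponentMk b
  let s : Finset V := univ.filter fun x => G.connectedComponentMk x = c
  have hs : ∀ x y, x = y ∨ G.Adj x y → (x ∈ s ↔ y ∈ s) := by
    rintro x y (rfl | hxy)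
    · rfl
    · simp only [s, Finset.mem_filter, Finset.mem_univ, true_and,
        SimpleGraph.ConnectedComponent.connectedComponentMk_eq_of_adj hxy]
  refine ⟨s, ⟨c, by ext; simp [s]⟩, ?_⟩
  have hsep : IsSep G s sᶜ := by
    rw [isSep_iff]
    refine ⟨fun x => by rw [Finset.mem_compl]; exact em _, fun x y hxy => ?_⟩
    have := hs x y (Or.inr hxy)
    simp only [Finset.mem_compl]
    tauto
  refine (h.mem_or hsep (by simpa using Nat.lt_of_succ_le hk)).resolve_left fun h1 => hb ?_
  have hempty : (A ∪ s) ∩ (B \ s) = ∅ := by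
    ext x
    have : x ∉ A ∩ B := by simp [hdisj]
    simp only [Finset.mem_inter, Finset.mem_union, Finset.mem_sdiff, Finset.notMem_empty] at *
    tauto
  have hmem : (A ∪ s, B \ s) ∈ τ := by
    have key : ∀ x y, x = y ∨ G.Adj x y →
        (x ∈ A ∧ y ∈ A) ∨ (x ∈ s ∧ y ∈ s) ∨ (x ∈ B \ s ∧ y ∈ B \ s) := fun x y hxy => by
      have := (h.1 _ hAB).1.cover hxy
      have := hs x y hxy
      simp only [Finset.mem_sdiff]
      tauto
    refine h.mem_of_subset hAB h1 ?_ (by rw [hempty, Finset.card_empty]; omega) key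
    rw [isSep_iff]
    refine ⟨fun x => ?_, fun x y hxy => ?_⟩
    · have := key x x (Or.inl rfl)
      rw [Finset.mem_union]
      tauto
    · have := key x y (Or.inr hxy)
      simp only [Finset.mem_union]
      tauto
  exact hmax (j := (A ∪ s, B \ s)) ⟨hmem, hempty⟩ Finset.subset_union_left
    (Finset.mem_union_right _ (by simp [s, c]))

/-- A tangle survives in the component it points to. -/
theorem exists_comap (h : IsTangle G k τ) {s : Finset V}
    (hs : ∀ x y, G.Adj x y → (x ∈ s ↔ y ∈ s)) (hsτ : (sᶜ, s) ∈ τ) :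
    ∃ τ', IsTangle (SimpleGraph.comap (Subtype.val : {x : V // x ∈ s} → V) G) k τ' ∧
      ∀ p ∈ τ, (p.1.subtype (· ∈ s), p.2.subtype (· ∈ s)) ∈ τ' := by
  set H := SimpleGraph.comap (Subtype.val : {x : V // x ∈ s} → V) G
  have hs' : ∀ x y, x = y ∨ G.Adj x y → (x ∈ s ↔ y ∈ s) := by
    rintro x y (rfl | hxy)
    · rfl
    · exact hs x y hxy
  have hlift : ∀ {A B : Finset {x : V // x ∈ s}}, IsSep H A B → ∀ {x y : V}, x = y ∨ G.Adj x y →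
      (x ∈ A.image Subtype.val ∧ y ∈ A.image Subtype.val) ∨ (x ∈ sᶜ ∧ y ∈ sᶜ) ∨
      (x ∈ B.image Subtype.val ∧ y ∈ B.image Subtype.val) := by
    intro A B hAB x y hxy
    have hxys := hs' x y hxy
    by_cases hx : x ∈ s
    · have hy := hxys.1 hx
      have := hAB.cover (u := ⟨x, hx⟩) (v := ⟨y, hy⟩) (hxy.imp (fun h => Subtype.ext h) id)
      simp only [Finset.mem_image, Subtype.exists, exists_and_right, exists_eq_right]
      exact this.imp (fun h => ⟨⟨hx, h.1⟩, ⟨hy, h.2⟩⟩) fun h => Or.inr ⟨⟨hx, h.1⟩, ⟨hy, h.2⟩⟩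
    · simp only [Finset.mem_compl]
      tauto
  have hsepG : ∀ {A B : Finset {x : V // x ∈ s}}, IsSep H A B →
      IsSep G (A.image Subtype.val ∪ sᶜ) (B.image Subtype.val) := by
    intro A B hAB
    rw [isSep_iff]
    refine ⟨fun x => ?_, fun x y hxy => ?_⟩
    · have := hlift hAB (Or.inl (Eq.refl x))
      rw [Finset.mem_union]
      tauto
    · have := hlift hAB (Or.inr hxy)
      simp only [Finset.mem_union]
      tauto
  have hcard : ∀ A B : Finset {x : V // x ∈ s},
      ((A.image Subtype.val ∪ sᶜ) ∩ B.image Subtype.val).card = (A ∩ B).card := by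
    intro A B
    rw [← Finset.card_image_of_injective _ Subtype.val_injective]
    congr 1
    ext x
    simp only [Finset.mem_inter, Finset.mem_union, Finset.mem_image, Subtype.exists,
      exists_and_right, exists_eq_right, Finset.mem_compl]
    constructor
    · rintro ⟨⟨h1, h2⟩ | h1, h3, h4⟩
      · exact ⟨h1, h2, h4⟩
      · exact absurd h3 h1
    · rintro ⟨h1, h2, h3⟩
      exact ⟨Or.inl ⟨h1, h2⟩, h1, h3⟩
  refine ⟨{p | IsSep H p.1 p.2 ∧ (p.1 ∩ p.2).card < k ∧
    (p.1.image Subtype.val ∪ sᶜ, p.2.image Subtype.val) ∈ τ},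
    of_mem_or (fun p hp => ⟨hp.1, hp.2.1⟩) (fun A B hAB hk => ?_) ?_, fun p hp => ?_⟩
  · have hk' := hk
    rw [Finset.inter_comm] at hk'
    refine (h.mem_or (hsepG hAB) (by rwa [hcard])).imp (fun h1 => ⟨hAB, hk, h1⟩) fun h1 =>
      ⟨hAB.symm, hk', ?_⟩
    exact h.mem_of_subset h1 hsτ (hsepG hAB.symm) (by rwa [hcard]) fun x y hxy =>
      hlift hAB.symm hxy
  · rintro p ⟨_, _, hp⟩ q ⟨_, _, hq⟩ r ⟨_, _, hr⟩ hc
    rw [coversG_iff] at hc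
    refine h.false_of_cover hp hq hr fun x y hxy => ?_
    have hxys := hs' x y hxy
    by_cases hx : x ∈ s
    · have hy := hxys.1 hx
      have key : ∀ A : Finset {x : V // x ∈ s}, ⟨x, hx⟩ ∈ A ∧ ⟨y, hy⟩ ∈ A →
          x ∈ A.image Subtype.val ∪ sᶜ ∧ y ∈ A.image Subtype.val ∪ sᶜ := fun A hA =>
        ⟨Finset.mem_union_left _ (Finset.mem_image_of_mem Subtype.val hA.1),
          Finset.mem_union_left _ (Finset.mem_image_of_mem Subtype.val hA.2)⟩
      exact (hc ⟨x, hx⟩ ⟨y, hy⟩ (hxy.imp (fun h => Subtype.ext h) id)).imp (key _)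
        (Or.imp (key _) (key _))
    · simp only [Finset.mem_union, Finset.mem_compl]
      tauto
  · have hsep : IsSep H (p.1.subtype (· ∈ s)) (p.2.subtype (· ∈ s)) := by
      rw [isSep_iff]
      refine ⟨fun x => ?_, fun x y hxy => ?_⟩
      · have := (h.1 p hp).1.cover (Or.inl (Eq.refl x.1))
        simp only [Finset.mem_subtype]
        tauto
      · have := (h.1 p hp).1.cover (Or.inr hxy)
        simpa only [Finset.mem_subtype] using this
    have hk : (p.1.subtype (· ∈ s) ∩ p.2.subtype (· ∈ s)).card < k := by
      refine lt_of_le_of_lt ?_ (h.1 p hp).2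
      rw [← Finset.card_image_of_injective _ Subtype.val_injective]
      refine Finset.card_le_card fun x hx => ?_
      simp only [Finset.mem_image, Finset.mem_inter, Finset.mem_subtype] at hx ⊢
      obtain ⟨a, ha, rfl⟩ := hx
      exact ha
    refine ⟨hsep, hk, h.mem_of_subset hp hsτ (hsepG hsep) (by rwa [hcard]) fun x y hxy => ?_⟩
    have := (h.1 p hp).1.cover hxy
    have := hs' x y hxy
    simp only [Finset.mem_image, Finset.mem_subtype, Subtype.exists, exists_and_right,
      exists_eq_right, Finset.mem_compl, exists_prop]
    tauto

end IsTangle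

/-- There is a sequence of steps, along which `τ` survives, from `X` to a connected graph with
fewer than `M` edges. -/
def ReducesBelow (k M : ℕ) (X : TGraph) (τ : Set (Finset X.V × Finset X.V)) : Prop :=
  ∃ (m : ℕ) (GS : Fin (m + 1) → TGraph)
    (TS : ∀ i : Fin (m + 1), Set (Finset (GS i).V × Finset (GS i).V)),
    GS 0 = X ∧ HEq (TS 0) τ ∧
    (∀ i : Fin (m + 1), @IsTangle (GS i).V (GS i).fin (GS i).deq (GS i).G k (TS i)) ∧
    (∀ i : Fin m, SurvStep k (GS i.castSucc) (GS i.succ) (TS i.castSucc) (TS i.succ)) ∧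
    (GS (Fin.last m)).G.Connected ∧
    (GS (Fin.last m)).G.edgeSet.ncard < M

theorem ReducesBelow.refl {k M : ℕ} {X : TGraph} {τ : Set (Finset X.V × Finset X.V)}
    (hτ : @IsTangle X.V X.fin X.deq X.G k τ) (hconn : X.G.Connected)
    (hM : X.G.edgeSet.ncard < M) : ReducesBelow k M X τ :=
  ⟨0, fun _ => X, fun _ => τ, rfl, HEq.rfl, fun _ => hτ, fun i => i.elim0, hconn, hM⟩

theorem ReducesBelow.step {k M : ℕ} {X Y : TGraph} {τ : Set (Finset X.V × Finset X.V)}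
    {σ : Set (Finset Y.V × Finset Y.V)} (hτ : @IsTangle X.V X.fin X.deq X.G k τ)
    (hstep : SurvStep k X Y τ σ) (h : ReducesBelow k M Y σ) : ReducesBelow k M X τ := by
  obtain ⟨m, GS, TS, hY, hσ, htangle, hsteps, hconn, hM⟩ := h
  subst hY
  obtain rfl := eq_of_heq hσ
  let F : Fin (m + 2) → Σ X : TGraph, Set (Finset X.V × Finset X.V) :=
    Fin.cons ⟨X, τ⟩ fun i => ⟨GS i, TS i⟩
  refine ⟨m + 1, fun i => (F i).1, fun i => (F i).2, rfl, HEq.rfl, fun i => ?_, fun i => ?_,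
    hconn, hM⟩
  · exact Fin.cases hτ htangle i
  · induction i using Fin.cases with
    | zero => exact hstep
    | succ i => exact hsteps i

theorem image_isoRefl {W : Type} [DecidableEq W] {H : SimpleGraph W} (A : Finset W) :
    A.image (SimpleGraph.Iso.refl : H ≃g H) = A :=
  Finset.image_id

section Steps

variable {G : SimpleGraph V} {k M : ℕ} {τ : Set (Finset V × Finset V)}

theorem reducesBelow_of_not_connected (h : IsTangle G k τ) (hk : 1 ≤ k) (hG : ¬ G.Connected)
    (ih : ∀ (W : Type) [Fintype W] [DecidableEq W] (H : SimpleGraph W)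
      (σ : Set (Finset W × Finset W)), Fintype.card W < Fintype.card V → IsTangle H k σ →
      ReducesBelow k M ⟨W, inferInstance, inferInstance, H⟩ σ) :
    ReducesBelow k M ⟨V, inferInstance, inferInstance, G⟩ τ := by
  obtain ⟨s, ⟨c, hc⟩, hsτ⟩ := h.exists_component hk
  have hmem : ∀ x, x ∈ s ↔ G.connectedComponentMk x = c := fun x => by
    rw [← Finset.mem_coe, hc, SimpleGraph.ConnectedComponent.mem_supp_iff]
  have hs : s ≠ univ := by
    rintro rfl
    refine hG ((SimpleGraph.connected_iff _).2 ⟨fun x y => ?_, ⟨c.out⟩⟩)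
    rw [← SimpleGraph.ConnectedComponent.eq, (hmem x).1 (mem_univ x), (hmem y).1 (mem_univ y)]
  obtain ⟨σ, hσ, hτσ⟩ := h.exists_comap (s := s) (fun x y hxy => by
    rw [hmem, hmem, SimpleGraph.ConnectedComponent.connectedComponentMk_eq_of_adj hxy]) hsτ
  refine ReducesBelow.step (Y := ⟨{x : V // x ∈ s}, inferInstance, inferInstance, _⟩) h
    (Or.inr (Or.inr ⟨s, ⟨c, hc⟩, hs, SimpleGraph.Iso.refl, fun p hp => ?_⟩))
    (ih _ _ σ ?_ hσ)
  · exact Set.mem_of_eq_of_mem (Prod.ext (image_isoRefl _) (image_isoRefl _)) (hτσ p hp)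
  · rw [Fintype.card_coe, ← Finset.card_univ]
    exact Finset.card_lt_card (Finset.ssubset_univ_iff.2 hs)

theorem reducesBelow_of_not_noDegreeTwo (h : IsTangle G k τ) (hG : ¬ NoDegreeTwo G)
    (ih : ∀ (W : Type) [Fintype W] [DecidableEq W] (H : SimpleGraph W)
      (σ : Set (Finset W × Finset W)), Fintype.card W < Fintype.card V → IsTangle H k σ →
      ReducesBelow k M ⟨W, inferInstance, inferInstance, H⟩ σ) :
    ReducesBelow k M ⟨V, inferInstance, inferInstance, G⟩ τ := by
  rw [NoDegreeTwo] at hG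
  push Not at hG
  obtain ⟨v, u, w, huw, hvu, hvw, hN⟩ := hG
  have hN' : ∀ x, G.Adj v x → x = u ∨ x = w := fun x hx => by
    have := hN x hx
    tauto
  refine ReducesBelow.step (Y := ⟨{x : V // x ≠ v}, inferInstance, inferInstance, _⟩) h
    (Or.inr (Or.inl ⟨v, u, w, hvu.ne', hvw.ne', huw, hvu, hvw, hN', SimpleGraph.Iso.refl, ?_⟩))
    (ih _ _ _ ?_ (h.suppTangle huw hvu hvw hN'))
  · refine (Set.image_id _).symm.trans (Set.image_congr' fun p => ?_)
    exact (Prod.ext (image_isoRefl _) (image_isoRefl _)).symm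
  · exact Fintype.card_subtype_lt (x := v) (by simp)

theorem reducesBelow_of_not_isCritical (h : IsTangle G k τ) {T : Finset V}
    (hT : ∀ p ∈ τ, ∀ q ∈ τ, ∀ r ∈ τ, ¬ CoversOn G T p.1 q.1 r.1) (hG : ¬ IsCritical G k T)
    (ih : ∀ (H : SimpleGraph V) (σ : Set (Finset V × Finset V)),
      H.edgeSet.ncard < G.edgeSet.ncard → IsTangle H k σ →
      ReducesBelow k M ⟨V, inferInstance, inferInstance, H⟩ σ) :
    ReducesBelow k M ⟨V, inferInstance, inferInstance, G⟩ τ := by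
  rw [IsCritical] at hG
  push Not at hG
  obtain ⟨u, v, huv, hnT, hnew⟩ := hG
  obtain ⟨σ, hσ, hτσ⟩ := h.exists_deleteEdges hT (fun h => hnT h.1 h.2) hnew
  refine ReducesBelow.step (Y := ⟨V, inferInstance, inferInstance, G.deleteEdges {s(u, v)}⟩) h
    (Or.inl ⟨s(u, v), huv, SimpleGraph.Iso.refl, fun p hp => ?_⟩) (ih _ σ ?_ hσ)
  · exact Set.mem_of_eq_of_mem (Prod.ext (image_isoRefl _) (image_isoRefl _)) (hτσ hp)
  · refine Set.ncard_lt_ncard ?_ (Set.toFinite _)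
    rw [SimpleGraph.edgeSet_deleteEdges (G := G)]
    exact Set.sdiff_singleton_ssubset.2 huv

end Steps

theorem IsTangle.reducesBelow {k : ℕ} (hk : 1 ≤ k) (n : ℕ) :
    ∀ (V : Type) [Fintype V] [DecidableEq V] (G : SimpleGraph V)
      (τ : Set (Finset V × Finset V)), Fintype.card V = n → IsTangle G k τ →
      ReducesBelow k (edgeBound k (witnessSize (3 * k)))
        ⟨V, inferInstance, inferInstance, G⟩ τ := by
  induction n using Nat.strong_induction_on with
  | _ n ihn =>
    intro V _ _ G τ hn h
    have ihV : ∀ (W : Type) [Fintype W] [DecidableEq W] (H : SimpleGraph W)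
        (σ : Set (Finset W × Finset W)), Fintype.card W < Fintype.card V → IsTangle H k σ →
        ReducesBelow k (edgeBound k (witnessSize (3 * k)))
          ⟨W, inferInstance, inferInstance, H⟩ σ := fun W _ _ H σ hlt hσ =>
      ihn _ (hn ▸ hlt) W H σ rfl hσ
    induction hm : G.edgeSet.ncard using Nat.strong_induction_on generalizing G τ with
    | _ m ihm =>
      by_cases hconn : G.Connected
      · by_cases hdeg : NoDegreeTwo G
        · obtain ⟨T, hTcard, hT⟩ := h.exists_witness
          by_cases hcrit : IsCritical G k T
          · exact .refl h hconn (ncard_edgeSet_lt hTcard hdeg hcrit)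
          · exact reducesBelow_of_not_isCritical h hT hcrit fun H σ hlt hσ =>
              ihm _ (hm ▸ hlt) H σ hσ rfl
        · exact reducesBelow_of_not_noDegreeTwo h hdeg ihV
      · exact reducesBelow_of_not_connected h hk hconn ihV

/-- For every `k ≥ 1` there is an `M(k)` such that every `k`-tangle `τ` in a graph `G` admits
a sequence `G_0, …, G_m` of graphs with `k`-tangles `τ_i` such that `G_0 = G`, `τ_0 = τ`, each
`G_i` is obtained from `G_{i-1}` by deleting an edge, suppressing a vertex, or taking a proper
component, each `τ_{i-1}` survives as `τ_i`, and `G_m` is connected with fewer than `M(k)`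
edges. -/
theorem stmt3 (k : ℕ) (hk : 1 ≤ k) :
    ∃ M : ℕ, ∀ (V : Type) (instF : Fintype V) (instD : DecidableEq V)
      (G : SimpleGraph V) (τ : Set (Finset V × Finset V)),
      @IsTangle V instF instD G k τ →
      ∃ (m : ℕ) (GS : Fin (m + 1) → TGraph)
        (TS : ∀ i : Fin (m + 1), Set (Finset (GS i).V × Finset (GS i).V)),
        GS 0 = TGraph.mk V instF instD G ∧
        HEq (TS 0) τ ∧
        (∀ i : Fin (m + 1), @IsTangle (GS i).V (GS i).fin (GS i).deq (GS i).G k (TS i)) ∧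
        (∀ i : Fin m, SurvStep k (GS i.castSucc) (GS i.succ) (TS i.castSucc) (TS i.succ)) ∧
        (GS (Fin.last m)).G.Connected ∧
        (GS (Fin.last m)).G.edgeSet.ncard < M := by
  exact ⟨edgeBound k (witnessSize (3 * k)), fun V _ _ G τ h =>
    IsTangle.reducesBelow hk _ V G τ rfl h⟩
end

section
/- For every integer k ≥ 3 there exists an integer M = M(k) such that: for every k-tangle τ in a connected graph G with minimum degree at least 3 and at least M edges, there is an edge e of G such that τ extends to a k-tangle in G − e. -/
open Finset

variable {V : Type} [Fintype V] [DecidableEq V]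

namespace TangleDeletion

theorem isSep_iff {G : SimpleGraph V} {A B : Finset V} :
    IsSep G A B ↔ (∀ v, v ∈ A ∨ v ∈ B) ∧ ∀ a b, a ∉ B → b ∉ A → ¬ G.Adj a b := by
  constructor
  · rintro ⟨h, h'⟩
    have hc : ∀ v, v ∈ A ∨ v ∈ B := fun v => by
      have : v ∈ A ∪ B := h ▸ mem_univ v
      simpa using this
    refine ⟨hc, fun a b ha hb => h' a ?_ b ?_⟩
    · simp only [mem_sdiff]; exact ⟨(hc a).resolve_right ha, ha⟩
    · simp only [mem_sdiff]; exact ⟨(hc b).resolve_left hb, hb⟩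
  · rintro ⟨h, h'⟩
    refine ⟨by ext v; simpa using h v, fun a ha b hb => h' a b ?_ ?_⟩
    · exact (mem_sdiff.1 ha).2
    · exact (mem_sdiff.1 hb).2

theorem isSep_symm {G : SimpleGraph V} {A B : Finset V} (h : IsSep G A B) : IsSep G B A := by
  rw [isSep_iff] at *
  exact ⟨fun v => (h.1 v).symm, fun a b ha hb hab => h.2 b a hb ha hab.symm⟩

theorem isSep_inter_union {G : SimpleGraph V} {A B A' B' : Finset V} (h : IsSep G A B)
    (h' : IsSep G A' B') : IsSep G (A ∩ A') (B ∪ B') := by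
  rw [isSep_iff] at *
  simp only [mem_inter, mem_union]
  grind

theorem isSep_union_inter {G : SimpleGraph V} {A B A' B' : Finset V} (h : IsSep G A B)
    (h' : IsSep G A' B') : IsSep G (A ∪ A') (B ∩ B') :=
  isSep_symm (isSep_inter_union (isSep_symm h) (isSep_symm h'))

/-- The order of separations is modular. -/
theorem card_corners {α : Type*} [DecidableEq α] {A B A' B' : Finset α} (h : ∀ v, v ∈ A ∨ v ∈ B)
    (h' : ∀ v, v ∈ A' ∨ v ∈ B') :
    ((A ∩ A') ∩ (B ∪ B')).card + ((A ∪ A') ∩ (B ∩ B')).card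
      = (A ∩ B).card + (A' ∩ B').card := by
  rw [← card_union_add_card_inter, ← card_union_add_card_inter (A ∩ B)]
  congr 2 <;> ext v <;> simp only [mem_inter, mem_union] <;> grind

/-- `p` is, among the members of `τ` whose small side contains `X`, of least order and, subject to
that, has the largest small side. -/
def IsCanonical (τ : Set (Finset V × Finset V)) (X : Finset V) (p : Finset V × Finset V) : Prop :=
  p ∈ τ ∧ X ⊆ p.1 ∧ ∀ q ∈ τ, X ⊆ q.1 → (p.1 ∩ p.2).card ≤ (q.1 ∩ q.2).card ∧
    ((q.1 ∩ q.2).card = (p.1 ∩ p.2).card → q.1 ⊆ p.1)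

theorem exists_isCanonical {G : SimpleGraph V} {k : ℕ} {τ : Set (Finset V × Finset V)}
    (hτ : IsTangle G k τ) {X : Finset V} (h : ∃ p ∈ τ, X ⊆ p.1) : ∃ p, IsCanonical τ X p := by
  classical
  obtain ⟨hsep, hor, htri⟩ := hτ
  obtain ⟨p₀, hp₀, hp₀min⟩ := exists_min_image
    (univ.filter fun p : Finset V × Finset V => p ∈ τ ∧ X ⊆ p.1) (fun p => (p.1 ∩ p.2).card)
    (by obtain ⟨p, hp⟩ := h; exact ⟨p, by simpa using hp⟩)
  obtain ⟨p, hp, hpmax⟩ := exists_max_image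
    (univ.filter fun p : Finset V × Finset V =>
      p ∈ τ ∧ X ⊆ p.1 ∧ (p.1 ∩ p.2).card = (p₀.1 ∩ p₀.2).card) (fun p => p.1.card)
    ⟨p₀, by simpa using hp₀⟩
  simp only [mem_filter, mem_univ, true_and, and_imp] at hp₀ hp₀min hp hpmax
  refine ⟨p, hp.1, hp.2.1, fun q hq hXq => ⟨hp.2.2 ▸ hp₀min q hq hXq, fun hcard => ?_⟩⟩
  obtain ⟨hpτ, hXp, hpc⟩ := hp
  obtain ⟨sp, kp⟩ := hsep p hpτ
  obtain ⟨sq, kq⟩ := hsep q hq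
  have sum := card_corners (isSep_iff.1 sp).1 (isSep_iff.1 sq).1
  have hinter : (p₀.1 ∩ p₀.2).card ≤ ((p.1 ∩ q.1) ∩ (p.2 ∪ q.2)).card := by
    by_contra! hlt
    have hs := isSep_inter_union sp sq
    have : (p.1 ∩ q.1, p.2 ∪ q.2) ∈ τ := by
      rw [hor _ _ hs (by omega)]
      intro hmem
      refine htri _ hmem _ hpτ _ hq ⟨fun v => ?_, fun u v huv => ?_⟩
      · have := (isSep_iff.1 hs).1 v
        simp only [mem_inter, mem_union] at this ⊢
        tauto
      · have h1 := (isSep_iff.1 hs).1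
        have h2 := (isSep_iff.1 hs).2 u v
        have h3 := (isSep_iff.1 hs).2 v u
        have := huv.symm
        simp only [mem_inter, mem_union] at *
        grind
    have := hp₀min _ this (subset_inter hXp hXq)
    simp only at this
    omega
  have hs := isSep_union_inter sp sq
  have hmem : (p.1 ∪ q.1, p.2 ∩ q.2) ∈ τ := by
    rw [hor _ _ hs (by omega)]
    intro hmem
    refine htri _ hmem _ hpτ _ hq ⟨fun v => ?_, fun u v huv => ?_⟩
    · have := (isSep_iff.1 hs).1 v
      simp only [mem_inter, mem_union] at this ⊢
      tauto
    · have h1 := isSep_iff.1 sp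
      have h2 := isSep_iff.1 sq
      have := huv.symm
      simp only [mem_inter]
      grind
  have hc1 := hp₀min _ hmem (hXp.trans subset_union_left)
  have hc2 := hpmax _ hmem (hXp.trans subset_union_left) (by simp only at hc1 ⊢; omega)
  have := eq_of_subset_of_card_le subset_union_left hc2
  rw [this]
  exact subset_union_right

/-- `{u, v}` spans a vertex (if `u = v`) or an edge of `G` inside none of the three sets. -/
def Uncovered (G : SimpleGraph V) (A₁ A₂ A₃ : Finset V) (u v : V) : Prop :=
  (u = v ∨ G.Adj u v) ∧ ¬ (u ∈ A₁ ∧ v ∈ A₁) ∧ ¬ (u ∈ A₂ ∧ v ∈ A₂) ∧ ¬ (u ∈ A₃ ∧ v ∈ A₃)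

theorem exists_uncovered {G : SimpleGraph V} {A₁ A₂ A₃ : Finset V} (h : ¬ CoversG G A₁ A₂ A₃) :
    ∃ u v, Uncovered G A₁ A₂ A₃ u v := by
  unfold CoversG at h
  unfold Uncovered
  by_contra! hne
  apply h
  constructor
  · intro v
    have := hne v v
    tauto
  · intro u v huv
    have := hne u v
    tauto

/-- `Z` meets every three small sides of `τ` in a set that they do not cover. -/
def IsTripleCover (G : SimpleGraph V) (τ : Set (Finset V × Finset V)) (Z : Finset V) : Prop :=
  ∀ p₁ ∈ τ, ∀ p₂ ∈ τ, ∀ p₃ ∈ τ, ∃ u ∈ Z, ∃ v ∈ Z, Uncovered G p₁.1 p₂.1 p₃.1 u v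

theorem exists_eq_succ_of_monotone {f : ℕ → ℕ} (hf : Monotone f) {n : ℕ} (hn : ∀ i, f i < n) :
    ∃ i < n, f i = f (i + 1) := by
  by_contra! h
  have key : ∀ i ≤ n, i ≤ f i := by
    intro i
    induction i with
    | zero => simp
    | succ i ih =>
      intro hi
      have h1 := ih (by omega)
      have h2 := h i (by omega)
      have h3 := hf (Nat.le_succ i)
      simp only [Nat.succ_eq_add_one] at h3
      omega
  have := key n le_rfl
  have := hn n
  omega

/-- A bound on the size of the `i`-th of the growing sets in `exists_tripleCover`. -/
def tripleCoverBound : ℕ → ℕ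
  | 0 => 0
  | i + 1 => tripleCoverBound i + (2 ^ tripleCoverBound i) ^ 3 * 2

theorem exists_tripleCover (k : ℕ) {G : SimpleGraph V} {τ : Set (Finset V × Finset V)}
    (hτ : IsTangle G k τ) :
    ∃ Z : Finset V, Z.card ≤ tripleCoverBound (3 * k) ∧ IsTripleCover G τ Z := by
  classical
  have hK : ∀ X : Finset V, ∃ p : Finset V × Finset V,
      (∃ q ∈ τ, X ⊆ q.1) → IsCanonical τ X p := by
    intro X
    by_cases h : ∃ q ∈ τ, X ⊆ q.1
    · obtain ⟨p, hp⟩ := exists_isCanonical hτ h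
      exact ⟨p, fun _ => hp⟩
    · exact ⟨(∅, ∅), fun h' => absurd h' h⟩
  choose K hK using hK
  have hW : ∀ t : Finset V × Finset V × Finset V, ∃ W : Finset V, W.card ≤ 2 ∧
      (K t.1 ∈ τ → K t.2.1 ∈ τ → K t.2.2 ∈ τ →
        ∃ u ∈ W, ∃ v ∈ W, Uncovered G (K t.1).1 (K t.2.1).1 (K t.2.2).1 u v) := by
    intro t
    by_cases h : K t.1 ∈ τ ∧ K t.2.1 ∈ τ ∧ K t.2.2 ∈ τ
    · obtain ⟨u, v, huv⟩ := exists_uncovered (hτ.2.2 _ h.1 _ h.2.1 _ h.2.2)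
      exact ⟨{u, v}, card_le_two, fun _ _ _ => ⟨u, by simp, v, by simp, huv⟩⟩
    · exact ⟨∅, by simp, fun h1 h2 h3 => absurd ⟨h1, h2, h3⟩ h⟩
  choose W hWcard hW using hW
  let next : Finset V → Finset V := fun Z =>
    Z ∪ (Z.powerset ×ˢ Z.powerset ×ˢ Z.powerset).biUnion W
  let Z : ℕ → Finset V := fun i => next^[i] ∅
  have hZsucc : ∀ i, Z (i + 1) = next (Z i) := fun i => Function.iterate_succ_apply' next i ∅
  have hZmono : Monotone Z := monotone_nat_of_le_succ fun i => by
    rw [hZsucc]; exact subset_union_left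
  have hZcard : ∀ i, (Z i).card ≤ tripleCoverBound i := by
    intro i
    induction i with
    | zero => simp [Z]
    | succ i ih =>
      rw [hZsucc]
      refine (card_union_le _ _).trans ?_
      rw [tripleCoverBound]
      refine add_le_add ih ((card_biUnion_le_card_mul _ _ 2 fun t _ => hWcard t).trans ?_)
      simp only [card_product, card_powerset]
      refine Nat.mul_le_mul_right 2 ?_
      calc 2 ^ (Z i).card * (2 ^ (Z i).card * 2 ^ (Z i).card) = (2 ^ (Z i).card) ^ 3 := by ring
        _ ≤ _ := by gcongr; norm_num
  refine ⟨Z (3 * k), hZcard _, fun p₁ h₁ p₂ h₂ p₃ h₃ => ?_⟩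
  have hcan : ∀ p ∈ τ, ∀ i, IsCanonical τ (p.1 ∩ Z i) (K (p.1 ∩ Z i)) :=
    fun p hp i => hK _ ⟨p, hp, inter_subset_left⟩
  let o : Finset V × Finset V → ℕ → ℕ := fun p i =>
    ((K (p.1 ∩ Z i)).1 ∩ (K (p.1 ∩ Z i)).2).card
  have hstep : ∀ p ∈ τ, ∀ i j, i ≤ j → o p i ≤ o p j ∧
      (o p j = o p i → (K (p.1 ∩ Z j)).1 ⊆ (K (p.1 ∩ Z i)).1) := by
    intro p hp i j hij
    exact (hcan p hp i).2.2 _ (hcan p hp j).1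
      ((inter_subset_inter_left (hZmono hij)).trans (hcan p hp j).2.1)
  have hok : ∀ p ∈ τ, ∀ i, o p i < k := fun p hp i => (hτ.1 _ (hcan p hp i).1).2
  obtain ⟨i, hi, heq⟩ := exists_eq_succ_of_monotone (f := fun i => o p₁ i + o p₂ i + o p₃ i)
    (n := 3 * k)
    (fun i j hij => add_le_add (add_le_add (hstep p₁ h₁ i j hij).1 (hstep p₂ h₂ i j hij).1)
      (hstep p₃ h₃ i j hij).1)
    (fun i => by have := hok p₁ h₁ i; have := hok p₂ h₂ i; have := hok p₃ h₃ i; omega)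
  have s₁ := hstep p₁ h₁ i (i + 1) (Nat.le_succ i)
  have s₂ := hstep p₂ h₂ i (i + 1) (Nat.le_succ i)
  have s₃ := hstep p₃ h₃ i (i + 1) (Nat.le_succ i)
  obtain ⟨u, hu, v, hv, huv⟩ := hW (p₁.1 ∩ Z i, p₂.1 ∩ Z i, p₃.1 ∩ Z i)
    (hcan p₁ h₁ i).1 (hcan p₂ h₂ i).1 (hcan p₃ h₃ i).1
  have hsub : W (p₁.1 ∩ Z i, p₂.1 ∩ Z i, p₃.1 ∩ Z i) ⊆ Z (i + 1) := by
    rw [hZsucc]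
    refine subset_union_right.trans' (subset_biUnion_of_mem W ?_)
    simp [inter_subset_right]
  have hu' := hsub hu
  have hv' := hsub hv
  have hin : ∀ p ∈ τ, (K (p.1 ∩ Z (i + 1))).1 ⊆ (K (p.1 ∩ Z i)).1 → ∀ x ∈ p.1, x ∈ Z (i + 1) →
      x ∈ (K (p.1 ∩ Z i)).1 := fun p hp hs x hx hxZ =>
    hs ((hcan p hp (i + 1)).2.1 (mem_inter.2 ⟨hx, hxZ⟩))
  have hle : Z (i + 1) ⊆ Z (3 * k) := hZmono hi
  refine ⟨u, hle hu', v, hle hv', huv.1, ?_, ?_, ?_⟩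
  · rintro ⟨a, b⟩
    have hs := s₁.2 (by omega)
    exact huv.2.1 ⟨hin p₁ h₁ hs u a hu', hin p₁ h₁ hs v b hv'⟩
  · rintro ⟨a, b⟩
    have hs := s₂.2 (by omega)
    exact huv.2.2.1 ⟨hin p₂ h₂ hs u a hu', hin p₂ h₂ hs v b hv'⟩
  · rintro ⟨a, b⟩
    have hs := s₃.2 (by omega)
    exact huv.2.2.2 ⟨hin p₃ h₃ hs u a hu', hin p₃ h₃ hs v b hv'⟩

/-- If the separations of `G - uv` of order `< k` can be replaced by separations of `G` without
shrinking their traces on a triple cover of `τ`, then `τ` extends to `G - uv`. -/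
theorem exists_isTangle_deleteEdges {G : SimpleGraph V} {k : ℕ} {τ : Set (Finset V × Finset V)}
    (hτ : IsTangle G k τ) {Z : Finset V} (hZ : IsTripleCover G τ Z) {u v : V}
    (huv : ¬ (u ∈ Z ∧ v ∈ Z))
    (h : ∀ C D, IsSep (G.deleteEdges {s(u, v)}) C D → (C ∩ D).card < k →
      ∃ C' D', IsSep G C' D' ∧ (C' ∩ D').card < k ∧ C ∩ Z ⊆ C' ∧ D ∩ Z ⊆ D') :
    ∃ τ' : Set (Finset V × Finset V), IsTangle (G.deleteEdges {s(u, v)}) k τ' ∧ τ ⊆ τ' := by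
  have hsep : ∀ {A B : Finset V}, IsSep G A B → IsSep (G.deleteEdges {s(u, v)}) A B := by
    intro A B hAB
    rw [isSep_iff] at *
    exact ⟨hAB.1, fun a b ha hb hab => hAB.2 a b ha hb (G.deleteEdges_le _ hab)⟩
  have hadj : ∀ a b, a ∈ Z → b ∈ Z → G.Adj a b → (G.deleteEdges {s(u, v)}).Adj a b := by
    intro a b ha hb hab
    rw [SimpleGraph.deleteEdges_adj]
    refine ⟨hab, fun he => huv ?_⟩
    simp only [Set.mem_singleton_iff, Sym2.eq_iff] at he
    rcases he with ⟨rfl, rfl⟩ | ⟨rfl, rfl⟩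
    · exact ⟨ha, hb⟩
    · exact ⟨hb, ha⟩
  have htri : ∀ p₁ ∈ τ, ∀ p₂ ∈ τ, ∀ p₃ ∈ τ, ∀ C₁ C₂ C₃ : Finset V, C₁ ∩ Z ⊆ p₁.1 → C₂ ∩ Z ⊆ p₂.1 →
      C₃ ∩ Z ⊆ p₃.1 → ¬ CoversG (G.deleteEdges {s(u, v)}) C₁ C₂ C₃ := by
    intro p₁ h₁ p₂ h₂ p₃ h₃ C₁ C₂ C₃ s₁ s₂ s₃ hcov
    obtain ⟨a, ha, b, hb, hab, n₁, n₂, n₃⟩ := hZ p₁ h₁ p₂ h₂ p₃ h₃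
    have key : (a ∈ C₁ ∧ b ∈ C₁) ∨ (a ∈ C₂ ∧ b ∈ C₂) ∨ (a ∈ C₃ ∧ b ∈ C₃) := by
      rcases hab with rfl | hab
      · simpa using hcov.1 a
      · exact hcov.2 a b (hadj a b ha hb hab)
    rcases key with ⟨x, y⟩ | ⟨x, y⟩ | ⟨x, y⟩
    · exact n₁ ⟨s₁ (mem_inter.2 ⟨x, ha⟩), s₁ (mem_inter.2 ⟨y, hb⟩)⟩
    · exact n₂ ⟨s₂ (mem_inter.2 ⟨x, ha⟩), s₂ (mem_inter.2 ⟨y, hb⟩)⟩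
    · exact n₃ ⟨s₃ (mem_inter.2 ⟨x, ha⟩), s₃ (mem_inter.2 ⟨y, hb⟩)⟩
  refine ⟨{p | IsSep (G.deleteEdges {s(u, v)}) p.1 p.2 ∧ (p.1 ∩ p.2).card < k ∧
    ∃ q ∈ τ, p.1 ∩ Z ⊆ q.1}, ⟨fun p hp => ⟨hp.1, hp.2.1⟩, fun A B hAB hk => ?_, ?_⟩, ?_⟩
  · constructor
    · rintro ⟨-, -, q₁, hq₁, hs₁⟩ ⟨-, -, q₂, hq₂, hs₂⟩
      refine htri q₁ hq₁ q₂ hq₂ q₂ hq₂ A B B hs₁ hs₂ hs₂ ⟨fun w => ?_, fun a b hab => ?_⟩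
      · have := (isSep_iff.1 hAB).1 w
        tauto
      · have h1 := isSep_iff.1 hAB
        have := hab.symm
        grind
    · intro hBA
      refine ⟨hAB, hk, ?_⟩
      obtain ⟨C', D', hs, hk', hC, hD⟩ := h A B hAB hk
      by_cases hm : (C', D') ∈ τ
      · exact ⟨_, hm, hC⟩
      · refine absurd ⟨isSep_symm hAB, by rwa [inter_comm], (D', C'), ?_, hD⟩ hBA
        by_contra hm'
        exact hm ((hτ.2.1 C' D' hs hk').2 hm')
  · rintro p₁ ⟨-, -, q₁, hq₁, hs₁⟩ p₂ ⟨-, -, q₂, hq₂, hs₂⟩ p₃ ⟨-, -, q₃, hq₃, hs₃⟩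
    exact htri q₁ hq₁ q₂ hq₂ q₃ hq₃ _ _ _ hs₁ hs₂ hs₃
  · intro p hp
    exact ⟨hsep (hτ.1 p hp).1, (hτ.1 p hp).2, p, hp, inter_subset_left⟩

/-- Every separation of `G` with `X` on the first and `Y` on the second side has order `≥ k`. -/
def MinSep (G : SimpleGraph V) (k : ℕ) (X Y : Finset V) : Prop :=
  ∀ A B : Finset V, IsSep G A B → X ⊆ A → Y ⊆ B → k ≤ (A ∩ B).card

/-- `(A, B)` is a separation of order `k` with `X` on the first and `Y` on the second side. -/
def Tight (G : SimpleGraph V) (k : ℕ) (X Y A B : Finset V) : Prop :=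
  IsSep G A B ∧ X ⊆ A ∧ Y ⊆ B ∧ (A ∩ B).card = k

/-- No separation of `G` with `X` and `Y` on different sides has order `< k`, but `G - uv` has one,
with `u` strictly on the side of `X`. -/
def Crit (G : SimpleGraph V) (k : ℕ) (X Y : Finset V) (u v : V) : Prop :=
  MinSep G k X Y ∧ G.Adj u v ∧ ∃ C D : Finset V, (∀ w, w ∈ C ∨ w ∈ D) ∧
    (∀ a b, a ∉ D → b ∉ C → G.Adj a b → a = u ∧ b = v) ∧ X ⊆ C ∧ Y ⊆ D ∧
    (C ∩ D).card < k ∧ u ∉ D ∧ v ∉ C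

/-- Every edge of `G` not inside `Z` is critical for some two subsets of `Z`. -/
def AllCrit (G : SimpleGraph V) (k : ℕ) (Z : Finset V) : Prop :=
  ∀ u v, G.Adj u v → ¬ (u ∈ Z ∧ v ∈ Z) →
    ∃ X ⊆ Z, ∃ Y ⊆ Z, Crit G k X Y u v ∨ Crit G k X Y v u

theorem MinSep.symm {G : SimpleGraph V} {k : ℕ} {X Y : Finset V} (h : MinSep G k X Y) :
    MinSep G k Y X := fun A B hAB hA hB => by
  rw [inter_comm]; exact h B A (isSep_symm hAB) hB hA

theorem Crit.symm {G : SimpleGraph V} {k : ℕ} {X Y : Finset V} {u v : V}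
    (h : Crit G k X Y u v) : Crit G k Y X v u := by
  obtain ⟨hm, huv, C, D, hc, he, hX, hY, hk, hu, hv⟩ := h
  exact ⟨hm.symm, huv.symm, D, C, fun w => (hc w).symm,
    fun a b ha hb hab => (he b a hb ha hab.symm).symm, hY, hX, by rwa [inter_comm], hv, hu⟩

theorem Crit.unique_right {G : SimpleGraph V} {k : ℕ} {X Y : Finset V} {u v w : V}
    (h : Crit G k X Y u v) (h' : Crit G k X Y u w) : v = w := by
  obtain ⟨hm, huv, C, D, hc, he, hX, hY, hk, hu, hv⟩ := h
  obtain ⟨-, huw, C', D', hc', he', hX', hY', hk', hu', hw'⟩ := h'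
  by_contra hne
  have h1 : IsSep G (C ∪ C') (D ∩ D') := by
    rw [isSep_iff]
    simp only [mem_union, mem_inter]
    grind
  have h2 : IsSep G (C ∩ C') (insert u (D ∪ D')) := by
    rw [isSep_iff]
    simp only [mem_union, mem_inter, mem_insert]
    grind
  have k1 := hm _ _ h1 (hX.trans subset_union_left) (subset_inter hY hY')
  have k2 := hm _ _ h2 (subset_inter hX hX')
    ((hY.trans subset_union_left).trans (subset_insert _ _))
  have k3 : ((C ∩ C') ∩ insert u (D ∪ D')).card ≤ ((C ∩ C') ∩ (D ∪ D')).card + 1 := by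
    refine (card_le_card ?_).trans (card_insert_le u _)
    intro x
    simp only [mem_inter, mem_insert]
    tauto
  have := card_corners hc hc'
  omega

theorem Crit.unique_left {G : SimpleGraph V} {k : ℕ} {X Y : Finset V} {u v w : V}
    (h : Crit G k X Y v u) (h' : Crit G k X Y w u) : v = w :=
  h.symm.unique_right h'.symm

theorem AllCrit.exists_neighbors {G : SimpleGraph V} {k : ℕ} {Z : Finset V} (h : AllCrit G k Z)
    (w : V) : ∃ N : Finset V, N.card ≤ Z.card + 2 ^ Z.card * 2 ^ Z.card * 2 ∧
      ∀ v, G.Adj w v → v ∈ N := by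
  classical
  have hone : ∀ p : Finset V × Finset V,
      (univ.filter fun v => Crit G k p.1 p.2 w v ∨ Crit G k p.1 p.2 v w).card ≤ 2 := by
    intro p
    rw [filter_or]
    refine (card_union_le _ _).trans (add_le_add (b := 1) (d := 1) ?_ ?_)
    · refine card_le_one.2 fun a ha b hb => ?_
      exact (mem_filter.1 ha).2.unique_right (mem_filter.1 hb).2
    · refine card_le_one.2 fun a ha b hb => ?_
      exact (mem_filter.1 ha).2.unique_left (mem_filter.1 hb).2
  refine ⟨Z ∪ (Z.powerset ×ˢ Z.powerset).biUnion fun p =>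
    univ.filter fun v => Crit G k p.1 p.2 w v ∨ Crit G k p.1 p.2 v w, ?_, fun v hv => ?_⟩
  · refine (card_union_le _ _).trans (add_le_add le_rfl ?_)
    refine (card_biUnion_le_card_mul _ _ 2 fun p _ => hone p).trans ?_
    simp
  · by_cases hZ : v ∈ Z
    · exact mem_union_left _ hZ
    · obtain ⟨X, hX, Y, hY, hc⟩ := h w v hv (by tauto)
      refine mem_union_right _ (mem_biUnion.2 ⟨(X, Y), ?_, ?_⟩)
      · simp [hX, hY]
      · simpa using hc

theorem AllCrit.eq_empty_of_closed {G : SimpleGraph V} {k : ℕ} {Z : Finset V}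
    (h : AllCrit G k Z) (hdeg : ∀ v : V, ∃ w, G.Adj v w) {K : Finset V} (hK : Disjoint K Z)
    (hcl : ∀ x ∈ K, ∀ y, G.Adj x y → y ∈ K) : K = ∅ := by
  by_contra hne
  obtain ⟨x, hx⟩ := nonempty_iff_ne_empty.2 hne
  obtain ⟨y, hxy⟩ := hdeg x
  have hKZ : ∀ z ∈ Z, z ∉ K := fun z hz hzK => disjoint_left.1 hK hzK hz
  have main : ∀ X ⊆ Z, ∀ Y ⊆ Z, ∀ u ∈ K, ∀ v ∈ K, ¬ Crit G k X Y u v := by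
    rintro X - Y hY u hu v hv ⟨hm, huv, C, D, hc, he, hX, hYD, hk, -, -⟩
    have hs : IsSep G (C ∪ K) (D \ K) := by
      rw [isSep_iff]
      simp only [mem_union, mem_sdiff]
      have hcl' : ∀ x ∈ K, ∀ y, G.Adj y x → y ∈ K := fun x hx y hxy => hcl x hx y hxy.symm
      grind
    have := hm _ _ hs (hX.trans subset_union_left) fun z hz =>
      mem_sdiff.2 ⟨hYD hz, hKZ z (hY hz)⟩
    have : ((C ∪ K) ∩ (D \ K)).card ≤ (C ∩ D).card := card_le_card fun z => by
      simp only [mem_inter, mem_union, mem_sdiff]; tauto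
    omega
  have hy := hcl x hx y hxy
  obtain ⟨X, hX, Y, hY, hc | hc⟩ := h x y hxy fun hh => hKZ x hh.1 hx
  · exact main X hX Y hY x hx y hy hc
  · exact main X hX Y hY y hy x hx hc

theorem Tight.inter {G : SimpleGraph V} {k : ℕ} {X Y A B A' B' : Finset V} (hm : MinSep G k X Y)
    (h : Tight G k X Y A B) (h' : Tight G k X Y A' B') :
    Tight G k X Y (A ∩ A') (B ∪ B') ∧ Tight G k X Y (A ∪ A') (B ∩ B') := by
  obtain ⟨s, hX, hY, hk⟩ := h
  obtain ⟨s', hX', hY', hk'⟩ := h'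
  have t := isSep_inter_union s s'
  have t' := isSep_union_inter s s'
  have e := hm _ _ t (subset_inter hX hX') (hY.trans subset_union_left)
  have e' := hm _ _ t' (hX.trans subset_union_left) (subset_inter hY hY')
  have := card_corners (isSep_iff.1 s).1 (isSep_iff.1 s').1
  exact ⟨⟨t, subset_inter hX hX', hY.trans subset_union_left, by omega⟩,
    ⟨t', hX.trans subset_union_left, subset_inter hY hY', by omega⟩⟩

theorem Tight.antitone {G : SimpleGraph V} {k : ℕ} {X Y A B A' B' : Finset V}
    (hm : MinSep G k X Y) (h : Tight G k X Y A B) (h' : Tight G k X Y A' B') (hA : A ⊆ A') :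
    B' ⊆ B := by
  have t := (h.inter hm h').1
  rw [inter_eq_left.2 hA] at t
  have : A ∩ B = A ∩ (B ∪ B') := eq_of_subset_of_card_le
    (inter_subset_inter_left subset_union_left) (by rw [t.2.2.2, h.2.2.2])
  intro x hx
  rcases (isSep_iff.1 h.1).1 x with hxA | hxB
  · have : x ∈ A ∩ B := this ▸ mem_inter.2 ⟨hxA, mem_union_right _ hx⟩
    exact (mem_inter.1 this).2
  · exact hxB

theorem Crit.exists_tight {G : SimpleGraph V} {k : ℕ} {X Y : Finset V} {u v : V}
    (h : Crit G k X Y u v) : ∃ A B, Tight G k X Y A B ∧ u ∈ A ∩ B := by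
  obtain ⟨hm, huv, C, D, hc, he, hX, hY, hk, hu, hv⟩ := h
  have hs : IsSep G C (insert u D) := by
    rw [isSep_iff]
    simp only [mem_insert]
    grind
  have huC := (hc u).resolve_right hu
  refine ⟨C, insert u D, ⟨hs, hX, hY.trans (subset_insert _ _), ?_⟩, by simp [huC]⟩
  have h1 := hm _ _ hs hX (hY.trans (subset_insert _ _))
  rw [inter_insert_of_mem huC] at h1 ⊢
  have := card_insert_le u (C ∩ D)
  omega

/-- Large finite lattices of sets contain long chains. -/
theorem exists_chain_of_card (t : ℕ) : ∃ n : ℕ, ∀ {α : Type} [DecidableEq α]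
    (𝓐 : Finset (Finset α)), (∀ A ∈ 𝓐, ∀ B ∈ 𝓐, A ∩ B ∈ 𝓐 ∧ A ∪ B ∈ 𝓐) → n ≤ 𝓐.card →
      ∃ c ⊆ 𝓐, IsChain (· ⊆ ·) (c : Set (Finset α)) ∧ t ≤ c.card := by
  induction t with
  | zero => exact ⟨0, fun 𝓐 _ _ => ⟨∅, by simp, by simp [IsChain], by simp⟩⟩
  | succ t ih =>
    obtain ⟨n, hn⟩ := ih
    refine ⟨n * n + 3, fun {α} _ 𝓐 hlat hcard => ?_⟩
    have hne : 𝓐.Nonempty := card_pos.1 (by omega)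
    obtain ⟨L, hL, hLmin⟩ := exists_min_image 𝓐 card hne
    obtain ⟨U, hU, hUmax⟩ := exists_max_image 𝓐 card hne
    have hLle : ∀ B ∈ 𝓐, L ⊆ B := fun B hB => by
      have := eq_of_subset_of_card_le inter_subset_left (hLmin _ (hlat L hL B hB).1)
      rw [← this]; exact inter_subset_right
    have hUle : ∀ B ∈ 𝓐, B ⊆ U := fun B hB => by
      have := eq_of_subset_of_card_le subset_union_left (hUmax _ (hlat U hU B hB).2)
      rw [this]; exact subset_union_right
    obtain ⟨A, hA⟩ : ((𝓐.erase L).erase U).Nonempty := by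
      have := pred_card_le_card_erase (s := 𝓐) (a := L)
      have := pred_card_le_card_erase (s := 𝓐.erase L) (a := U)
      exact card_pos.1 (by omega)
    simp only [mem_erase] at hA
    obtain ⟨hAU, hAL, hA⟩ := hA
    have hprod : 𝓐.card ≤ (𝓐.filter (· ⊆ A)).card * (𝓐.filter (A ⊆ ·)).card := by
      rw [← card_product]
      refine card_le_card_of_injOn (fun B => (B ∩ A, B ∪ A)) ?_ ?_
      · intro B hB
        have := hlat B hB A hA
        simp [this]
      · intro B _ B' _ hBB
        simp only [Prod.mk.injEq, Finset.ext_iff, mem_inter, mem_union] at hBB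
        ext x
        have h1 := hBB.1 x
        have h2 := hBB.2 x
        tauto
    rcases le_or_gt n (𝓐.filter (· ⊆ A)).card with h | h
    · obtain ⟨c, hc, hch, hct⟩ := hn (𝓐.filter (· ⊆ A)) (by
        intro B hB B' hB'
        simp only [mem_filter] at hB hB' ⊢
        exact ⟨⟨(hlat B hB.1 B' hB'.1).1, inter_subset_left.trans hB.2⟩,
          ⟨(hlat B hB.1 B' hB'.1).2, union_subset hB.2 hB'.2⟩⟩) h
      refine ⟨insert U c, insert_subset hU (hc.trans (filter_subset _ _)), ?_, ?_⟩
      · rw [coe_insert]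
        exact hch.insert fun B hB _ => Or.inr (hUle B (mem_filter.1 (hc hB)).1)
      · rw [card_insert_of_notMem]
        · omega
        · intro hUc
          have := (mem_filter.1 (hc hUc)).2
          exact hAU (subset_antisymm (hUle A hA) this)
    · obtain ⟨c, hc, hch, hct⟩ := hn (𝓐.filter (A ⊆ ·)) (by
        intro B hB B' hB'
        simp only [mem_filter] at hB hB' ⊢
        exact ⟨⟨(hlat B hB.1 B' hB'.1).1, subset_inter hB.2 hB'.2⟩,
          ⟨(hlat B hB.1 B' hB'.1).2, hB.2.trans subset_union_left⟩⟩) (by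
        by_contra! h'
        have := Nat.mul_le_mul h.le h'.le
        omega)
      refine ⟨insert L c, insert_subset hL (hc.trans (filter_subset _ _)), ?_, ?_⟩
      · rw [coe_insert]
        exact hch.insert fun B hB _ => Or.inl (hLle B (mem_filter.1 (hc hB)).1)
      · rw [card_insert_of_notMem]
        · omega
        · intro hLc
          have := (mem_filter.1 (hc hLc)).2
          exact hAL (subset_antisymm this (hLle A hA))

/-- A chain of sets can be listed in increasing order. -/
theorem exists_seq_of_chain {α : Type*} [DecidableEq α] (n : ℕ) :
    ∀ c : Finset (Finset α), IsChain (· ⊆ ·) (c : Set (Finset α)) → n ≤ c.card →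
      ∃ A : ℕ → Finset α, (∀ i < n, A i ∈ c) ∧ ∀ i j, i < j → j < n → A i ⊂ A j := by
  induction n with
  | zero => exact fun c _ _ => ⟨fun _ => ∅, by simp, by simp⟩
  | succ n ih =>
    intro c hc hn
    obtain ⟨U, hU, hUmax⟩ := exists_max_image c card (card_pos.1 (by omega))
    have hUle : ∀ B ∈ c, B ⊆ U := fun B hB => by
      rcases hc.total hB hU with h | h
      · exact h
      · exact (eq_of_subset_of_card_le h (hUmax B hB)).ge
    obtain ⟨A, hA, hmono⟩ := ih (c.erase U) (hc.mono (by simp)) (by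
      have := pred_card_le_card_erase (s := c) (a := U); omega)
    refine ⟨fun i => if i = n then U else A i, fun i hi => ?_, fun i j hij hj => ?_⟩
    · dsimp only
      split_ifs with h
      · exact hU
      · exact mem_of_mem_erase (hA i (by omega))
    · dsimp only
      rw [if_neg (by omega : ¬ i = n)]
      split_ifs with h
      · have := mem_erase.1 (hA i (by omega))
        exact (hUle _ this.2).ssubset_of_ne this.1
      · exact hmono i j hij (by omega)

/-- `(C, D)` is a separation of the graph obtained from `G` by deleting the edge `uv`. -/
def SepDelete (G : SimpleGraph V) (u v : V) (C D : Finset V) : Prop :=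
  (∀ w, w ∈ C ∨ w ∈ D) ∧
    ∀ a b, a ∉ D → b ∉ C → G.Adj a b → (a = u ∧ b = v) ∨ (a = v ∧ b = u)

theorem SepDelete.symm {G : SimpleGraph V} {u v : V} {C D : Finset V}
    (h : SepDelete G u v C D) : SepDelete G u v D C :=
  ⟨fun w => (h.1 w).symm, fun a b ha hb hab => by
    have := h.2 b a hb ha hab.symm
    tauto⟩

theorem Crit.sepDelete {G : SimpleGraph V} {k : ℕ} {X Y : Finset V} {u v : V}
    (h : Crit G k X Y u v ∨ Crit G k X Y v u) :
    MinSep G k X Y ∧ ∃ C D, SepDelete G u v C D ∧ X ⊆ C ∧ Y ⊆ D ∧ (C ∩ D).card < k := by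
  rcases h with ⟨hm, -, C, D, hc, he, hX, hY, hk, -, -⟩ | ⟨hm, -, C, D, hc, he, hX, hY, hk, -, -⟩
  · exact ⟨hm, C, D, ⟨hc, fun a b ha hb hab => Or.inl (he a b ha hb hab)⟩, hX, hY, hk⟩
  · exact ⟨hm, C, D, ⟨hc, fun a b ha hb hab => Or.inr (he a b ha hb hab)⟩, hX, hY, hk⟩

theorem SepDelete.isSep_or_crit {G : SimpleGraph V} {k : ℕ} {X Y : Finset V} {u v : V}
    (hm : MinSep G k X Y) {C D : Finset V} (h : SepDelete G u v C D) (hX : X ⊆ C) (hY : Y ⊆ D)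
    (hk : (C ∩ D).card < k) : Crit G k X Y u v ∨ Crit G k X Y v u := by
  have hns : ¬ IsSep G C D := fun hs => (hm C D hs hX hY).not_gt hk
  rw [isSep_iff] at hns
  push Not at hns
  obtain ⟨a, b, ha, hb, hab⟩ := hns h.1
  have hcr : Crit G k X Y a b := by
    refine ⟨hm, hab, C, D, h.1, fun a' b' ha' hb' hab' => ?_, hX, hY, hk, ha, hb⟩
    have h1 := h.1 a
    have h2 := h.1 b
    have h3 := h.2 a b ha hb hab
    have h4 := h.2 a' b' ha' hb' hab'
    grind
  rcases h.2 a b ha hb hab with ⟨rfl, rfl⟩ | ⟨rfl, rfl⟩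
  · exact Or.inl hcr
  · exact Or.inr hcr

theorem exists_adj_not_crit {G : SimpleGraph V} {k : ℕ} {X Y : Finset V} {w : V}
    (hdeg : 3 ≤ (G.neighborSet w).ncard) :
    ∃ v, G.Adj w v ∧ ¬ (Crit G k X Y w v ∨ Crit G k X Y v w) := by
  by_contra! h
  obtain ⟨a, ha, b, hb, c, hc, hab, hac, hbc⟩ := (Set.two_lt_ncard (Set.toFinite _)).1 hdeg
  rw [SimpleGraph.mem_neighborSet] at ha hb hc
  rcases h a ha with h1 | h1 <;> rcases h b hb with h2 | h2 <;> rcases h c hc with h3 | h3 <;>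
    first
    | exact hab (h1.unique_right h2)
    | exact hab (h1.unique_left h2)
    | exact hac (h1.unique_right h3)
    | exact hac (h1.unique_left h3)
    | exact hbc (h2.unique_right h3)
    | exact hbc (h2.unique_left h3)

/-- If both boundaries of a strip lie strictly on the same side of a separation, the whole strip
can be moved to that side. -/
theorem exists_sep_of_same {G : SimpleGraph V} {u v : V} {A₁ B₁ A₂ B₂ F Z S C D : Finset V}
    (h₁ : IsSep G A₁ B₁) (h₂ : IsSep G A₂ B₂)
    (hS : ∀ x, x ∈ S ↔ x ∈ B₁ ∧ x ∈ A₂ ∧ x ∉ F) (hu : u ∈ S) (hv : v ∈ S)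
    (hSF : ∀ x ∈ S, ∀ f ∈ F, ¬ G.Adj x f) (hSZ : ∀ x ∈ S, x ∉ Z) (hCD : SepDelete G u v C D)
    (hT₁ : ∀ x ∈ S, x ∈ A₁ → x ∉ D) (hT₂ : ∀ x ∈ S, x ∈ B₂ → x ∉ D) :
    ∃ C' D', IsSep G C' D' ∧ (C' ∩ D').card ≤ (C ∩ D).card ∧ C ∩ Z ⊆ C' ∧ D ∩ Z ⊆ D' := by
  obtain ⟨c₁, s₁⟩ := isSep_iff.1 h₁
  obtain ⟨c₂, s₂⟩ := isSep_iff.1 h₂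
  refine ⟨C ∪ S, D \ S, ?_, card_le_card ?_, ?_, ?_⟩
  · rw [isSep_iff]
    refine ⟨fun x => ?_, fun a b ha hb hab => ?_⟩
    · have := hCD.1 x
      simp only [mem_union, mem_sdiff]; tauto
    · simp only [mem_union, mem_sdiff, not_or, not_and, not_not] at ha hb
      have key : a ∉ D → False := fun h => by
        rcases hCD.2 a b h hb.1 hab with ⟨-, rfl⟩ | ⟨-, rfl⟩
        · exact hb.2 hv
        · exact hb.2 hu
      have haS : a ∈ S := ha (not_not.1 key)
      have hbF : b ∉ F := fun hf => hSF a haS b hf hab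
      have haS' := (hS a).1 haS
      by_cases hb1 : b ∈ B₁
      · have hb2 : b ∉ A₂ := fun h => hb.2 ((hS b).2 ⟨hb1, h, hbF⟩)
        by_cases haB : a ∈ B₂
        · exact key (hT₂ a haS haB)
        · exact s₂ a b haB hb2 hab
      · by_cases haA : a ∈ A₁
        · exact key (hT₁ a haS haA)
        · exact s₁ b a hb1 haA hab.symm
  · intro x; simp only [mem_inter, mem_union, mem_sdiff]; tauto
  · intro x; simp only [mem_inter, mem_union]; tauto
  · intro x; simp only [mem_inter, mem_sdiff]; exact fun h => ⟨h.1, fun hx => hSZ x hx h.2⟩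

/-- If the boundaries of a strip lie strictly on different sides of a separation and `G - uv` has
no small separation along the strip, then the separation can be moved out of the strip. -/
theorem exists_sep_of_opposite {G : SimpleGraph V} {k : ℕ} {u v : V} {X Y : Finset V}
    {A₁ B₁ A₂ B₂ F Z S C D : Finset V}
    (h₁ : IsSep G A₁ B₁) (h₂ : IsSep G A₂ B₂) (hk : (A₁ ∩ B₁).card = k) (hX : X ⊆ A₁)
    (hY : Y ⊆ B₂) (hF : F ⊆ A₁ ∩ B₁) (hAB : A₁ ∩ B₂ ⊆ F)
    (hS : ∀ x, x ∈ S ↔ x ∈ B₁ ∧ x ∈ A₂ ∧ x ∉ F) (hu : u ∈ S) (hv : v ∈ S)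
    (hSF : ∀ x ∈ S, ∀ f ∈ F, ¬ G.Adj x f) (hSZ : ∀ x ∈ S, x ∉ Z)
    (hcrit : ∀ C D, SepDelete G u v C D → X ⊆ C → Y ⊆ D → k ≤ (C ∩ D).card)
    (hCD : SepDelete G u v C D)
    (hT₁ : ∀ x ∈ S, x ∈ A₁ → x ∉ D) (hT₂ : ∀ x ∈ S, x ∈ B₂ → x ∉ C) :
    ∃ C' D', IsSep G C' D' ∧ (C' ∩ D').card ≤ (C ∩ D).card ∧ C ∩ Z ⊆ C' ∧ D ∩ Z ⊆ D' := by
  obtain ⟨c₁, s₁⟩ := isSep_iff.1 h₁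
  obtain ⟨c₂, s₂⟩ := isSep_iff.1 h₂
  have hnew : SepDelete G u v (A₁ ∪ (C ∩ (B₁ ∩ A₂))) (B₂ ∪ (D ∩ (B₁ ∩ A₂))) := by
    refine ⟨fun x => ?_, fun a b ha hb hab => ?_⟩
    · have := hCD.1 x
      have := c₁ x
      have := c₂ x
      simp only [mem_union, mem_inter]
      tauto
    · simp only [mem_union, mem_inter, not_or, not_and] at ha hb
      have ha2 : a ∈ A₂ := (c₂ a).resolve_right ha.1
      have hb1 : b ∈ B₁ := (c₁ b).resolve_left hb.1
      have ha1 : a ∈ B₁ := by by_contra h; exact s₁ a b h hb.1 hab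
      have hb2 : b ∈ A₂ := by by_contra h; exact s₂ a b ha.1 h hab
      exact hCD.2 a b (fun h => ha.2 h ha1 ha2) (fun h => hb.2 h hb1 hb2) hab
  have e1 := hcrit _ _ hnew (hX.trans subset_union_left) (hY.trans subset_union_left)
  have e2 : ((A₁ ∪ (C ∩ (B₁ ∩ A₂))) ∩ (B₂ ∪ (D ∩ (B₁ ∩ A₂)))).card
      ≤ F.card + ((C ∩ D) ∩ S).card := by
    refine (card_le_card ?_).trans (card_union_le _ _)
    intro x hx
    have hxF : x ∈ A₁ → x ∈ B₂ → x ∈ F := fun h h' => hAB (mem_inter.2 ⟨h, h'⟩)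
    simp only [mem_inter, mem_union] at hx ⊢
    refine or_iff_not_imp_left.2 fun hf => ?_
    rcases hx with ⟨ha | ⟨hC, hb⟩, ha' | ⟨hD, hb'⟩⟩
    · exact absurd (hxF ha ha') hf
    · exact absurd hD (hT₁ x ((hS x).2 ⟨hb'.1, hb'.2, hf⟩) ha)
    · exact absurd hC (hT₂ x ((hS x).2 ⟨hb.1, hb.2, hf⟩) ha')
    · exact ⟨⟨hC, hD⟩, (hS x).2 ⟨hb.1, hb.2, hf⟩⟩
  have e3 : ((A₁ ∩ B₁) \ F).card = k - F.card := by rw [card_sdiff_of_subset hF, hk]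
  have hFk : F.card ≤ k := hk ▸ card_le_card hF
  have e4 := card_sdiff_add_card_inter (C ∩ D) S
  refine ⟨(C \ S) ∪ ((A₁ ∩ B₁) \ F), D ∪ S, ?_, ?_, ?_, ?_⟩
  · rw [isSep_iff]
    refine ⟨fun x => ?_, fun a b ha hb hab => ?_⟩
    · have := hCD.1 x
      simp only [mem_union, mem_sdiff]; tauto
    · simp only [mem_union, mem_sdiff, mem_inter, not_or, not_and, not_not] at ha hb
      have key : b ∉ C → False := fun h => by
        rcases hCD.2 a b ha.1 h hab with ⟨rfl, -⟩ | ⟨rfl, -⟩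
        · exact ha.2 hu
        · exact ha.2 hv
      have hbS : b ∈ S := hb.1 (not_not.1 key)
      have haF : a ∉ F := fun hf => hSF b hbS a hf hab.symm
      have hbS' := (hS b).1 hbS
      by_cases ha1 : a ∈ B₁
      · have ha2 : a ∉ A₂ := fun h => ha.2 ((hS a).2 ⟨ha1, h, haF⟩)
        by_cases hbB : b ∈ B₂
        · exact key (hT₂ b hbS hbB)
        · exact s₂ b a hbB ha2 hab.symm
      · by_cases hbA : b ∈ A₁
        · exact hbS'.2.2 (hb.2 ⟨hbA, hbS'.1⟩)
        · exact s₁ a b ha1 hbA hab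
  · have e5 : (((C \ S) ∪ ((A₁ ∩ B₁) \ F)) ∩ (D ∪ S)).card
        ≤ ((C ∩ D) \ S).card + ((A₁ ∩ B₁) \ F).card := by
      refine (card_le_card ?_).trans (card_union_le _ _)
      intro x
      simp only [mem_inter, mem_union, mem_sdiff]
      tauto
    omega
  · intro x hx
    simp only [mem_inter, mem_union, mem_sdiff] at hx ⊢
    exact Or.inl ⟨hx.1, fun h => hSZ x h hx.2⟩
  · intro x; simp only [mem_inter, mem_union]; tauto

theorem exists_disjoint_of_card_lt {α : Type*} [DecidableEq α] (P : ℕ → Finset α) {n : ℕ}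
    (hP : ∀ i j, i < j → j < n → Disjoint (P i) (P j)) {D : Finset α} (hD : D.card < n) :
    ∃ i < n, Disjoint (P i) D := by
  by_contra! h
  have h' : ∀ i : Fin n, ∃ x, x ∈ P i ∧ x ∈ D := fun i => not_disjoint_iff.1 (h i i.2)
  choose f hf hfD using h'
  have hinj : Function.Injective f := by
    intro i j hij
    by_contra hne
    rcases lt_or_gt_of_ne hne with hlt | hlt
    · exact disjoint_left.1 (hP i j hlt j.2) (hf i) (hij ▸ hf j)
    · exact disjoint_left.1 (hP j i hlt i.2) (hf j) (hij ▸ hf i)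
  have := card_le_card_of_injOn f (s := univ) (t := D) (fun i _ => hfD i) hinj.injOn
  simp at this
  omega

/-- A set `R` disjoint from `C ∩ D` that is connected in `G - uv` lies strictly on one side. -/
theorem SepDelete.side {G : SimpleGraph V} {u v : V} {C D R : Finset V}
    (h : SepDelete G u v C D) (hR : Disjoint R (C ∩ D)) (hu : u ∉ R)
    (hconn : ∀ Q ⊆ R, Q.Nonempty → (∀ x ∈ Q, ∀ y ∈ R, G.Adj x y → y ∈ Q) → R ⊆ Q) :
    (∀ x ∈ R, x ∉ D) ∨ ∀ x ∈ R, x ∉ C := by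
  have hR' : ∀ x ∈ R, x ∈ C → x ∉ D := fun x hx hC hD =>
    disjoint_left.1 hR hx (mem_inter.2 ⟨hC, hD⟩)
  rcases (R ∩ C).eq_empty_or_nonempty with he | hne
  · exact Or.inr fun x hx hC => notMem_empty x (he ▸ mem_inter.2 ⟨hx, hC⟩)
  · refine Or.inl fun x hx => hR' x hx ?_
    refine (mem_inter.1 (hconn (R ∩ C) inter_subset_left hne ?_ hx)).2
    intro x hx y hy hxy
    simp only [mem_inter] at hx ⊢
    refine ⟨hy, by_contra fun hyC => ?_⟩
    rcases h.2 x y (hR' x hx.1 hx.2) hyC hxy with ⟨rfl, -⟩ | ⟨-, rfl⟩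
    · exact hu hx.1
    · exact hu hy

/-- There is no long sequence of connected strips avoiding `Z`. -/
theorem AllCrit.not_strip {G : SimpleGraph V} {k : ℕ} {Z X Y F : Finset V} {A B : ℕ → Finset V}
    (hk₀ : 0 < k) (hall : AllCrit G k Z) (hdeg : ∀ v, 3 ≤ (G.neighborSet v).ncard)
    (hm : MinSep G k X Y)
    (hT : ∀ i ≤ 4 * k + 2, Tight G k X Y (A i) (B i))
    (hA : ∀ i j, i < j → j ≤ 4 * k + 2 → A i ⊂ A j)
    (hF : ∀ i ≤ 4 * k + 2, F ⊆ A i ∩ B i)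
    (hF' : ∀ i j, i < j → j ≤ 4 * k + 2 → A i ∩ B j ⊆ F)
    (hreg : ∀ x ∈ B 0, x ∈ A (4 * k + 2) → x ∉ F → x ∉ Z ∧ ∀ f ∈ F, ¬ G.Adj x f)
    (hconn : ∀ i < 4 * k + 2, ∀ Q ⊆ (B i ∩ A (i + 1)) \ F, Q.Nonempty →
      (∀ x ∈ Q, ∀ y ∈ (B i ∩ A (i + 1)) \ F, G.Adj x y → y ∈ Q) →
      (B i ∩ A (i + 1)) \ F ⊆ Q) : False := by
  have hA' : ∀ i j, i ≤ j → j ≤ 4 * k + 2 → A i ⊆ A j := fun i j hij hj => by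
    rcases hij.eq_or_lt with rfl | h
    · exact Subset.rfl
    · exact (hA i j h hj).1
  have hB' : ∀ i j, i ≤ j → j ≤ 4 * k + 2 → B j ⊆ B i := fun i j hij hj =>
    (hT i (by omega)).antitone hm (hT j hj) (hA' i j hij hj)
  have hnot : ∀ i j x, i < j → j ≤ 4 * k + 2 → x ∈ A i → x ∈ B j → x ∈ F :=
    fun i j x hij hj h h' => hF' i j hij hj (mem_inter.2 ⟨h, h'⟩)
  obtain ⟨w, hw, hw'⟩ := exists_of_ssubset (hA (2 * k + 1) (2 * k + 2) (by omega) (by omega))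
  have hwF : w ∉ F := fun h => hw' (mem_inter.1 (hF (2 * k + 1) (by omega) h)).1
  have sep := fun i (hi : i ≤ 4 * k + 2) => isSep_iff.1 (hT i hi).1
  have hwB : w ∈ B (2 * k) :=
    hB' (2 * k) (2 * k + 1) (by omega) (by omega) (((sep _ (by omega)).1 w).resolve_left hw')
  have hwA : w ∉ A (2 * k) := fun h => hw' (hA' (2 * k) (2 * k + 1) (by omega) (by omega) h)
  have hwB3 : w ∉ B (2 * k + 3) := fun h =>
    hwF (hnot (2 * k + 2) (2 * k + 3) w (by omega) (by omega) hw h)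
  have hwA3 : w ∈ A (2 * k + 3) := hA' (2 * k + 2) (2 * k + 3) (by omega) (by omega) hw
  have hmid : ∀ x, x ∈ B (2 * k) → x ∈ A (2 * k + 3) → x ∉ F → x ∉ Z ∧ ∀ f ∈ F, ¬ G.Adj x f :=
    fun x h h' => hreg x (hB' 0 (2 * k) (by omega) (by omega) h)
      (hA' (2 * k + 3) (4 * k + 2) (by omega) (by omega) h')
  obtain ⟨w', hadj, hncrit⟩ := exists_adj_not_crit (k := k) (X := X) (Y := Y) (hdeg w)
  have hwB' : w' ∈ B (2 * k) := by
    by_contra h; exact (sep (2 * k) (by omega)).2 w' w h hwA hadj.symm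
  have hwA' : w' ∈ A (2 * k + 3) := by
    by_contra h; exact (sep (2 * k + 3) (by omega)).2 w w' hwB3 h hadj
  have hwF' : w' ∉ F := fun h => (hmid w hwB hwA3 hwF).2 w' h hadj
  have hcrit : ∀ C D, SepDelete G w w' C D → X ⊆ C → Y ⊆ D → k ≤ (C ∩ D).card := by
    intro C D h hX hY
    by_contra! hlt
    exact hncrit (h.isSep_or_crit hm hX hY hlt)
  obtain ⟨X', hX', Y', hY', hc⟩ := hall w w' hadj fun h => (hmid w hwB hwA3 hwF).1 h.1
  obtain ⟨hm', C, D, hCD, hXC, hYD, hk⟩ := Crit.sepDelete hc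
  obtain ⟨a, ha, hadis⟩ := exists_disjoint_of_card_lt
    (fun r => (B (2 * r) ∩ A (2 * r + 1)) \ F) (n := k) (fun i j hij hj => by
      rw [disjoint_left]
      simp only [mem_sdiff, mem_inter]
      exact fun x hx hx' =>
        hx.2 (hnot (2 * i + 1) (2 * j) x (by omega) (by omega) hx.1.2 hx'.1.1)) hk
  obtain ⟨b, hb, hbdis⟩ := exists_disjoint_of_card_lt
    (fun r => (B (2 * k + 3 + 2 * r) ∩ A (2 * k + 3 + 2 * r + 1)) \ F) (n := k)
    (fun i j hij hj => by
      rw [disjoint_left]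
      simp only [mem_sdiff, mem_inter]
      exact fun x hx hx' =>
        hx.2 (hnot (2 * k + 3 + 2 * i + 1) (2 * k + 3 + 2 * j) x
          (by omega) (by omega) hx.1.2 hx'.1.1)) hk
  have sa := hCD.side hadis (by
    simp only [mem_sdiff, mem_inter, not_and, not_not]
    intro h
    exact hnot (2 * a + 1) (2 * k) w (by omega) (by omega) h.2 hwB) (hconn _ (by omega))
  have sb := hCD.side hbdis (by
    simp only [mem_sdiff, mem_inter, not_and, not_not]
    intro h
    exact absurd (hB' (2 * k + 3) (2 * k + 3 + 2 * b) (by omega) (by omega) h.1) hwB3) (hconn _ (by omega))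
  set e := 2 * k + 3 + 2 * b with he
  set S := (B (2 * a) ∩ A (e + 1)) \ F with hS
  have hSmem : ∀ x, x ∈ S ↔ x ∈ B (2 * a) ∧ x ∈ A (e + 1) ∧ x ∉ F := fun x => by
    simp only [hS, mem_sdiff, mem_inter]; tauto
  have hin : ∀ x, x ∈ B (2 * k) → x ∈ A (2 * k + 3) → x ∉ F → x ∈ S := fun x h h' hf =>
    (hSmem x).2 ⟨hB' (2 * a) (2 * k) (by omega) (by omega) h,
      hA' (2 * k + 3) (e + 1) (by omega) (by omega) h', hf⟩
  have hu := hin w hwB hwA3 hwF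
  have hv := hin w' hwB' hwA' hwF'
  have hSreg : ∀ x ∈ S, x ∉ Z ∧ ∀ f ∈ F, ¬ G.Adj x f := fun x hx => by
    obtain ⟨h1, h2, h3⟩ := (hSmem x).1 hx
    exact hreg x (hB' 0 (2 * a) (by omega) (by omega) h1)
      (hA' (e + 1) (4 * k + 2) (by omega) (by omega) h2) h3
  have hta := hT (2 * a) (by omega)
  have htb := hT (e + 1) (by omega)
  have la : ∀ x ∈ S, x ∈ A (2 * a) → x ∈ (B (2 * a) ∩ A (2 * a + 1)) \ F := fun x hx hxA => by
    obtain ⟨h1, h2, h3⟩ := (hSmem x).1 hx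
    simp only [mem_sdiff, mem_inter]
    exact ⟨⟨h1, hA' (2 * a) (2 * a + 1) (by omega) (by omega) hxA⟩, h3⟩
  have lb : ∀ x ∈ S, x ∈ B (e + 1) → x ∈ (B e ∩ A (e + 1)) \ F := fun x hx hxB => by
    obtain ⟨h1, h2, h3⟩ := (hSmem x).1 hx
    simp only [mem_sdiff, mem_inter]
    exact ⟨⟨hB' e (e + 1) (by omega) (by omega) hxB, h2⟩, h3⟩
  have same := fun {C D} (h : SepDelete G w w' C D) =>
    exists_sep_of_same hta.1 htb.1 hSmem hu hv (fun x hx => (hSreg x hx).2)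
      (fun x hx => (hSreg x hx).1) h
  have opp := fun {C D} (h : SepDelete G w w' C D) =>
    exists_sep_of_opposite hta.1 htb.1 hta.2.2.2 hta.2.1 htb.2.2.1
      (hF (2 * a) (by omega))
      (hF' (2 * a) (e + 1) (by omega) (by omega)) hSmem hu hv
      (fun x hx => (hSreg x hx).2) (fun x hx => (hSreg x hx).1) hcrit h
  have contra : ¬ ∃ C' D', IsSep G C' D' ∧ (C' ∩ D').card ≤ (C ∩ D).card ∧ C ∩ Z ⊆ C' ∧
      D ∩ Z ⊆ D' := by
    rintro ⟨C', D', hs, hle, hC', hD'⟩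
    have := hm' C' D' hs ((subset_inter hXC hX').trans hC') ((subset_inter hYD hY').trans hD')
    omega
  have contra' : ¬ ∃ C' D', IsSep G C' D' ∧ (C' ∩ D').card ≤ (D ∩ C).card ∧ D ∩ Z ⊆ C' ∧
      C ∩ Z ⊆ D' := by
    rintro ⟨C', D', hs, hle, hC', hD'⟩
    exact contra ⟨D', C', isSep_symm hs, by rwa [inter_comm, inter_comm C], hD', hC'⟩
  rcases sa with sa | sa <;> rcases sb with sb | sb
  · exact contra (same hCD (fun x hx h => sa x (la x hx h)) fun x hx h => sb x (lb x hx h))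
  · exact contra (opp hCD (fun x hx h => sa x (la x hx h)) fun x hx h => sb x (lb x hx h))
  · exact contra' (opp hCD.symm (fun x hx h => sa x (la x hx h)) fun x hx h => sb x (lb x hx h))
  · exact contra' (same hCD.symm (fun x hx h => sa x (la x hx h)) fun x hx h => sb x (lb x hx h))

/-- If `Q` is a union of components of the strip between two separations, following the first
separation outside `Q` and the second one inside `Q` yields a separation. -/
theorem isSep_mix {G : SimpleGraph V} {A₁ B₁ A₂ B₂ R Q : Finset V} (h₁ : IsSep G A₁ B₁)
    (h₂ : IsSep G A₂ B₂) (hR : ∀ x ∈ B₁, x ∈ A₂ → x ∉ A₁ → x ∈ R)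
    (hQ : ∀ x ∈ Q, ∀ y ∈ R, G.Adj x y → y ∈ Q) :
    IsSep G (A₁ ∪ (A₂ ∩ Q)) (B₁ \ (Q \ B₂)) := by
  obtain ⟨c₁, s₁⟩ := isSep_iff.1 h₁
  obtain ⟨c₂, s₂⟩ := isSep_iff.1 h₂
  rw [isSep_iff]
  refine ⟨fun x => ?_, fun a b ha hb hab => ?_⟩
  · have := c₁ x
    have := c₂ x
    simp only [mem_union, mem_inter, mem_sdiff]
    tauto
  · simp only [mem_union, mem_inter, mem_sdiff, not_or, not_and, not_not] at ha hb
    have ha₁ : a ∈ B₁ := by by_contra h; exact s₁ a b h hb.1 hab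
    obtain ⟨haQ, haB⟩ : a ∈ Q ∧ a ∉ B₂ := by
      by_contra h
      exact ha ha₁ fun h' => by_contra fun h'' => h ⟨h', h''⟩
    have hb₂ : b ∈ A₂ := by by_contra h; exact s₂ a b haB h hab
    exact hb.2 hb₂ (hQ a haQ b (hR b ((c₁ b).resolve_left hb.1) hb₂ hb.1) hab)

theorem mix_inter {α : Type*} [DecidableEq α] {A₁ B₁ A₂ B₂ Q : Finset α} (hA : A₁ ⊆ A₂)
    (hB : B₂ ⊆ B₁) :
    (A₁ ∪ (A₂ ∩ Q)) ∩ (B₁ \ (Q \ B₂)) = ((A₁ ∩ B₁) \ Q) ∪ ((A₂ ∩ B₂) ∩ Q) := by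
  ext x
  have := @hA x
  have := @hB x
  simp only [mem_union, mem_inter, mem_sdiff]
  tauto

theorem card_mix_inter {α : Type*} [DecidableEq α] {A₁ B₁ A₂ B₂ Q : Finset α} (hA : A₁ ⊆ A₂)
    (hB : B₂ ⊆ B₁) :
    ((A₁ ∪ (A₂ ∩ Q)) ∩ (B₁ \ (Q \ B₂))).card + ((A₁ ∩ B₁) ∩ Q).card
      = (A₁ ∩ B₁).card + ((A₂ ∩ B₂) ∩ Q).card := by
  rw [mix_inter hA hB, card_union_of_disjoint, ← card_sdiff_add_card_inter (A₁ ∩ B₁) Q]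
  · omega
  · rw [disjoint_left]
    intro x
    simp only [mem_inter, mem_sdiff]
    tauto

/-- Passing from one tight separation to a later one cannot lower the number of boundary vertices
in a union of components of the strip between them. -/
theorem Tight.card_inter_le {G : SimpleGraph V} {k : ℕ} {X Y A₁ B₁ A₂ B₂ R Q : Finset V}
    (hm : MinSep G k X Y) (h₁ : Tight G k X Y A₁ B₁) (h₂ : Tight G k X Y A₂ B₂) (hA : A₁ ⊆ A₂)
    (hR : ∀ x ∈ B₁, x ∈ A₂ → x ∉ A₁ → x ∈ R) (hQ : ∀ x ∈ Q, ∀ y ∈ R, G.Adj x y → y ∈ Q) :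
    ((A₁ ∩ B₁) ∩ Q).card ≤ ((A₂ ∩ B₂) ∩ Q).card := by
  have hB := h₁.antitone hm h₂ hA
  have h := hm _ _ (isSep_mix h₁.1 h₂.1 hR hQ) (h₁.2.1.trans subset_union_left) (fun y hy => by
    simp only [mem_sdiff, not_and, not_not]
    exact ⟨h₁.2.2.1 hy, fun _ => h₂.2.2.1 hy⟩)
  have := card_mix_inter (Q := Q) hA hB
  have := h₁.2.2.2
  omega

/-- Every chain of tight separations whose boundaries all contain `F` has at most `N` elements. -/
def ChainBound (G : SimpleGraph V) (k : ℕ) (X Y F : Finset V) (N : ℕ) : Prop :=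
  ∀ c : Finset (Finset V), IsChain (· ⊆ ·) (c : Set (Finset V)) →
    (∀ A ∈ c, ∃ B, Tight G k X Y A B ∧ F ⊆ A ∩ B) → c.card ≤ N

theorem isChain_image_Icc {α : Type*} [DecidableEq α] {A : ℕ → Finset α} {i j : ℕ}
    (hA : ∀ l m, i ≤ l → l ≤ m → m ≤ j → A l ⊆ A m) :
    IsChain (· ⊆ ·) (((Icc i j).image A : Finset (Finset α)) : Set (Finset α)) := by
  intro S hS T hT _
  simp only [coe_image, Set.mem_image, coe_Icc, Set.mem_Icc] at hS hT
  obtain ⟨l, hl, rfl⟩ := hS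
  obtain ⟨m, hm, rfl⟩ := hT
  rcases le_total l m with h | h
  · exact Or.inl (hA l m hl.1 h hm.2)
  · exact Or.inr (hA m l hm.1 h hl.2)

theorem ChainBound.card_image_le {G : SimpleGraph V} {k N : ℕ} {X Y F : Finset V}
    (h : ChainBound G k X Y F N) {A B : ℕ → Finset V} {i j : ℕ}
    (hA : ∀ l m, i ≤ l → l ≤ m → m ≤ j → A l ⊆ A m)
    (hT : ∀ l, i ≤ l → l ≤ j → Tight G k X Y (A l) (B l) ∧ F ⊆ A l ∩ B l) :
    ((Icc i j).image A).card ≤ N := by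
  refine h _ (isChain_image_Icc hA) fun S hS => ?_
  obtain ⟨l, hl, rfl⟩ := mem_image.1 hS
  rw [mem_Icc] at hl
  exact ⟨B l, hT l hl.1 hl.2⟩

section Sequence

variable {G : SimpleGraph V} {k N : ℕ} {Z X Y F : Finset V} {A B : ℕ → Finset V} {i j : ℕ}

theorem inter_subset_of_chainBound (hm : MinSep G k X Y)
    (hN : ∀ F', F ⊂ F' → ChainBound G k X Y F' N) (hij : i + N ≤ j)
    (hA : ∀ l m, i ≤ l → l < m → m ≤ j → A l ⊂ A m)
    (hT : ∀ l, i ≤ l → l ≤ j → Tight G k X Y (A l) (B l) ∧ F ⊆ A l ∩ B l) :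
    A i ∩ B j ⊆ F := by
  intro x hx
  by_contra hxF
  rw [mem_inter] at hx
  have hA' : ∀ l m, i ≤ l → l ≤ m → m ≤ j → A l ⊆ A m := fun l m hl hlm hmj => by
    rcases hlm.eq_or_lt with rfl | h
    · exact Subset.rfl
    · exact (hA l m hl h hmj).1
  have := (hN (insert x F) (ssubset_insert hxF)).card_image_le (i := i) (j := j) hA'
    fun l hl hlj => ⟨(hT l hl hlj).1, insert_subset (mem_inter.2
      ⟨hA' i l le_rfl hl hlj hx.1,
        (hT l hl hlj).1.antitone hm (hT j (by omega) le_rfl).1 (hA' l j hl hlj le_rfl) hx.2⟩)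
      (hT l hl hlj).2⟩
  rw [card_image_of_injOn, Nat.card_Icc] at this
  · omega
  · intro l hl m hm hlm
    simp only [coe_Icc, Set.mem_Icc] at hl hm
    by_contra hne
    rcases lt_or_gt_of_ne hne with h | h
    · exact (hA l m hl.1 h hm.2).ne hlm
    · exact (hA m l hm.1 h hl.2).ne hlm.symm

/-- Long strips of tight separations are connected. -/
theorem AllCrit.strip_connected (hall : AllCrit G k Z) (hdeg : ∀ v, ∃ w, G.Adj v w)
    (hm : MinSep G k X Y) (hN : ∀ F', F ⊂ F' → ChainBound G k X Y F' N) (hij : i + N * N ≤ j)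
    (hA : ∀ l m, i ≤ l → l < m → m ≤ j → A l ⊂ A m)
    (hT : ∀ l, i ≤ l → l ≤ j → Tight G k X Y (A l) (B l) ∧ F ⊆ A l ∩ B l)
    (hZ : ∀ x ∈ B i, x ∈ A j → x ∉ F → x ∉ Z ∧ ∀ f ∈ F, ¬ G.Adj x f)
    {Q : Finset V} (hQR : Q ⊆ (B i ∩ A j) \ F) (hne : Q.Nonempty)
    (hQ : ∀ x ∈ Q, ∀ y ∈ (B i ∩ A j) \ F, G.Adj x y → y ∈ Q) : (B i ∩ A j) \ F ⊆ Q := by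
  have hle : i ≤ j := by omega
  have hA' : ∀ l m, i ≤ l → l ≤ m → m ≤ j → A l ⊆ A m := fun l m hl hlm hmj => by
    rcases hlm.eq_or_lt with rfl | h
    · exact Subset.rfl
    · exact (hA l m hl h hmj).1
  have hB' : ∀ l m, i ≤ l → l ≤ m → m ≤ j → B m ⊆ B l := fun l m hl hlm hmj =>
    (hT l hl (by omega)).1.antitone hm (hT m (by omega) hmj).1 (hA' l m hl hlm hmj)
  set R := (B i ∩ A j) \ F with hRdef
  have hRmem : ∀ x, x ∈ R ↔ x ∈ B i ∧ x ∈ A j ∧ x ∉ F := fun x => by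
    simp only [hRdef, mem_sdiff, mem_inter]; tauto
  have hFA : F ⊆ A i ∩ B i := (hT i le_rfl hle).2
  have hsep := isSep_iff.1 (hT i le_rfl hle).1.1
  have hsep' := isSep_iff.1 (hT j hle le_rfl).1.1
  have hRl : ∀ l, l ≤ j → ∀ x ∈ B i, i ≤ l → x ∈ A l → x ∉ A i → x ∈ R :=
    fun l hl x hx hil hxl hxi => (hRmem x).2
      ⟨hx, hA' l j hil hl le_rfl hxl, fun h => hxi (mem_inter.1 (hFA h)).1⟩
  have hle_card : ∀ P : Finset V, (∀ x ∈ P, ∀ y ∈ R, G.Adj x y → y ∈ P) → ∀ l, i ≤ l → l ≤ j →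
      ((A i ∩ B i) ∩ P).card ≤ ((A l ∩ B l) ∩ P).card := fun P hP l hl hlj =>
    (hT i le_rfl hle).1.card_inter_le hm (hT l hl hlj).1 (hA' i l le_rfl hl hlj)
      (fun x hx => hRl l hlj x hx hl) hP
  have hQ' : ∀ x ∈ R \ Q, ∀ y ∈ R, G.Adj x y → y ∈ R \ Q := fun x hx y hy hxy =>
    mem_sdiff.2 ⟨hy, fun h => (mem_sdiff.1 hx).2 (hQ y h x (mem_sdiff.1 hx).1 hxy.symm)⟩
  have hsum : ∀ l, i ≤ l → l ≤ j →
      ((A l ∩ B l) ∩ Q).card + ((A l ∩ B l) ∩ (R \ Q)).card = k - F.card := fun l hl hlj => by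
    rw [← card_union_of_disjoint, ← (hT l hl hlj).1.2.2.2, ← card_sdiff_of_subset (hT l hl hlj).2]
    · congr 1
      ext x
      have h1 := hRmem x
      have h2 := @hQR x
      have h3 : x ∈ A l → x ∈ A j := fun h => hA' l j hl hlj le_rfl h
      have h4 : x ∈ B l → x ∈ B i := fun h => hB' i l le_rfl hl hlj h
      simp only [mem_union, mem_inter, mem_sdiff]
      tauto
    · rw [disjoint_left]
      intro x
      simp only [mem_inter, mem_sdiff]
      tauto
  have hsi := hsum i le_rfl hle
  have heq : ∀ l, i ≤ l → l ≤ j →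
      ((A l ∩ B l) ∩ Q).card = ((A i ∩ B i) ∩ Q).card ∧
      ((A l ∩ B l) ∩ (R \ Q)).card = ((A i ∩ B i) ∩ (R \ Q)).card := fun l hl hlj => by
    have := hsum l hl hlj
    have := hle_card Q hQ l hl hlj
    have := hle_card (R \ Q) hQ' l hl hlj
    omega
  by_contra hnot
  have hne' : (R \ Q).Nonempty := sdiff_nonempty.2 hnot
  have hmeet : ∀ P ⊆ R, P.Nonempty → (∀ x ∈ P, ∀ y ∈ R, G.Adj x y → y ∈ P) →
      ((A j ∩ B j) ∩ P).card = ((A i ∩ B i) ∩ P).card → ((A i ∩ B i) ∩ P).Nonempty := by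
    intro P hPR hP hPcl hcard
    by_contra hemp
    rw [not_nonempty_iff_eq_empty] at hemp
    have hemp' : (A j ∩ B j) ∩ P = ∅ := by rw [← card_eq_zero, hcard, hemp, card_empty]
    refine hP.ne_empty (hall.eq_empty_of_closed hdeg (K := P) ?_ ?_)
    · rw [disjoint_left]
      intro x hx
      obtain ⟨h1, h2, h3⟩ := (hRmem x).1 (hPR hx)
      exact (hZ x h1 h2 h3).1
    · intro x hx y hxy
      obtain ⟨h1, h2, h3⟩ := (hRmem x).1 (hPR hx)
      have hxA : x ∉ A i := fun h =>
        notMem_empty x (hemp ▸ mem_inter.2 ⟨mem_inter.2 ⟨h, h1⟩, hx⟩)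
      have hxB : x ∉ B j := fun h =>
        notMem_empty x (hemp' ▸ mem_inter.2 ⟨mem_inter.2 ⟨h2, h⟩, hx⟩)
      refine hPcl x hx y ((hRmem y).2 ⟨?_, ?_, fun h => (hZ x h1 h2 h3).2 y h hxy⟩) hxy
      · by_contra h; exact hsep.2 y x h hxA hxy.symm
      · by_contra h; exact hsep'.2 x y hxB h hxy
  have hbound : ∀ P P' : Finset V, (∀ x ∈ P, ∀ y ∈ R, G.Adj x y → y ∈ P) → P ⊆ R → P' ⊆ R →
      Disjoint P P' → ((A i ∩ B i) ∩ P').Nonempty →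
      (∀ l, i ≤ l → l ≤ j → ((A l ∩ B l) ∩ P).card = ((A i ∩ B i) ∩ P).card) →
      ((Icc i j).image fun l => A i ∪ (A l ∩ P)).card ≤ N := by
    intro P P' hP hPR hPR' hdis hmt hcard
    refine (hN ((A i ∩ B i) \ P) ?_).card_image_le (B := fun l => B i \ (P \ B l)) ?_ ?_
    · refine ⟨fun x hx => mem_sdiff.2 ⟨hFA hx, fun h => ((hRmem x).1 (hPR h)).2.2 hx⟩, ?_⟩
      obtain ⟨x, hx⟩ := hmt
      rw [mem_inter] at hx
      exact fun h => ((hRmem x).1 (hPR' hx.2)).2.2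
        (h (mem_sdiff.2 ⟨hx.1, fun h' => disjoint_left.1 hdis h' hx.2⟩))
    · exact fun l m hl hlm hmj => union_subset_union_right
        (inter_subset_inter_right (hA' l m hl hlm hmj))
    · intro l hl hlj
      have hTi := (hT i le_rfl hle).1
      have hTl := (hT l hl hlj).1
      refine ⟨⟨isSep_mix hTi.1 hTl.1 (fun x hx => hRl l hlj x hx hl) hP,
        hTi.2.1.trans subset_union_left, fun y hy => ?_, ?_⟩, ?_⟩
      · simp only [mem_sdiff, not_and, not_not]
        exact ⟨hTi.2.2.1 hy, fun _ => hTl.2.2.1 hy⟩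
      · have := card_mix_inter (Q := P) (hA' i l le_rfl hl hlj) (hB' i l le_rfl hl hlj)
        have := hcard l hl hlj
        have := hTi.2.2.2
        omega
      · rw [mix_inter (hA' i l le_rfl hl hlj) (hB' i l le_rfl hl hlj)]
        exact subset_union_left
  have hdis : Disjoint Q (R \ Q) := disjoint_sdiff
  have hj := heq j hle le_rfl
  have b1 := hbound Q (R \ Q) hQ hQR sdiff_subset hdis (hmeet _ sdiff_subset hne' hQ' hj.2)
    fun l hl hlj => (heq l hl hlj).1
  have b2 := hbound (R \ Q) Q hQ' sdiff_subset hQR hdis.symm (hmeet _ hQR hne hQ hj.1)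
    fun l hl hlj => (heq l hl hlj).2
  have hlt : ∀ l m, i ≤ l → l < m → m ≤ j → A i ∪ (A l ∩ Q) = A i ∪ (A m ∩ Q) →
      A i ∪ (A l ∩ (R \ Q)) = A i ∪ (A m ∩ (R \ Q)) → False := by
    intro l m hl hlm hmj e1 e2
    obtain ⟨x, hxm, hxl⟩ := exists_of_ssubset (hA l m hl hlm hmj)
    have hxi : x ∉ A i := fun h => hxl (hA' i l le_rfl hl (by omega) h)
    have hxR : x ∈ R := hRl m hmj x ((hsep.1 x).resolve_left hxi) (by omega) hxm hxi
    rw [Finset.ext_iff] at e1 e2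
    have e1 := e1 x
    have e2 := e2 x
    simp only [mem_union, mem_inter, mem_sdiff] at e1 e2
    tauto
  have : (Icc i j).card ≤ N * N := by
    refine le_trans ?_ (Nat.mul_le_mul b1 b2)
    rw [← card_product]
    refine card_le_card_of_injOn (fun l => (A i ∪ (A l ∩ Q), A i ∪ (A l ∩ (R \ Q)))) ?_ ?_
    · intro l hl
      exact mem_product.2 ⟨mem_image_of_mem _ hl, mem_image_of_mem _ hl⟩
    · intro l hl m hm hlm
      simp only [coe_Icc, Set.mem_Icc] at hl hm
      simp only [Prod.mk.injEq] at hlm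
      by_contra hne
      rcases lt_or_gt_of_ne hne with h | h
      · exact hlt l m hl.1 h hm.2 hlm.1 hlm.2
      · exact hlt m l hm.1 h hl.2 hlm.1.symm hlm.2.symm
  rw [Nat.card_Icc] at this
  omega

end Sequence

theorem AllCrit.exists_closed_neighborhood {G : SimpleGraph V} {k z : ℕ} {Z : Finset V}
    (h : AllCrit G k Z) (hz : Z.card ≤ z) (F : Finset V) :
    ∃ D : Finset V, D.card ≤ z + F.card * (z + 2 ^ z * 2 ^ z * 2) ∧ Z ⊆ D ∧
      ∀ x, ∀ f ∈ F, G.Adj x f → x ∈ D := by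
  choose nb hnb hnb' using h.exists_neighbors
  refine ⟨Z ∪ F.biUnion nb, ?_, subset_union_left, fun x f hf hxf =>
    mem_union_right _ (mem_biUnion.2 ⟨f, hf, hnb' f x hxf.symm⟩)⟩
  refine (card_union_le _ _).trans (add_le_add hz
    (card_biUnion_le_card_mul _ _ _ fun f _ => (hnb f).trans ?_))
  have := Nat.pow_le_pow_right two_pos hz
  gcongr

/-- The length of a chain of tight separations is bounded if all edges are critical. -/
theorem AllCrit.exists_chainBound {k : ℕ} (hk : 0 < k) (z r : ℕ) :
    ∃ N : ℕ, ∀ (V : Type) [Fintype V] [DecidableEq V] (G : SimpleGraph V) (Z X Y : Finset V),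
      Z.card ≤ z → (∀ v, 3 ≤ (G.neighborSet v).ncard) → AllCrit G k Z → MinSep G k X Y →
      ∀ F : Finset V, k + 1 ≤ F.card + r → ChainBound G k X Y F N := by
  induction r with
  | zero =>
    refine ⟨0, fun V _ _ G Z X Y hz hdeg hall hm F hF c hc hcT => ?_⟩
    rw [Nat.le_zero, card_eq_zero, eq_empty_iff_forall_notMem]
    intro A hA
    obtain ⟨B, hT, hFA⟩ := hcT A hA
    have := card_le_card hFA
    have := hT.2.2.2
    omega
  | succ r ih =>
    obtain ⟨N, hN⟩ := ih
    set β := z + k * (z + 2 ^ z * 2 ^ z * 2) with hβ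
    set s := N * N + N + 1 with hs
    refine ⟨(β + 1) * (4 * k + 3) * s, fun V _ _ G Z X Y hz hdeg hall hm F hF c hc hcT => ?_⟩
    by_contra! hlt
    have hN' : ∀ F', F ⊂ F' → ChainBound G k X Y F' N := fun F' hFF' =>
      hN V G Z X Y hz hdeg hall hm F' (by have := card_lt_card hFF'; omega)
    obtain ⟨A, hAc, hA⟩ := exists_seq_of_chain _ c hc hlt.le
    have hB : ∀ i, ∃ B, i < (β + 1) * (4 * k + 3) * s →
        Tight G k X Y (A i) B ∧ F ⊆ A i ∩ B := fun i => by
      by_cases h : i < (β + 1) * (4 * k + 3) * s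
      · obtain ⟨B, hB⟩ := hcT _ (hAc i h)
        exact ⟨B, fun _ => hB⟩
      · exact ⟨∅, fun h' => absurd h' h⟩
    choose B hB using hB
    obtain ⟨D, hD, hZD, hFD⟩ := hall.exists_closed_neighborhood hz F
    have hFk : F.card ≤ k := by
      have h0 : 0 < (β + 1) * (4 * k + 3) * s := by positivity
      have := card_le_card (hB 0 h0).2
      have := (hB 0 h0).1.2.2.2
      omega
    have hidx : ∀ r t, r ≤ β → t ≤ 4 * k + 2 →
        (r * (4 * k + 3) + t) * s < (β + 1) * (4 * k + 3) * s := fun r t hr ht => by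
      refine Nat.mul_lt_mul_of_pos_right ?_ (by omega)
      have := Nat.mul_le_mul_right (4 * k + 3) hr
      rw [add_mul]
      omega
    have hgap : ∀ a b, a < b → a * s + s ≤ b * s := fun a b hab => by
      rw [← Nat.succ_mul]
      exact Nat.mul_le_mul_right s hab
    have hinter : ∀ a b, a < b → b * s < (β + 1) * (4 * k + 3) * s →
        A (a * s) ∩ B (b * s) ⊆ F := fun a b hab hb =>
      inter_subset_of_chainBound hm hN' (by have := hgap a b hab; omega)
        (fun l m _ hlm hmb => hA l m hlm (by omega)) fun l _ hlb => hB l (by omega)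
    obtain ⟨q, hq, hqD⟩ := exists_disjoint_of_card_lt
      (fun q => (B ((q * (4 * k + 3) + 0) * s) ∩ A ((q * (4 * k + 3) + (4 * k + 2)) * s)) \ F)
      (n := β + 1) (D := D) (fun a b hab hb => by
        rw [disjoint_left]
        simp only [mem_sdiff, mem_inter]
        refine fun x hx hx' => hx.2 (hinter (a * (4 * k + 3) + (4 * k + 2)) (b * (4 * k + 3) + 0)
          ?_ (hidx b 0 (by omega) (by omega)) (mem_inter.2 ⟨hx.1.2, hx'.1.1⟩))
        have := Nat.mul_le_mul_right (4 * k + 3) (Nat.succ_le_of_lt hab)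
        rw [Nat.succ_mul] at this
        omega) (by
        have := Nat.mul_le_mul_right (z + 2 ^ z * 2 ^ z * 2) hFk
        omega)
    replace hidx := fun t ht => hidx q t (by omega) ht
    have hreg : ∀ x ∈ B ((q * (4 * k + 3) + 0) * s),
        x ∈ A ((q * (4 * k + 3) + (4 * k + 2)) * s) → x ∉ F →
        x ∉ Z ∧ ∀ f ∈ F, ¬ G.Adj x f := fun x hx hx' hxF => by
      have hxD : x ∉ D := disjoint_left.1 hqD (mem_sdiff.2 ⟨mem_inter.2 ⟨hx, hx'⟩, hxF⟩)
      exact ⟨fun h => hxD (hZD h), fun f hf hxf => hxD (hFD x f hf hxf)⟩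
    have hmono : ∀ a b, a < b → b ≤ 4 * k + 2 →
        A ((q * (4 * k + 3) + a) * s) ⊂ A ((q * (4 * k + 3) + b) * s) := fun a b hab hb =>
      hA _ _ (by have := hgap (q * (4 * k + 3) + a) (q * (4 * k + 3) + b) (by omega); omega)
        (hidx b hb)
    have hmono' : ∀ a b, a ≤ b → b ≤ 4 * k + 2 →
        A ((q * (4 * k + 3) + a) * s) ⊆ A ((q * (4 * k + 3) + b) * s) := fun a b hab hb => by
      rcases hab.eq_or_lt with rfl | h
      · exact Subset.rfl
      · exact (hmono a b h hb).1
    refine hall.not_strip (A := fun t => A ((q * (4 * k + 3) + t) * s))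
      (B := fun t => B ((q * (4 * k + 3) + t) * s)) (F := F) hk hdeg hm
      (fun i hi => (hB _ (hidx i hi)).1) hmono (fun i hi => (hB _ (hidx i hi)).2)
      (fun i j hij hj => hinter _ _ (by omega) (hidx j hj)) hreg ?_
    intro i hi Q hQR hQ hQcl
    have hj := hidx (i + 1) (by omega)
    have hg := hgap (q * (4 * k + 3) + i) (q * (4 * k + 3) + (i + 1)) (by omega)
    refine hall.strip_connected (fun v => ?_) hm hN' (by omega)
      (fun l m _ hlm hmb => hA l m hlm (by omega)) (fun l _ hlb => hB l (by omega)) ?_ hQR hQ hQcl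
    · obtain ⟨a, ha, -⟩ := (Set.two_lt_ncard (Set.toFinite _)).1 (hdeg v)
      exact ⟨a, ha⟩
    · intro x hx hx'
      exact hreg x ((hB _ (hidx 0 (by omega))).1.antitone hm (hB _ (hidx i (by omega))).1
        (hmono' 0 i (by omega) (by omega)) hx) (hmono' (i + 1) _ (by omega) le_rfl hx')

/-- The number of edges is bounded if all edges are critical. -/
theorem AllCrit.exists_ncard_edgeSet_le {k : ℕ} (hk : 0 < k) (z : ℕ) :
    ∃ M : ℕ, ∀ (V : Type) [Fintype V] [DecidableEq V] (G : SimpleGraph V) (Z : Finset V),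
      Z.card ≤ z → (∀ v, 3 ≤ (G.neighborSet v).ncard) → AllCrit G k Z → G.edgeSet.ncard ≤ M := by
  classical
  obtain ⟨N, hN⟩ := AllCrit.exists_chainBound hk z (k + 1)
  obtain ⟨n, hn⟩ := exists_chain_of_card (N + 1)
  refine ⟨z * z + 2 ^ z * 2 ^ z * (k * n), fun V _ _ G Z hz hdeg hall => ?_⟩
  have hcrit : ∀ p : Finset V × Finset V,
      (univ.filter fun e : V × V => Crit G k p.1 p.2 e.1 e.2).card ≤ k * n := by
    rintro ⟨X, Y⟩
    by_cases hm : MinSep G k X Y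
    swap
    · rw [filter_false_of_mem fun e _ he => hm he.1]
      simp
    set 𝓐 := univ.filter fun A : Finset V => ∃ B, Tight G k X Y A B with h𝓐
    have hmem : ∀ A, A ∈ 𝓐 ↔ ∃ B, Tight G k X Y A B := fun A => by simp [h𝓐]
    have hlat : 𝓐.card ≤ n := by
      by_contra! hlt
      obtain ⟨c, hc, hch, hcard⟩ := hn 𝓐 (fun A hA A' hA' => by
        obtain ⟨B, hB⟩ := (hmem A).1 hA
        obtain ⟨B', hB'⟩ := (hmem A').1 hA'
        exact ⟨(hmem _).2 ⟨_, (hB.inter hm hB').1⟩, (hmem _).2 ⟨_, (hB.inter hm hB').2⟩⟩) hlt.le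
      have := hN V G Z X Y hz hdeg hall hm ∅ (by simp) c hch fun A hA => by
        obtain ⟨B, hB⟩ := (hmem A).1 (hc hA)
        exact ⟨B, hB, empty_subset _⟩
      omega
    have hex : ∀ A : Finset V, ∃ T : Finset V, A ∈ 𝓐 →
        T.card ≤ k ∧ ∀ B, Tight G k X Y A B → A ∩ B ⊆ T := fun A => by
      by_cases h : A ∈ 𝓐
      · obtain ⟨B, hB⟩ := (hmem A).1 h
        exact ⟨A ∩ B, fun _ => ⟨hB.2.2.2.le, fun B' hB' =>
          inter_subset_inter_left (hB.antitone hm hB' Subset.rfl)⟩⟩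
      · exact ⟨∅, fun h' => absurd h' h⟩
    choose T hT using hex
    calc (univ.filter fun e : V × V => Crit G k X Y e.1 e.2).card
        ≤ (𝓐.biUnion T).card := by
          refine card_le_card_of_injOn Prod.fst ?_ ?_
          · intro e he
            obtain ⟨A, B, hAB, hu⟩ := (mem_filter.1 he).2.exists_tight
            have hA := (hmem A).2 ⟨B, hAB⟩
            exact mem_biUnion.2 ⟨A, hA, (hT A hA).2 B hAB hu⟩
          · rintro ⟨u, v⟩ he ⟨u', v'⟩ he' h
            obtain rfl : u = u' := h
            have h1 : Crit G k X Y u v := (mem_filter.1 he).2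
            have h2 : Crit G k X Y u v' := (mem_filter.1 he').2
            rw [h1.unique_right h2]
      _ ≤ 𝓐.card * k := card_biUnion_le_card_mul _ _ _ fun A hA => (hT A hA).1
      _ ≤ k * n := by rw [mul_comm]; exact Nat.mul_le_mul_left k hlat
  set P := (Z ×ˢ Z) ∪ (Z.powerset ×ˢ Z.powerset).biUnion fun p =>
    univ.filter fun e : V × V => Crit G k p.1 p.2 e.1 e.2 with hP
  have hPcard : P.card ≤ z * z + 2 ^ z * 2 ^ z * (k * n) := by
    refine (card_union_le _ _).trans (add_le_add ?_
      ((card_biUnion_le_card_mul _ _ _ fun p _ => hcrit p).trans ?_))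
    · rw [card_product]; exact Nat.mul_le_mul hz hz
    · have := Nat.pow_le_pow_right two_pos hz
      rw [card_product, card_powerset]
      gcongr
  have hsub : G.edgeSet ⊆ (P.image fun e => s(e.1, e.2) : Finset (Sym2 V)) := by
    intro e he
    induction e with
    | _ u v =>
      rw [SimpleGraph.mem_edgeSet] at he
      rw [coe_image]
      by_cases hZ : u ∈ Z ∧ v ∈ Z
      · exact ⟨(u, v), mem_coe.2 (mem_union_left _ (mem_product.2 hZ)), rfl⟩
      · obtain ⟨X, hX, Y, hY, hc⟩ := hall u v he hZ
        have hXY : (X, Y) ∈ Z.powerset ×ˢ Z.powerset := by simp [hX, hY]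
        rcases hc with hc | hc
        · exact ⟨(u, v), mem_coe.2 (mem_union_right _ (mem_biUnion.2 ⟨_, hXY, by simpa⟩)), rfl⟩
        · exact ⟨(v, u), mem_coe.2 (mem_union_right _ (mem_biUnion.2 ⟨_, hXY, by simpa⟩)),
            Sym2.eq_swap⟩
  calc G.edgeSet.ncard ≤ (P.image fun e => s(e.1, e.2)).card := by
        rw [← Set.ncard_coe_finset]; exact Set.ncard_le_ncard hsub (Set.toFinite _)
    _ ≤ P.card := card_image_le
    _ ≤ _ := hPcard

/-- If not every edge outside `Z` is critical, some such edge can be deleted while every partition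
of `Z` induced by a small separation remains induced by a small separation. -/
theorem exists_adj_of_not_allCrit {G : SimpleGraph V} {k : ℕ} {Z : Finset V}
    (h : ¬ AllCrit G k Z) : ∃ u v, G.Adj u v ∧ ¬ (u ∈ Z ∧ v ∈ Z) ∧
      ∀ C D, IsSep (G.deleteEdges {s(u, v)}) C D → (C ∩ D).card < k →
        ∃ C' D', IsSep G C' D' ∧ (C' ∩ D').card < k ∧ C ∩ Z ⊆ C' ∧ D ∩ Z ⊆ D' := by
  unfold AllCrit at h
  push Not at h
  obtain ⟨u, v, huv, hZ, hnc⟩ := h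
  refine ⟨u, v, huv, fun h => hZ h.1 h.2, fun C D hCD hk => ?_⟩
  by_contra! hno
  have hm : MinSep G k (C ∩ Z) (D ∩ Z) := fun A B hAB hA hB => by
    by_contra! hlt
    exact hno A B hAB hlt hA hB
  have hdel : SepDelete G u v C D := by
    obtain ⟨hc, he⟩ := isSep_iff.1 hCD
    refine ⟨hc, fun a b ha hb hab => ?_⟩
    have := he a b ha hb
    rw [SimpleGraph.deleteEdges_adj, not_and, not_not] at this
    simpa using this hab
  have hn := hnc (C ∩ Z) inter_subset_right (D ∩ Z) inter_subset_right
  rcases hdel.isSep_or_crit hm inter_subset_left inter_subset_left hk with h | h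
  · exact hn.1 h
  · exact hn.2 h

end TangleDeletion

/-- For every `k ≥ 3` there is an `M` such that for every `k`-tangle `τ` in a connected graph
`G` with minimum degree at least `3` and at least `M` edges, there is an edge `e` of `G` such
that `τ` extends to a `k`-tangle in `G - e`. -/
theorem stmt4 (k : ℕ) (hk : 3 ≤ k) :
    ∃ M : ℕ, ∀ (V : Type) [Fintype V] [DecidableEq V] (G : SimpleGraph V),
      G.Connected → (∀ v : V, 3 ≤ (G.neighborSet v).ncard) → M ≤ G.edgeSet.ncard →
      ∀ τ : Set (Finset V × Finset V), IsTangle G k τ →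
        ∃ e ∈ G.edgeSet, ∃ τ' : Set (Finset V × Finset V),
          IsTangle (G.deleteEdges {e}) k τ' ∧ τ ⊆ τ' := by
  obtain ⟨M, hM⟩ := TangleDeletion.AllCrit.exists_ncard_edgeSet_le (by omega : 0 < k)
    (TangleDeletion.tripleCoverBound (3 * k))
  refine ⟨M + 1, fun V _ _ G _ hdeg hE τ hτ => ?_⟩
  obtain ⟨Z, hZcard, hZ⟩ := TangleDeletion.exists_tripleCover k hτ
  have hnot : ¬ TangleDeletion.AllCrit G k Z := fun h => by
    have := hM V G Z hZcard hdeg h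
    omega
  obtain ⟨u, v, huv, huvZ, h⟩ := TangleDeletion.exists_adj_of_not_allCrit hnot
  exact ⟨s(u, v), huv, TangleDeletion.exists_isTangle_deleteEdges hτ hZ huvZ h⟩
end
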